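/- arXiv:2510.22578 — 2 statements merged into one kernel-verified Lean document; each statement's English description precedes it below -/
import Mathlib

section
/- There exist universal constants C, C', c̃₁, c̃₂, c̃₃ > 0 such that the following holds for all positive integers k ≤ n and m with C·k·log(en/k) ≤ m, and every fixed x₀ ∈ ℂ^n. If A ∈ ℂ^{m×n} is a standard complex Gaussian random matrix, then with probability at least 1 − c̃₃·exp(−c̃₂·m) − exp(−√(m·n)) − 2m·exp(−c̃₁·m/log(en/m)): every x♯ ∈ ℂ^n satisfying |A x♯| = |A x₀| entrywise and ‖x♯‖₁ ≤ ‖z‖₁ for all z ∈ ℂ^n with |A z| = |A x₀| (that is, x♯ is a minimizer of the ℓ₁ norm subject to the phaseless constraint) satisfies dist(x♯, x₀) ≤ C'·σ_k(x₀)₂. -/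
open MeasureTheory ProbabilityTheory Real Finset

/-- The `ℓ_q` (quasi-)norm `(∑ i, ‖x i‖^q)^{1/q}` of a vector with entries in `𝕜 ∈ {ℝ, ℂ}`. -/
noncomputable def lpNorm {ι : Type*} [Fintype ι] {𝕜 : Type*} [RCLike 𝕜] (q : ℝ) (x : ι → 𝕜) : ℝ :=
  (∑ i, ‖x i‖ ^ q) ^ (1 / q)

open Classical in
/-- The number of nonzero entries of a vector. -/
noncomputable def l0Norm {ι : Type*} [Fintype ι] {𝕜 : Type*} [RCLike 𝕜] (x : ι → 𝕜) : ℕ :=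
  (Finset.univ.filter fun i => x i ≠ 0).card

/-- The phase distance `dist_q(x,y) = inf_{|c|=1} ‖x - c • y‖_q`. -/
noncomputable def phaseDist {ι : Type*} [Fintype ι] {𝕜 : Type*} [RCLike 𝕜] (q : ℝ)
    (x y : ι → 𝕜) : ℝ :=
  sInf {d | ∃ c : 𝕜, ‖c‖ = 1 ∧ d = lpNorm q (fun i => x i - c * y i)}

/-- The best `k`-term approximation error `σ_k(x)_q = inf {‖x - z‖_q : ‖z‖₀ ≤ k}`. -/
noncomputable def sigmaK {ι : Type*} [Fintype ι] {𝕜 : Type*} [RCLike 𝕜] (k : ℕ) (q : ℝ)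
    (x : ι → 𝕜) : ℝ :=
  sInf {d | ∃ z : ι → 𝕜, l0Norm z ≤ k ∧ d = lpNorm q (fun i => x i - z i)}

/-- The entrywise modulus `|Ax|` of the matrix-vector product `Ax`. -/
noncomputable def absMv {m n : ℕ} {𝕜 : Type*} [RCLike 𝕜] (A : Fin m → Fin n → 𝕜)
    (x : Fin n → 𝕜) : Fin m → ℝ :=
  fun i => ‖∑ j, A i j * x j‖

/-- `A` satisfies the phaseless bi-Lipschitz condition on `X` with constants `L, U`:
`L·dist(x,y) ≤ ‖|Ax| - |Ay|‖₂ ≤ U·dist(x,y)` for all `x, y ∈ X`. -/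
def PhaselessBiLip {m n : ℕ} {𝕜 : Type*} [RCLike 𝕜] (A : Fin m → Fin n → 𝕜)
    (X : Set (Fin n → 𝕜)) (L U : ℝ) : Prop :=
  ∀ x ∈ X, ∀ y ∈ X,
    L * phaseDist 2 x y ≤ lpNorm 2 (fun i => absMv A x i - absMv A y i) ∧
    lpNorm 2 (fun i => absMv A x i - absMv A y i) ≤ U * phaseDist 2 x y

/-- The law of a standard complex Gaussian random matrix `A ∈ ℂ^{m×n}`: the pushforward, under
the entrywise map `(x,y) ↦ x + i·y`, of the product over the `m·n` entries of the product of two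
real Gaussian measures with mean `0` and variance `1/2`. -/
noncomputable def gaussMatrixComplex (m n : ℕ) : Measure (Fin m → Fin n → ℂ) :=
  Measure.map (fun g : Fin m → Fin n → ℝ × ℝ => fun i j => ((g i j).1 : ℂ) + (g i j).2 * Complex.I)
    (Measure.pi fun _ : Fin m => Measure.pi fun _ : Fin n =>
      (gaussianReal 0 (1/2)).prod (gaussianReal 0 (1/2)))

/-- A volume bound: `ε`-separated finite subsets of the unit ball have at most `(1 + 2/ε)^d`
elements. -/
theorem card_le_of_separated_unitBall {V : Type*} [NormedAddCommGroup V] [NormedSpace ℝ V]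
    [FiniteDimensional ℝ V] {ε : ℝ} (hε : 0 < ε) (s : Finset V) (hs : ∀ c ∈ s, ‖c‖ ≤ 1)
    (h : ∀ c ∈ s, ∀ d ∈ s, c ≠ d → ε ≤ ‖c - d‖) :
    (s.card : ℝ) ≤ (1 + 2 / ε) ^ Module.finrank ℝ V := by
  borelize V
  let μ : Measure V := Measure.addHaar
  let δ : ℝ := ε / 2
  let ρ : ℝ := 1 + ε / 2
  have δpos : 0 < δ := by positivity
  have ρpos : 0 < ρ := by positivity
  set A := ⋃ c ∈ s, Metric.ball (c : V) δ with hA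
  have D : Set.Pairwise (s : Set V) (Function.onFun Disjoint fun c => Metric.ball (c : V) δ) := by
    rintro c hc d hd hcd
    apply Metric.ball_disjoint_ball
    rw [dist_eq_norm]
    have := h c hc d hd hcd
    simp only [δ]; linarith
  have A_subset : A ⊆ Metric.ball (0 : V) ρ := by
    refine Set.iUnion₂_subset fun x hx => ?_
    apply Metric.ball_subset_ball'
    rw [dist_zero_right]
    have := hs x hx
    simp only [δ, ρ]; linarith
  have I :
    (s.card : ENNReal) * ENNReal.ofReal (δ ^ Module.finrank ℝ V) * μ (Metric.ball 0 1) ≤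
      ENNReal.ofReal (ρ ^ Module.finrank ℝ V) * μ (Metric.ball 0 1) :=
    calc
      (s.card : ENNReal) * ENNReal.ofReal (δ ^ Module.finrank ℝ V) * μ (Metric.ball 0 1) = μ A := by
        rw [hA, measure_biUnion_finset D fun c _ => measurableSet_ball]
        simp only [μ.addHaar_ball_of_pos _ δpos]
        simp only [Finset.sum_const, nsmul_eq_mul, mul_assoc]
      _ ≤ μ (Metric.ball (0 : V) ρ) := measure_mono A_subset
      _ = ENNReal.ofReal (ρ ^ Module.finrank ℝ V) * μ (Metric.ball 0 1) := by
        simp only [μ.addHaar_ball_of_pos _ ρpos]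
  have J : (s.card : ENNReal) * ENNReal.ofReal (δ ^ Module.finrank ℝ V) ≤
      ENNReal.ofReal (ρ ^ Module.finrank ℝ V) :=
    (ENNReal.mul_le_mul_iff_left (Metric.measure_ball_pos _ _ zero_lt_one).ne'
      measure_ball_lt_top.ne).1 I
  have K := ENNReal.toReal_le_of_le_ofReal (pow_nonneg ρpos.le _) J
  rw [ENNReal.toReal_mul, ENNReal.toReal_natCast, ENNReal.toReal_ofReal (by positivity)] at K
  have e : 1 + 2 / ε = ρ / δ := by simp only [ρ, δ]; field_simp; ring
  rw [e, div_pow, le_div_iff₀ (by positivity)]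
  exact K

/-- The unit ball of a `d`-dimensional real normed space has an `ε`-net of size
at most `(1 + 2/ε)^d`. -/
theorem exists_net_unitBall (V : Type*) [NormedAddCommGroup V] [NormedSpace ℝ V]
    [FiniteDimensional ℝ V] {ε : ℝ} (hε : 0 < ε) :
    ∃ N : Finset V, (∀ u ∈ N, ‖u‖ ≤ 1) ∧ (∀ x : V, ‖x‖ ≤ 1 → ∃ u ∈ N, ‖x - u‖ ≤ ε) ∧
      (N.card : ℝ) ≤ (1 + 2 / ε) ^ Module.finrank ℝ V := by
  classical
  let P : ℕ → Prop := fun k => ∃ s : Finset V, s.card = k ∧ (∀ c ∈ s, ‖c‖ ≤ 1) ∧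
    (∀ c ∈ s, ∀ d ∈ s, c ≠ d → ε ≤ ‖c - d‖)
  obtain ⟨B, hB⟩ := exists_nat_ge ((1 + 2 / ε) ^ Module.finrank ℝ V)
  have hbd : ∀ k, P k → k ≤ B := by
    rintro k ⟨s, rfl, h1, h2⟩
    exact_mod_cast (card_le_of_separated_unitBall hε s h1 h2).trans hB
  have h0 : P 0 := ⟨∅, by simp⟩
  obtain ⟨N, hcard, hN1, hN2⟩ := Nat.findGreatest_spec (P := P) (Nat.zero_le B) h0
  refine ⟨N, hN1, fun x hx => ?_, card_le_of_separated_unitBall hε N hN1 hN2⟩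
  by_contra! hcon
  have hxN : x ∉ N := fun hxN => by
    have := hcon x hxN
    simp at this
    linarith
  have hP : P (N.card + 1) := by
    refine ⟨insert x N, by simp [hxN], ?_, ?_⟩
    · intro c hc
      rcases Finset.mem_insert.1 hc with rfl | hc
      exacts [hx, hN1 c hc]
    · intro c hc d hd hcd
      rcases Finset.mem_insert.1 hc with rfl | hc' <;>
        rcases Finset.mem_insert.1 hd with rfl | hd'
      · exact absurd rfl hcd
      · exact (hcon d hd').le
      · rw [norm_sub_rev]; exact (hcon c hc').le
      · exact hN2 c hc' d hd' hcd
  have := Nat.le_findGreatest (hbd _ hP) hP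
  omega

/-- An operator bound on a `1/2`-net of the unit ball extends to the whole space. -/
theorem norm_le_of_net {V F : Type*} [NormedAddCommGroup V] [NormedSpace ℂ V]
    [FiniteDimensional ℂ V] [NormedAddCommGroup F] [NormedSpace ℂ F] (f : V →ₗ[ℂ] F)
    {ε B : ℝ} (hε : ε ≤ 1 / 2) (hB : 0 ≤ B) (N : Set V)
    (hN : ∀ x : V, ‖x‖ ≤ 1 → ∃ u ∈ N, ‖x - u‖ ≤ ε) (hf : ∀ u ∈ N, ‖f u‖ ≤ B) (x : V) :
    ‖f x‖ ≤ 2 * B * ‖x‖ := by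
  let g : V →L[ℂ] F := LinearMap.toContinuousLinearMap f
  have hg : ∀ x, g x = f x := fun x => rfl
  have h1 : ‖g‖ ≤ B + ε * ‖g‖ := by
    let : NormedSpace ℝ V := NormedSpace.restrictScalars ℝ ℂ V
    refine ContinuousLinearMap.opNorm_le_of_unit_norm ?_ ?_
    · obtain ⟨u, hu, hu'⟩ := hN 0 (by simp)
      have : 0 ≤ ε := (norm_nonneg _).trans hu'
      positivity
    · intro x hx
      obtain ⟨u, hu, hu'⟩ := hN x hx.le
      calc ‖g x‖ = ‖g u + g (x - u)‖ := by rw [← map_add]; simp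
        _ ≤ ‖g u‖ + ‖g (x - u)‖ := norm_add_le _ _
        _ ≤ B + ‖g‖ * ε := by
          gcongr
          · exact hf u hu
          · exact (g.le_opNorm _).trans (by gcongr)
        _ = B + ε * ‖g‖ := by ring
  have h2 : ‖g‖ ≤ 2 * B := by nlinarith [norm_nonneg g]
  rw [← hg]
  exact (g.le_opNorm x).trans (by gcongr)

/-- The restriction of a vector to a set of coordinates. -/
noncomputable def restrictTo {ι : Type*} [DecidableEq ι] (S : Finset ι)
    (x : EuclideanSpace ℂ ι) : EuclideanSpace ℂ ι :=
  WithLp.toLp 2 fun j => if j ∈ S then x j else 0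

/-- The `ℓ₁` norm of a complex vector. -/
noncomputable def sumNorm {ι : Type*} [Fintype ι] (x : EuclideanSpace ℂ ι) : ℝ := ∑ j, ‖x j‖

/-- The vector `x` vanishes outside `S`. -/
def SupportedOn {ι : Type*} (S : Finset ι) (x : EuclideanSpace ℂ ι) : Prop :=
  ∀ j, j ∉ S → x j = 0

/-- `f` is bounded by `B` on all vectors supported on `s` coordinates. -/
def SparseBound {ι F : Type*} [Fintype ι] [NormedAddCommGroup F] [NormedSpace ℂ F]
    (f : EuclideanSpace ℂ ι →ₗ[ℂ] F) (s : ℕ) (B : ℝ) : Prop :=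
  ∀ S : Finset ι, S.card = s → ∀ x, SupportedOn S x → ‖f x‖ ≤ B * ‖x‖

theorem restrictTo_apply {ι : Type*} [DecidableEq ι] (S : Finset ι) (x : EuclideanSpace ℂ ι) (j : ι) :
    restrictTo S x j = if j ∈ S then x j else 0 := rfl

theorem supportedOn_restrictTo {ι : Type*} [DecidableEq ι] (S : Finset ι) (x : EuclideanSpace ℂ ι) :
    SupportedOn S (restrictTo S x) := fun j hj => by simp [restrictTo_apply, hj]

theorem sumNorm_nonneg {ι : Type*} [Fintype ι] (x : EuclideanSpace ℂ ι) : 0 ≤ sumNorm x :=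
  Finset.sum_nonneg fun _ _ => norm_nonneg _

theorem sumNorm_add_le {ι : Type*} [Fintype ι] (x y : EuclideanSpace ℂ ι) : sumNorm (x + y) ≤ sumNorm x + sumNorm y := by
  unfold sumNorm
  rw [← Finset.sum_add_distrib]
  exact Finset.sum_le_sum fun j _ => by simpa using norm_add_le (x j) (y j)

theorem sumNorm_smul {ι : Type*} [Fintype ι] (c : ℂ) (x : EuclideanSpace ℂ ι) : sumNorm (c • x) = ‖c‖ * sumNorm x := by
  simp [sumNorm, Finset.mul_sum]

theorem norm_sq_le_mul_sumNorm {ι : Type*} [Fintype ι] {b : ℝ} (x : EuclideanSpace ℂ ι) (hx : ∀ j, ‖x j‖ ≤ b) :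
    ‖x‖ ^ 2 ≤ b * sumNorm x := by
  rw [EuclideanSpace.norm_sq_eq, sumNorm, Finset.mul_sum]
  refine Finset.sum_le_sum fun j _ => ?_
  rw [sq]
  exact mul_le_mul_of_nonneg_right (hx j) (norm_nonneg _)

section Sparse

variable {ι : Type*} [Fintype ι] [DecidableEq ι]

theorem restrictTo_add_compl (S : Finset ι) (x : EuclideanSpace ℂ ι) :
    restrictTo S x + restrictTo Sᶜ x = x := by
  ext j
  by_cases h : j ∈ S <;> simp [restrictTo_apply, h]

theorem sumNorm_restrictTo (S : Finset ι) (x : EuclideanSpace ℂ ι) :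
    sumNorm (restrictTo S x) = ∑ j ∈ S, ‖x j‖ := by
  simp only [sumNorm, restrictTo_apply]
  rw [← Finset.sum_filter_add_sum_filter_not Finset.univ (· ∈ S)]
  rw [Finset.sum_congr rfl (g := fun j => ‖x j‖), Finset.sum_eq_zero (s := Finset.univ.filter (· ∉ S))]
  · simp
  · intro j hj; simp at hj; simp [hj]
  · intro j hj; simp at hj; simp [hj]

theorem sumNorm_restrictTo_add_compl (S : Finset ι) (x : EuclideanSpace ℂ ι) :
    sumNorm (restrictTo S x) + sumNorm (restrictTo Sᶜ x) = sumNorm x := by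
  rw [sumNorm_restrictTo, sumNorm_restrictTo]
  exact Finset.sum_add_sum_compl S _

theorem norm_restrictTo_le (S : Finset ι) (x : EuclideanSpace ℂ ι) : ‖restrictTo S x‖ ≤ ‖x‖ := by
  rw [EuclideanSpace.norm_eq, EuclideanSpace.norm_eq]
  apply Real.sqrt_le_sqrt
  refine Finset.sum_le_sum fun j _ => ?_
  rw [restrictTo_apply]
  split_ifs <;> simp

/-- Cauchy–Schwarz on the coordinates in `S`. -/
theorem sumNorm_restrictTo_le (S : Finset ι) (x : EuclideanSpace ℂ ι) :
    sumNorm (restrictTo S x) ≤ √S.card * ‖x‖ := by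
  rw [sumNorm_restrictTo, EuclideanSpace.norm_eq, ← Real.sqrt_mul (by positivity)]
  apply Real.le_sqrt_of_sq_le
  calc (∑ j ∈ S, ‖x j‖) ^ 2 ≤ S.card * ∑ j ∈ S, ‖x j‖ ^ 2 := sq_sum_le_card_mul_sum_sq
    _ ≤ S.card * ∑ j, ‖x j‖ ^ 2 := by
      gcongr
      exact Finset.subset_univ S

theorem sumNorm_le (x : EuclideanSpace ℂ ι) : sumNorm x ≤ √(Fintype.card ι) * ‖x‖ := by
  have h := sumNorm_restrictTo_le Finset.univ x
  have e : restrictTo Finset.univ x = x := by ext j; simp [restrictTo_apply]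
  rwa [e, Finset.card_univ] at h

theorem exists_top_coordinates (x : ι → ℝ) (s : ℕ) (hs : s ≤ Fintype.card ι) :
    ∃ T : Finset ι, T.card = s ∧ ∀ i ∈ T, ∀ j ∉ T, x j ≤ x i := by
  induction s with
  | zero => exact ⟨∅, by simp⟩
  | succ s ih =>
    obtain ⟨T, hT, hT'⟩ := ih (by omega)
    have hne : (Tᶜ : Finset ι).Nonempty := by
      rw [← Finset.card_pos, Finset.card_compl]; omega
    obtain ⟨a, ha, hmax⟩ := Finset.exists_max_image Tᶜ x hne
    have ha' : a ∉ T := by simpa using ha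
    refine ⟨insert a T, by simp [ha', hT], fun i hi j hj => ?_⟩
    have hj' : j ≠ a ∧ j ∉ T := by simpa using hj
    rcases Finset.mem_insert.1 hi with rfl | hi
    · exact hmax j (by simpa using hj'.2)
    · exact hT' i hi j hj'.2

variable {F : Type*} [NormedAddCommGroup F] [NormedSpace ℂ F]

theorem SparseBound.norm_le_of_flat {f : EuclideanSpace ℂ ι →ₗ[ℂ] F} {s : ℕ} {B : ℝ}
    (hf : SparseBound f s B) (hB : 0 ≤ B) (hs : 0 < s) (hsι : s ≤ Fintype.card ι) {b : ℝ}
    (hb : 0 ≤ b) (w : EuclideanSpace ℂ ι) (hw : ∀ j, ‖w j‖ ≤ b) :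
    ‖f w‖ ≤ B * (√s * b + sumNorm w / √s) := by
  have hs' : (0 : ℝ) < √s := Real.sqrt_pos.2 (by exact_mod_cast hs)
  have hss : √(s : ℝ) * √s = s := Real.mul_self_sqrt (by positivity)
  obtain ⟨d, hd⟩ : ∃ d, (Finset.univ.filter fun j => w j ≠ 0).card = d := ⟨_, rfl⟩
  induction d using Nat.strong_induction_on generalizing w b with
  | _ d ih =>
  have hsparse : ∀ S : Finset ι, S.card = s → ∀ v : EuclideanSpace ℂ ι, (∀ j, ‖v j‖ ≤ b) →
      SupportedOn S v → ‖f v‖ ≤ B * (√s * b) := by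
    intro S hS v hv hSv
    refine (hf S hS v hSv).trans (mul_le_mul_of_nonneg_left ?_ hB)
    rw [EuclideanSpace.norm_eq]
    apply Real.sqrt_le_iff.2 ⟨by positivity, ?_⟩
    calc ∑ j, ‖v j‖ ^ 2 = ∑ j ∈ S, ‖v j‖ ^ 2 := by
          symm
          apply Finset.sum_subset (Finset.subset_univ _)
          intro j _ hj; simp [hSv j hj]
      _ ≤ ∑ j ∈ S, b ^ 2 := by
          gcongr with j _; exact hv j
      _ = (√s * b) ^ 2 := by rw [mul_pow, Real.sq_sqrt (by positivity)]; simp [hS]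
  obtain ⟨T, hT, hTtop⟩ := exists_top_coordinates (fun j => ‖w j‖) s hsι
  by_cases hcase : SupportedOn T w
  · refine (hsparse T hT w hw hcase).trans (mul_le_mul_of_nonneg_left ?_ hB)
    have := sumNorm_nonneg w
    have : 0 ≤ sumNorm w / √s := by positivity
    linarith
  · have hT0 : ∀ i ∈ T, w i ≠ 0 := by
      intro i hi h0
      apply hcase
      intro j hj
      have := hTtop i hi j hj
      simpa [h0] using this
    obtain ⟨i0, hi0⟩ : T.Nonempty := by rw [← Finset.card_pos]; omega
    have hflat : ∀ j, ‖restrictTo Tᶜ w j‖ ≤ sumNorm (restrictTo T w) / s := by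
      intro j
      rw [le_div_iff₀ (by positivity), restrictTo_apply]
      by_cases hj : j ∈ T
      · simp [hj, sumNorm_nonneg]
      · simp only [Finset.mem_compl, hj, not_false_eq_true, if_true]
        rw [sumNorm_restrictTo, mul_comm, ← hT, ← nsmul_eq_mul]
        exact Finset.card_nsmul_le_sum _ _ _ fun i hi => hTtop i hi j hj
    have hlt : (Finset.univ.filter fun j => restrictTo Tᶜ w j ≠ 0).card < d := by
      rw [← hd]
      apply Finset.card_lt_card
      refine ⟨?_, ?_⟩
      · intro j hj
        simp [restrictTo_apply] at hj ⊢
        exact hj.2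
      · intro hsub
        have := hsub (show i0 ∈ _ by simp [hT0 i0 hi0])
        simp [restrictTo_apply, hi0] at this
    have h1 := ih _ hlt (b := sumNorm (restrictTo T w) / s)
      (by have := sumNorm_nonneg (restrictTo T w); positivity) (restrictTo Tᶜ w) hflat rfl
    have h2 := hsparse T hT (restrictTo T w) (fun j => by
      rw [restrictTo_apply]; split_ifs
      · exact hw j
      · simpa using hb) (supportedOn_restrictTo T w)
    have h3 : √(s : ℝ) * (sumNorm (restrictTo T w) / s) = sumNorm (restrictTo T w) / √s := by
      rw [eq_div_iff hs'.ne', mul_right_comm, hss]; field_simp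
    calc ‖f w‖ = ‖f (restrictTo T w) + f (restrictTo Tᶜ w)‖ := by
          rw [← map_add, restrictTo_add_compl]
      _ ≤ ‖f (restrictTo T w)‖ + ‖f (restrictTo Tᶜ w)‖ := norm_add_le _ _
      _ ≤ B * (√s * b) + B * (sumNorm (restrictTo T w) / √s + sumNorm (restrictTo Tᶜ w) / √s) := by
          rw [← h3]; exact add_le_add h2 h1
      _ = B * (√s * b + sumNorm w / √s) := by
          rw [← sumNorm_restrictTo_add_compl T w]; ring

/-- Splitting off the `s` largest coordinates leaves a remainder controlled by `‖x‖₁/√s`. -/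
theorem SparseBound.exists_truncation {f : EuclideanSpace ℂ ι →ₗ[ℂ] F} {s : ℕ} {B : ℝ}
    (hf : SparseBound f s B) (hB : 0 ≤ B) (hs : 0 < s) (hsι : s ≤ Fintype.card ι)
    (x : EuclideanSpace ℂ ι) :
    ∃ T : Finset ι, T.card = s ∧ ‖x - restrictTo T x‖ ≤ sumNorm x / √s ∧
      ‖f (x - restrictTo T x)‖ ≤ B * (2 * (sumNorm x / √s)) := by
  have hs' : (0 : ℝ) < √s := Real.sqrt_pos.2 (by exact_mod_cast hs)
  have hss : √(s : ℝ) * √s = s := Real.mul_self_sqrt (by positivity)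
  obtain ⟨T, hT, hTtop⟩ := exists_top_coordinates (fun j => ‖x j‖) s hsι
  have hx0 := sumNorm_nonneg x
  have hle : sumNorm (restrictTo Tᶜ x) ≤ sumNorm x := by
    have := sumNorm_restrictTo_add_compl T x
    have := sumNorm_nonneg (restrictTo T x)
    linarith
  have hle' : sumNorm (restrictTo T x) ≤ sumNorm x := by
    have := sumNorm_restrictTo_add_compl T x
    have := sumNorm_nonneg (restrictTo Tᶜ x)
    linarith
  have hflat : ∀ j, ‖restrictTo Tᶜ x j‖ ≤ sumNorm x / s := by
    intro j
    rw [le_div_iff₀ (by positivity), restrictTo_apply]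
    by_cases hj : j ∈ T
    · simp [hj, sumNorm_nonneg]
    · simp only [Finset.mem_compl, hj, not_false_eq_true, if_true]
      refine le_trans ?_ hle'
      rw [sumNorm_restrictTo, mul_comm, ← hT, ← nsmul_eq_mul]
      exact Finset.card_nsmul_le_sum _ _ _ fun i hi => hTtop i hi j hj
  have e : x - restrictTo T x = restrictTo Tᶜ x :=
    sub_eq_iff_eq_add'.2 (restrictTo_add_compl T x).symm
  have h3 : √(s : ℝ) * (sumNorm x / s) = sumNorm x / √s := by
    rw [eq_div_iff hs'.ne', mul_right_comm, hss]; field_simp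
  refine ⟨T, hT, ?_, ?_⟩
  · rw [e]
    apply le_of_sq_le_sq _ (by positivity)
    calc ‖restrictTo Tᶜ x‖ ^ 2 ≤ sumNorm x / s * sumNorm (restrictTo Tᶜ x) :=
          norm_sq_le_mul_sumNorm _ hflat
      _ ≤ sumNorm x / s * sumNorm x := by gcongr
      _ = (sumNorm x / √s) ^ 2 := by rw [div_pow, Real.sq_sqrt (by positivity)]; ring
  · rw [e]
    refine (hf.norm_le_of_flat hB hs hsι (by positivity) _ hflat).trans ?_
    rw [h3]
    gcongr
    have : sumNorm (restrictTo Tᶜ x) / √s ≤ sumNorm x / √s := by gcongr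
    linarith

end Sparse

section Quotient

variable {ι κ : Type*} [Fintype ι] [DecidableEq ι] [Fintype κ]

omit [DecidableEq ι] in
theorem norm_le_sumNorm (x : EuclideanSpace ℂ ι) : ‖x‖ ≤ sumNorm x := by
  apply le_of_sq_le_sq _ (sumNorm_nonneg x)
  rw [sq (sumNorm x)]
  exact norm_sq_le_mul_sumNorm x fun j =>
    Finset.single_le_sum (f := fun j => ‖x j‖) (fun _ _ => norm_nonneg _) (Finset.mem_univ j)

theorem exists_correction_of_correlated_columns {f : EuclideanSpace ℂ ι →ₗ[ℂ] EuclideanSpace ℂ κ}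
    {s : ℕ} {B t : ℝ} (hf : SparseBound f s B) (hB : 0 < B) (ht : 0 < t)
    {e : EuclideanSpace ℂ κ} (he : ‖e‖ ≤ 1) (he' : 3 / 4 ≤ ‖e‖) {S : Finset ι} (hS : S.card = s)
    (hcor : ∀ j ∈ S, t * ‖e‖ ≤ ‖inner ℂ e (f (EuclideanSpace.single j 1))‖) :
    ∃ u, sumNorm u ≤ 3 / 4 * (t * s / B ^ 2) ∧ ‖e - f u‖ ≤ 1 - s * t ^ 2 / B ^ 2 / 4 := by
  set a : ℝ := s * t ^ 2 / B ^ 2 with ha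
  set θ : ℝ := 3 / 4 * (t / B ^ 2) with hθ
  have hθ0 : 0 ≤ θ := by positivity
  choose c hc1 hc2 using fun j => RCLike.exists_norm_eq_mul_self
    (inner ℂ e (f (EuclideanSpace.single j 1)))
  let u : EuclideanSpace ℂ ι := WithLp.toLp 2 fun j => if j ∈ S then (θ : ℂ) * c j else 0
  have hu : ∀ j, u j = if j ∈ S then (θ : ℂ) * c j else 0 := fun j => rfl
  have huS : SupportedOn S u := fun j hj => by simp [hu, hj]
  have hnorm : ∀ j, ‖u j‖ = if j ∈ S then θ else 0 := by
    intro j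
    rw [hu]; split_ifs
    · simp [hc1, abs_of_nonneg hθ0]
    · simp
  have hsum : sumNorm u = s * θ := by
    simp [sumNorm, hnorm, hS]
  have hu2 : ‖u‖ ^ 2 = s * θ ^ 2 := by
    rw [EuclideanSpace.norm_sq_eq]
    simp [hnorm, hS, ite_pow]
  have hfu : f u = ∑ j, u j • f (EuclideanSpace.single j 1) := by
    conv_lhs => rw [show u = ∑ j, u j • EuclideanSpace.single j (1 : ℂ) by
      ext i; simp [Pi.single_apply]]
    rw [map_sum]
    simp only [map_smul]
  have hinner : s * (θ * (t * ‖e‖)) ≤ RCLike.re (inner ℂ e (f u)) := by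
    rw [hfu, inner_sum]
    have : ∀ j, inner ℂ e (u j • f (EuclideanSpace.single j 1)) =
        if j ∈ S then ((θ * ‖inner ℂ e (f (EuclideanSpace.single j 1))‖ : ℝ) : ℂ) else 0 := by
      intro j
      rw [inner_smul_right, hu]
      split_ifs
      · rw [mul_assoc, ← hc2 j]; push_cast; rfl
      · simp
    simp only [this, Finset.sum_ite_mem, Finset.univ_inter]
    rw [← Complex.ofReal_sum]
    simp only [RCLike.re_to_complex, Complex.ofReal_re]
    rw [← hS, ← nsmul_eq_mul]
    exact Finset.card_nsmul_le_sum _ _ _ fun j hj =>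
      mul_le_mul_of_nonneg_left (hcor j hj) hθ0
  have hfu2 : ‖f u‖ ^ 2 ≤ B ^ 2 * (s * θ ^ 2) := by
    rw [← hu2, ← mul_pow]
    gcongr
    exact hf S hS u huS
  have hid1 : B ^ 2 * (s * θ ^ 2) = 9 / 16 * a := by
    rw [ha, hθ]; field_simp; ring
  have hid2 : s * (θ * (t * (3 / 4))) = 9 / 16 * a := by
    rw [ha, hθ]; field_simp; ring
  have hlow : s * (θ * (t * (3 / 4))) ≤ s * (θ * (t * ‖e‖)) := by gcongr
  have hkey : ‖e - f u‖ ^ 2 ≤ 1 - 9 / 16 * a := by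
    rw [@norm_sub_sq ℂ]
    have : ‖e‖ ^ 2 ≤ 1 := by nlinarith [norm_nonneg e]
    linarith
  have ha0 : 0 ≤ a := by positivity
  have ha1 : 0 ≤ 1 - 9 / 16 * a := (sq_nonneg _).trans hkey
  refine ⟨u, ?_, ?_⟩
  · rw [hsum, hθ]; exact le_of_eq (by ring)
  · apply le_of_sq_le_sq _ (by linarith)
    nlinarith

omit [DecidableEq ι] in
/-- Approximate preimages with geometric error sum up to exact preimages. -/
theorem exists_preimage_of_approx {f : EuclideanSpace ℂ ι →ₗ[ℂ] EuclideanSpace ℂ κ}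
    {q K : ℝ} (hq : 0 ≤ q) (hq1 : q < 1) (hK : 0 ≤ K)
    (h : ∀ e : EuclideanSpace ℂ κ, ‖e‖ = 1 → ∃ u, sumNorm u ≤ K ∧ ‖e - f u‖ ≤ q)
    (e : EuclideanSpace ℂ κ) : ∃ u, f u = e ∧ sumNorm u ≤ K / (1 - q) * ‖e‖ := by
  have h' : ∀ e : EuclideanSpace ℂ κ, ∃ u, sumNorm u ≤ K * ‖e‖ ∧ ‖e - f u‖ ≤ q * ‖e‖ := by
    intro e
    rcases eq_or_ne e 0 with rfl | he
    · exact ⟨0, by simp [sumNorm], by simp⟩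
    · have hn : 0 < ‖e‖ := norm_pos_iff.2 he
      obtain ⟨u, hu1, hu2⟩ := h ((‖e‖⁻¹ : ℂ) • e) (by
        rw [norm_smul]; simp [hn.ne'])
      refine ⟨(‖e‖ : ℂ) • u, ?_, ?_⟩
      · rw [sumNorm_smul, mul_comm]; simpa using mul_le_mul_of_nonneg_right hu1 hn.le
      · have : e - f ((‖e‖ : ℂ) • u) = (‖e‖ : ℂ) • ((‖e‖⁻¹ : ℂ) • e - f u) := by
          rw [smul_sub, smul_smul, map_smul, mul_inv_cancel₀ (by exact_mod_cast hn.ne'), one_smul]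
        rw [this, norm_smul, mul_comm]; simpa using mul_le_mul_of_nonneg_right hu2 hn.le
  choose g hg1 hg2 using h'
  let r : ℕ → EuclideanSpace ℂ κ := fun k => Nat.rec e (fun _ v => v - f (g v)) k
  have r0 : r 0 = e := rfl
  have rs : ∀ k, r (k + 1) = r k - f (g (r k)) := fun k => rfl
  have hr : ∀ k, ‖r k‖ ≤ q ^ k * ‖e‖ := by
    intro k
    induction k with
    | zero => simp [r0]
    | succ k ih =>
      rw [rs]
      calc _ ≤ q * ‖r k‖ := hg2 _
        _ ≤ q * (q ^ k * ‖e‖) := by gcongr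
        _ = _ := by ring
  have hgs : ∀ k, sumNorm (g (r k)) ≤ q ^ k * (K * ‖e‖) := by
    intro k
    calc _ ≤ K * ‖r k‖ := hg1 _
      _ ≤ K * (q ^ k * ‖e‖) := by gcongr; exact hr k
      _ = _ := by ring
  have hgeo := hasSum_geometric_of_lt_one hq hq1
  have hsum : Summable fun k => g (r k) :=
    Summable.of_norm_bounded (hgeo.mul_right (K * ‖e‖)).summable
      fun k => (norm_le_sumNorm _).trans (hgs k)
  have hlim := hsum.hasSum.tendsto_sum_nat
  have hf : Continuous f := f.continuous_of_finiteDimensional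
  have hpart : ∀ k, f (∑ i ∈ Finset.range k, g (r i)) = e - r k := by
    intro k
    induction k with
    | zero => simp [r0]
    | succ k ih => rw [Finset.sum_range_succ, map_add, ih, rs]; abel
  have hr0 : Filter.Tendsto r Filter.atTop (nhds 0) := by
    refine squeeze_zero_norm hr ?_
    simpa using (tendsto_pow_atTop_nhds_zero_of_lt_one hq hq1).mul_const ‖e‖
  refine ⟨∑' k, g (r k), ?_, ?_⟩
  · have h1 := (hf.tendsto _).comp hlim
    have h2 : Filter.Tendsto (fun k => e - r k) Filter.atTop (nhds (e - 0)) :=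
      hr0.const_sub e
    rw [sub_zero] at h2
    refine tendsto_nhds_unique h1 (h2.congr fun k => (hpart k).symm)
  · have hcont : Continuous (sumNorm : EuclideanSpace ℂ ι → ℝ) := by
      unfold sumNorm; fun_prop
    refine le_of_tendsto ((hcont.tendsto _).comp hlim) (Filter.Eventually.of_forall fun k => ?_)
    have hle : ∀ k, sumNorm (∑ i ∈ Finset.range k, g (r i)) ≤
        ∑ i ∈ Finset.range k, q ^ i * (K * ‖e‖) := by
      intro k
      induction k with
      | zero => simp [sumNorm]
      | succ k ih =>
        rw [Finset.sum_range_succ, Finset.sum_range_succ]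
        exact (sumNorm_add_le _ _).trans (add_le_add ih (hgs k))
    refine (hle k).trans ?_
    have := sum_le_hasSum (Finset.range k) (fun i _ => by positivity)
      (hgeo.mul_right (K * ‖e‖))
    refine this.trans (le_of_eq ?_)
    rw [div_eq_mul_inv]; ring

/-- If every point of a fine net is strongly correlated with `s` columns of `f`, then `f` has the
`ℓ₁`-quotient property with constant `6 / t`. -/
theorem exists_preimage_of_correlated_columns
    {f : EuclideanSpace ℂ ι →ₗ[ℂ] EuclideanSpace ℂ κ}
    {s : ℕ} {B t ε : ℝ} (hf : SparseBound f s B) (hB : 0 < B) (ht : 0 < t) (hs : 0 < s)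
    (hε : ε ≤ 1 / 4) (hε' : ε ≤ s * t ^ 2 / B ^ 2 / 8) (N : Set (EuclideanSpace ℂ κ))
    (hN1 : ∀ u ∈ N, ‖u‖ ≤ 1) (hN : ∀ x : EuclideanSpace ℂ κ, ‖x‖ ≤ 1 → ∃ u ∈ N, ‖x - u‖ ≤ ε)
    (hcor : ∀ e ∈ N, ∃ S : Finset ι, S.card = s ∧
      ∀ j ∈ S, t * ‖e‖ ≤ ‖inner ℂ e (f (EuclideanSpace.single j 1))‖)
    (e : EuclideanSpace ℂ κ) : ∃ u, f u = e ∧ sumNorm u ≤ 6 / t * ‖e‖ := by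
  set a : ℝ := s * t ^ 2 / B ^ 2 with ha
  have ha0 : 0 < a := by positivity
  rcases subsingleton_or_nontrivial (EuclideanSpace ℂ κ) with hsub | hnt
  · exact ⟨0, Subsingleton.elim _ _, by simp [sumNorm]; positivity⟩
  have h : ∀ e : EuclideanSpace ℂ κ, ‖e‖ = 1 → ∃ u, sumNorm u ≤ 3 / 4 * (t * s / B ^ 2) ∧
      ‖e - f u‖ ≤ 1 - a / 8 := by
    intro e he
    obtain ⟨v, hv, hev⟩ := hN e he.le
    obtain ⟨S, hS, hS'⟩ := hcor v hv
    have hv' : 3 / 4 ≤ ‖v‖ := by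
      have := norm_sub_norm_le e v
      linarith
    obtain ⟨u, hu1, hu2⟩ := exists_correction_of_correlated_columns hf hB ht (hN1 v hv) hv' hS hS'
    refine ⟨u, hu1, ?_⟩
    calc ‖e - f u‖ = ‖(e - v) + (v - f u)‖ := by congr 1; abel
      _ ≤ ‖e - v‖ + ‖v - f u‖ := norm_add_le _ _
      _ ≤ 1 - a / 8 := by linarith
  obtain ⟨w, hw⟩ := exists_norm_eq (EuclideanSpace ℂ κ) (zero_le_one)
  have hq : 0 ≤ 1 - a / 8 := by
    obtain ⟨u, -, hu⟩ := h w hw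
    exact (norm_nonneg _).trans hu
  obtain ⟨u, hu1, hu2⟩ := exists_preimage_of_approx hq (by linarith) (by positivity) h e
  refine ⟨u, hu1, hu2.trans (le_of_eq ?_)⟩
  congr 1
  rw [ha]; field_simp; ring

end Quotient

/-- The sum `∑ᵢ |Re (conj (P i) * H i)|`. -/
noncomputable def absReSum {κ : Type*} [Fintype κ] (P H : EuclideanSpace ℂ κ) : ℝ :=
  ∑ i, |((starRingEnd ℂ) (P i) * H i).re|

section LowerBound

theorem absReSum_le {κ : Type*} [Fintype κ] (P H : EuclideanSpace ℂ κ) :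
    absReSum P H ≤ ‖P‖ * ‖H‖ := by
  rw [EuclideanSpace.norm_eq, EuclideanSpace.norm_eq]
  refine le_trans ?_ (Real.sum_mul_le_sqrt_mul_sqrt _ _ _)
  refine Finset.sum_le_sum fun i _ => (Complex.abs_re_le_norm _).trans ?_
  simp

theorem absReSum_le_add {κ : Type*} [Fintype κ] (P H P' H' : EuclideanSpace ℂ κ) :
    absReSum P' H' ≤ absReSum P H + ‖P'‖ * ‖H' - H‖ + ‖P' - P‖ * ‖H‖ := by
  refine le_trans ?_ (add_le_add (add_le_add le_rfl (absReSum_le P' (H' - H)))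
    (absReSum_le (P' - P) H))
  unfold absReSum
  rw [← Finset.sum_add_distrib, ← Finset.sum_add_distrib]
  refine Finset.sum_le_sum fun i _ => ?_
  refine le_trans (le_of_eq ?_) ((abs_add_le _ _).trans (add_le_add_left (abs_add_le _ _) _))
  congr 1
  simp
  ring

theorem absReSum_smul {κ : Type*} [Fintype κ] (P H : EuclideanSpace ℂ κ) {a b : ℝ} (ha : 0 ≤ a)
    (hb : 0 ≤ b) : absReSum ((a : ℂ) • P) ((b : ℂ) • H) = a * b * absReSum P H := by
  unfold absReSum
  rw [Finset.mul_sum]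
  refine Finset.sum_congr rfl fun i _ => ?_
  have : (starRingEnd ℂ) (((a : ℂ) • P) i) * ((b : ℂ) • H) i =
      ((a * b : ℝ) : ℂ) * ((starRingEnd ℂ) (P i) * H i) := by
    simp; ring
  rw [this, Complex.re_ofReal_mul, abs_mul, abs_of_nonneg (by positivity)]

variable {ι κ : Type*} [Fintype ι] [DecidableEq ι] [Fintype κ]

theorem SparseBound.exists_net_approx {f : EuclideanSpace ℂ ι →ₗ[ℂ] EuclideanSpace ℂ κ}
    {s : ℕ} {B ε ω : ℝ} (hf : SparseBound f s B) (hB : 0 ≤ B) (hs : 0 < s)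
    (hsι : s ≤ Fintype.card ι) {N : Set (EuclideanSpace ℂ ι)}
    (hN : ∀ S : Finset ι, S.card = s → ∀ x, SupportedOn S x → ‖x‖ ≤ 1 →
      ∃ u ∈ N, SupportedOn S u ∧ ‖u‖ ≤ 1 ∧ ‖x - u‖ ≤ ε)
    {p : EuclideanSpace ℂ ι} (hp : ‖p‖ = 1) (hpω : sumNorm p ≤ ω * √s) :
    ∃ u ∈ N, ‖u‖ ≤ 1 ∧ ‖f u‖ ≤ B ∧ ‖p - u‖ ≤ 2 * ω + ε ∧ ‖f (p - u)‖ ≤ B * (2 * ω + ε) := by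
  have hs' : (0 : ℝ) < √s := Real.sqrt_pos.2 (by exact_mod_cast hs)
  have hdiv : sumNorm p / √s ≤ ω := (div_le_iff₀ hs').2 hpω
  have hω : 0 ≤ ω := le_trans (by have := sumNorm_nonneg p; positivity) hdiv
  obtain ⟨T, hT, hT1, hT2⟩ := hf.exists_truncation hB hs hsι p
  obtain ⟨u, huN, huT, hu1, hu2⟩ := hN T hT (restrictTo T p) (supportedOn_restrictTo T p)
    ((norm_restrictTo_le T p).trans hp.le)
  have e : p - u = (p - restrictTo T p) + (restrictTo T p - u) := by abel
  refine ⟨u, huN, hu1, ?_, ?_, ?_⟩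
  · exact (hf T hT u huT).trans (mul_le_of_le_one_right hB hu1)
  · rw [e]
    refine (norm_add_le _ _).trans ?_
    linarith
  · rw [e, map_add]
    refine (norm_add_le _ _).trans ?_
    have h1 : ‖f (restrictTo T p - u)‖ ≤ B * ε :=
      (hf T hT _ fun j hj => by simp [supportedOn_restrictTo T p j hj, huT j hj]).trans (by gcongr)
    have h2 : B * (2 * (sumNorm p / √s)) ≤ B * (2 * ω) := by gcongr
    linarith

/-- On vectors that are effectively sparse, a linear map bounded on sparse vectors is bounded. -/
theorem SparseBound.norm_le_of_sumNorm_le {f : EuclideanSpace ℂ ι →ₗ[ℂ] EuclideanSpace ℂ κ}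
    {s : ℕ} {B ω : ℝ} (hf : SparseBound f s B) (hB : 0 ≤ B) (hs : 0 < s)
    (hsι : s ≤ Fintype.card ι) (p : EuclideanSpace ℂ ι) (hpω : sumNorm p ≤ ω * √s * ‖p‖) :
    ‖f p‖ ≤ B * (1 + 2 * ω) * ‖p‖ := by
  have hs' : (0 : ℝ) < √s := Real.sqrt_pos.2 (by exact_mod_cast hs)
  have hdiv : sumNorm p / √s ≤ ω * ‖p‖ := (div_le_iff₀ hs').2 (by linarith)
  obtain ⟨T, hT, -, hT2⟩ := hf.exists_truncation hB hs hsι p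
  have h1 := (hf T hT _ (supportedOn_restrictTo T p)).trans
    (mul_le_mul_of_nonneg_left (norm_restrictTo_le T p) hB)
  calc ‖f p‖ = ‖f (restrictTo T p) + f (p - restrictTo T p)‖ := by rw [← map_add]; simp
    _ ≤ B * ‖p‖ + B * (2 * (sumNorm p / √s)) := (norm_add_le _ _).trans (add_le_add h1 hT2)
    _ ≤ B * ‖p‖ + B * (2 * (ω * ‖p‖)) := by gcongr
    _ = _ := by ring

/-- A lower bound for `absReSum (f p) (f h)` on a net extends to all effectively sparse `p, h`
with real inner product. -/
theorem absReSum_ge_of_net {f : EuclideanSpace ℂ ι →ₗ[ℂ] EuclideanSpace ℂ κ}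
    {s : ℕ} {B ε ω b : ℝ} (hf : SparseBound f s B) (hB : 0 ≤ B) (hs : 0 < s)
    (hsι : s ≤ Fintype.card ι) {N : Set (EuclideanSpace ℂ ι)}
    (hN : ∀ S : Finset ι, S.card = s → ∀ x, SupportedOn S x → ‖x‖ ≤ 1 →
      ∃ u ∈ N, SupportedOn S u ∧ ‖u‖ ≤ 1 ∧ ‖x - u‖ ≤ ε)
    (hτ : 2 * ω + ε ≤ 1 / 10) (hb : 12 * B ^ 2 * (2 * ω + ε) ≤ b)
    (hNb : ∀ p ∈ N, ∀ h ∈ N, |(inner ℂ p h).im| ≤ ‖p‖ * ‖h‖ / 2 →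
      b * (‖p‖ * ‖h‖) ≤ absReSum (f p) (f h))
    {p h : EuclideanSpace ℂ ι} (hp : sumNorm p ≤ ω * √s * ‖p‖) (hh : sumNorm h ≤ ω * √s * ‖h‖)
    (hph : (inner ℂ p h).im = 0) :
    b / 2 * (‖p‖ * ‖h‖) ≤ absReSum (f p) (f h) := by
  have unit : ∀ p h : EuclideanSpace ℂ ι, ‖p‖ = 1 → ‖h‖ = 1 → sumNorm p ≤ ω * √s →
      sumNorm h ≤ ω * √s → (inner ℂ p h).im = 0 → b / 2 ≤ absReSum (f p) (f h) := by
    clear hp hh hph p h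
    intro p h hp1 hh1 hp hh hph
    obtain ⟨u, huN, hu1, hfu, hpu, hfpu⟩ := hf.exists_net_approx hB hs hsι hN hp1 hp
    obtain ⟨v, hvN, hv1, hfv, hhv, hfhv⟩ := hf.exists_net_approx hB hs hsι hN hh1 hh
    set τ := 2 * ω + ε with hτdef
    have hτ0 : 0 ≤ τ := (norm_nonneg _).trans hpu
    have hu : 9 / 10 ≤ ‖u‖ := by have := norm_sub_norm_le p u; linarith
    have hv : 9 / 10 ≤ ‖v‖ := by have := norm_sub_norm_le h v; linarith
    have huv : 81 / 100 ≤ ‖u‖ * ‖v‖ := by nlinarith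
    have him : |(inner ℂ u v).im| ≤ 2 * τ := by
      have e : (inner ℂ u v).im = -(inner ℂ (p - u) h).im - (inner ℂ u (h - v)).im := by
        rw [inner_sub_left, inner_sub_right]; simp [hph]
      rw [e]
      calc |(-(inner ℂ (p - u) h).im - (inner ℂ u (h - v)).im)|
          ≤ |(inner ℂ (p - u) h).im| + |(inner ℂ u (h - v)).im| := by
            refine (abs_sub _ _).trans ?_
            rw [abs_neg]
        _ ≤ ‖p - u‖ * ‖h‖ + ‖u‖ * ‖h - v‖ := add_le_add
            ((Complex.abs_im_le_norm _).trans (norm_inner_le_norm _ _))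
            ((Complex.abs_im_le_norm _).trans (norm_inner_le_norm _ _))
        _ ≤ τ * 1 + 1 * τ := by gcongr; exact hh1.le
        _ = 2 * τ := by ring
    have h1 := hNb u huN v hvN (by linarith)
    have h2 := absReSum_le_add (f p) (f h) (f u) (f v)
    have h3 : ‖f v - f h‖ ≤ B * τ := by rw [norm_sub_rev, ← map_sub]; exact hfhv
    have h4 : ‖f u - f p‖ ≤ B * τ := by rw [norm_sub_rev, ← map_sub]; exact hfpu
    have h5 : ‖f h‖ ≤ B + B * τ := by
      have := norm_sub_norm_le (f h) (f v)
      rw [← map_sub] at this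
      linarith
    have h6 : ‖f u‖ * ‖f v - f h‖ ≤ B * (B * τ) := by gcongr
    have h7 : ‖f u - f p‖ * ‖f h‖ ≤ (B * τ) * (B + B * τ) := by gcongr
    have h8 : (B * τ) * (B + B * τ) ≤ 2 * (B ^ 2 * τ) := by
      have : 0 ≤ B ^ 2 * τ := by positivity
      nlinarith
    have hb0 : 0 ≤ b := le_trans (by positivity) hb
    have h9 : b * (81 / 100) ≤ b * (‖u‖ * ‖v‖) := by gcongr
    nlinarith
  rcases eq_or_ne p 0 with rfl | hp0
  · simp [absReSum]
  rcases eq_or_ne h 0 with rfl | hh0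
  · simp [absReSum]
  have hpn : 0 < ‖p‖ := norm_pos_iff.2 hp0
  have hhn : 0 < ‖h‖ := norm_pos_iff.2 hh0
  have hsc : ∀ x : EuclideanSpace ℂ ι, 0 < ‖x‖ → sumNorm x ≤ ω * √s * ‖x‖ →
      ‖((‖x‖⁻¹ : ℝ) : ℂ) • x‖ = 1 ∧ sumNorm (((‖x‖⁻¹ : ℝ) : ℂ) • x) ≤ ω * √s := by
    intro x hx hxs
    constructor
    · rw [norm_smul]; simp [hx.ne']
    · rw [sumNorm_smul]
      simp only [Complex.norm_real, norm_inv, norm_norm]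
      rw [inv_mul_le_iff₀ hx]; linarith
  have key := unit _ _ (hsc p hpn hp).1 (hsc h hhn hh).1 (hsc p hpn hp).2 (hsc h hhn hh).2 (by
    rw [inner_smul_left, inner_smul_right, Complex.conj_ofReal, Complex.im_ofReal_mul,
      Complex.im_ofReal_mul, hph]; simp)
  rw [map_smul, map_smul, absReSum_smul _ _ (by positivity) (by positivity)] at key
  calc b / 2 * (‖p‖ * ‖h‖) ≤ (‖p‖⁻¹ * ‖h‖⁻¹ * absReSum (f p) (f h)) * (‖p‖ * ‖h‖) := by gcongr
    _ = absReSum (f p) (f h) := by field_simp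

end LowerBound

section Recovery

variable {ι κ : Type*} [Fintype ι] [DecidableEq ι] [Fintype κ]

omit [DecidableEq ι] in
theorem absReSum_add_sub_le (X Y V : EuclideanSpace ℂ κ) (h : ∀ i, |‖X i‖ - ‖Y i‖| ≤ ‖V i‖) :
    absReSum (X + Y) (X - Y) ≤ ‖V‖ * (‖X + Y‖ + ‖X - Y‖) := by
  rw [mul_add, EuclideanSpace.norm_eq V, EuclideanSpace.norm_eq (X + Y),
    EuclideanSpace.norm_eq (X - Y)]
  refine le_trans ?_ (add_le_add (Real.sum_mul_le_sqrt_mul_sqrt _ _ _)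
    (Real.sum_mul_le_sqrt_mul_sqrt _ _ _))
  unfold absReSum
  rw [← Finset.sum_add_distrib]
  refine Finset.sum_le_sum fun i _ => ?_
  have e : ((starRingEnd ℂ) ((X + Y) i) * (X - Y) i).re =
      (‖X i‖ - ‖Y i‖) * (‖X i‖ + ‖Y i‖) := by
    have h1 : ‖X i‖ ^ 2 = (X i).re * (X i).re + (X i).im * (X i).im := by
      rw [← Complex.normSq_eq_norm_sq, Complex.normSq_apply]
    have h2 : ‖Y i‖ ^ 2 = (Y i).re * (Y i).re + (Y i).im * (Y i).im := by
      rw [← Complex.normSq_eq_norm_sq, Complex.normSq_apply]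
    have : (‖X i‖ - ‖Y i‖) * (‖X i‖ + ‖Y i‖) = ‖X i‖ ^ 2 - ‖Y i‖ ^ 2 := by ring
    rw [this, h1, h2]
    simp
    ring
  rw [e, abs_mul, ← mul_add, abs_of_nonneg (by positivity : 0 ≤ ‖X i‖ + ‖Y i‖)]
  refine mul_le_mul (h i) ?_ (by positivity) (norm_nonneg _)
  · have h1 : ‖(2 : ℂ) * X i‖ ≤ ‖(X + Y) i‖ + ‖(X - Y) i‖ := by
      refine le_trans (le_of_eq ?_) (norm_add_le _ _)
      congr 1; simp; ring
    have h2 : ‖(2 : ℂ) * Y i‖ ≤ ‖(X + Y) i‖ + ‖(X - Y) i‖ := by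
      refine le_trans (le_of_eq ?_) (norm_sub_le _ _)
      congr 1; simp; ring
    rw [norm_mul] at h1 h2
    norm_num at h1 h2 ⊢
    linarith

/-- The cone condition satisfied by the error of an `ℓ₁` minimizer. -/
theorem sumNorm_sub_le_of_sumNorm_le {T : Finset ι} {k : ℕ} (hT : T.card ≤ k)
    {x y : EuclideanSpace ℂ ι} (hy : SupportedOn T y) {d : ℝ} (hx : sumNorm x ≤ sumNorm y + d) :
    sumNorm (x - y) ≤ 2 * (√k * ‖x - y‖) + d := by
  have h1 := sumNorm_restrictTo_add_compl T (x - y)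
  have h2 := sumNorm_restrictTo_add_compl T x
  have h3 : restrictTo Tᶜ (x - y) = restrictTo Tᶜ x := by
    ext j
    by_cases hj : j ∈ T <;> simp [restrictTo_apply, hj, hy j]
  have h4 : sumNorm y ≤ sumNorm (restrictTo T x) + sumNorm (restrictTo T (x - y)) := by
    have e : y = restrictTo T x + (-1 : ℂ) • restrictTo T (x - y) := by
      ext j
      by_cases hj : j ∈ T <;> simp [restrictTo_apply, hj, hy j]
    calc sumNorm y = sumNorm (restrictTo T x + (-1 : ℂ) • restrictTo T (x - y)) := by rw [← e]
      _ ≤ _ := sumNorm_add_le _ _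
      _ = _ := by rw [sumNorm_smul]; simp
  have h5 : sumNorm (restrictTo T (x - y)) ≤ √k * ‖x - y‖ :=
    (sumNorm_restrictTo_le T _).trans (by gcongr)
  rw [h3] at h1
  linarith

set_option maxHeartbeats 1000000 in
/-- Deterministic recovery guarantee for `ℓ₁` minimization under phaseless constraints. -/
theorem exists_phase_norm_sub_le {f : EuclideanSpace ℂ ι →ₗ[ℂ] EuclideanSpace ℂ κ}
    {s k : ℕ} {ω c D K ℓ μ : ℝ} (hω : 0 < ω) (hc : 0 < c) (hD : 0 ≤ D) (hK : 0 ≤ K)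
    (hℓ : 0 < ℓ) (hμ : 0 < μ)
    (hlow : ∀ p h : EuclideanSpace ℂ ι, sumNorm p ≤ ω * √s * ‖p‖ → sumNorm h ≤ ω * √s * ‖h‖ →
      (inner ℂ p h).im = 0 → c * μ ^ 2 * (‖p‖ * ‖h‖) ≤ absReSum (f p) (f h))
    (hup : ∀ p : EuclideanSpace ℂ ι, sumNorm p ≤ ω * √s * ‖p‖ → ‖f p‖ ≤ D * μ * ‖p‖)
    {T : Finset ι} (hT : T.card ≤ k) (hk : 8 * √k ≤ ω * √s) {x₀ u xs : EuclideanSpace ℂ ι}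
    (hv : ‖f (x₀ - restrictTo T x₀)‖ ≤ K * μ * ‖x₀ - restrictTo T x₀‖)
    (hu : f u = f (x₀ - restrictTo T x₀))
    (hu' : sumNorm u ≤ ℓ * √s * ‖x₀ - restrictTo T x₀‖)
    (hxs : ∀ i, ‖f xs i‖ = ‖f x₀ i‖)
    (hmin : ∀ z, (∀ i, ‖f z i‖ = ‖f x₀ i‖) → sumNorm xs ≤ sumNorm z) :
    ∃ a : ℂ, ‖a‖ = 1 ∧ ‖xs - a • x₀‖ ≤
      (2 * ℓ / ω + 2 * K * D / c + 1) * ‖x₀ - restrictTo T x₀‖ := by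
  set y := restrictTo T x₀ with hy
  set v := x₀ - y with hvdef
  have hyT : SupportedOn T y := supportedOn_restrictTo T x₀
  obtain ⟨a, ha, ha'⟩ := RCLike.exists_norm_eq_mul_self (inner ℂ y xs)
  set x := a • xs with hx
  have hyx : inner ℂ y x = ((‖(inner ℂ y xs : ℂ)‖ : ℝ) : ℂ) := by
    rw [hx, inner_smul_right, ← ha']; rfl
  have hyx_re : 0 ≤ (inner ℂ y x).re := by rw [hyx, Complex.ofReal_re]; positivity
  have hyx_im : (inner ℂ y x).im = 0 := by rw [hyx, Complex.ofReal_im]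
  have hxy_im : (inner ℂ x y).im = 0 := by
    rw [← inner_conj_symm, Complex.conj_im, hyx_im, neg_zero]
  have hxy_re : (inner ℂ x y).re = (inner ℂ y x).re := by
    rw [← inner_conj_symm, Complex.conj_re]
  have hphase : ‖xs - (starRingEnd ℂ) a • x₀‖ = ‖x - x₀‖ := by
    have h1 : (starRingEnd ℂ) a * a = 1 := by
      rw [mul_comm, Complex.mul_conj, Complex.normSq_eq_norm_sq, ha]; simp
    have : xs - (starRingEnd ℂ) a • x₀ = (starRingEnd ℂ) a • (x - x₀) := by
      rw [smul_sub, hx, smul_smul, h1, one_smul]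
    rw [this, norm_smul, RCLike.norm_conj, ha, one_mul]
  refine ⟨(starRingEnd ℂ) a, by rw [RCLike.norm_conj, ha], ?_⟩
  rw [hphase]
  have hxv : ‖x - x₀‖ ≤ ‖x - y‖ + ‖v‖ := by
    rw [show x - x₀ = (x - y) - v by rw [hvdef]; abel]
    exact norm_sub_le _ _
  have hx₀ : y + v = x₀ := by rw [hvdef]; abel
  have hfx : ∀ i, ‖f x i‖ = ‖f x₀ i‖ := by
    intro i
    rw [hx, map_smul, PiLp.smul_apply, norm_smul, ha, one_mul, hxs]
  have hxsum : sumNorm x ≤ sumNorm y + sumNorm u := by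
    rw [hx, sumNorm_smul, ha, one_mul]
    refine (hmin (y + u) fun i => ?_).trans (sumNorm_add_le _ _)
    rw [map_add, hu, ← map_add, hx₀]
  have hcone := sumNorm_sub_le_of_sumNorm_le hT hyT hxsum
  suffices hmain : ‖x - y‖ ≤ (2 * ℓ / ω + 2 * K * D / c) * ‖v‖ by
    linarith
  have hn1 : ‖x + y‖ ^ 2 = ‖x‖ ^ 2 + 2 * (inner ℂ x y).re + ‖y‖ ^ 2 := @norm_add_sq ℂ _ _ _ _ x y
  have hn2 : ‖x - y‖ ^ 2 = ‖x‖ ^ 2 - 2 * (inner ℂ x y).re + ‖y‖ ^ 2 := @norm_sub_sq ℂ _ _ _ _ x y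
  rw [hxy_re] at hn1 hn2
  have hhp : ‖x - y‖ ≤ ‖x + y‖ := le_of_sq_le_sq (by linarith) (norm_nonneg _)
  have hyp : ‖y‖ ≤ ‖x + y‖ :=
    le_of_sq_le_sq (by nlinarith [norm_nonneg x]) (norm_nonneg _)
  have hv0 := norm_nonneg v
  have hA : 0 ≤ 2 * ℓ / ω := by positivity
  have hB : 0 ≤ 2 * K * D / c := by positivity
  by_cases hsmall : ‖x - y‖ ≤ 2 * ℓ / ω * ‖v‖
  · nlinarith
  push Not at hsmall
  have hsmall' : ℓ * ‖v‖ ≤ ω / 2 * ‖x - y‖ := by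
    have : ℓ * ‖v‖ = ω / 2 * (2 * ℓ / ω * ‖v‖) := by field_simp
    rw [this]; gcongr
  have hd : sumNorm u ≤ ω / 2 * √s * ‖x - y‖ := by
    calc sumNorm u ≤ √s * (ℓ * ‖v‖) := by linarith
      _ ≤ √s * (ω / 2 * ‖x - y‖) := by gcongr
      _ = _ := by ring
  have hkh : √k * ‖x - y‖ ≤ ω / 8 * √s * ‖x - y‖ := by
    gcongr; linarith
  have hh : sumNorm (x - y) ≤ ω * √s * ‖x - y‖ := by
    have : 0 ≤ ω * √s * ‖x - y‖ := by positivity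
    linarith
  have hh' : sumNorm (x - y) ≤ 3 / 4 * (ω * √s) * ‖x - y‖ := by linarith
  have hp : sumNorm (x + y) ≤ ω * √s * ‖x + y‖ := by
    have e : x + y = (x - y) + (2 : ℂ) • y := by rw [two_smul]; abel
    have h1 : sumNorm (x + y) ≤ sumNorm (x - y) + 2 * sumNorm y := by
      rw [e]
      refine (sumNorm_add_le _ _).trans ?_
      rw [sumNorm_smul]; simp
    have h2 : sumNorm y ≤ √k * ‖y‖ := by
      have e2 : restrictTo T y = y := by
        ext j; by_cases hj : j ∈ T <;> simp [restrictTo_apply, hj, hyT j]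
      calc sumNorm y = sumNorm (restrictTo T y) := by rw [e2]
        _ ≤ √T.card * ‖y‖ := sumNorm_restrictTo_le T y
        _ ≤ √k * ‖y‖ := by gcongr
    have h3 : √k * ‖y‖ ≤ ω / 8 * √s * ‖x + y‖ := by
      gcongr; linarith
    have h4 : 3 / 4 * (ω * √s) * ‖x - y‖ ≤ 3 / 4 * (ω * √s) * ‖x + y‖ := by gcongr
    linarith
  have him : (inner ℂ (x + y) (x - y)).im = 0 := by
    rw [inner_add_left, inner_sub_right, inner_sub_right]
    simp only [Complex.add_im, Complex.sub_im, hxy_im, hyx_im]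
    rw [inner_self_eq_norm_sq_to_K, inner_self_eq_norm_sq_to_K]
    simp [← Complex.ofReal_pow]
  have key := hlow _ _ hp hh him
  rw [map_add, map_sub] at key
  have key2 := absReSum_add_sub_le (f x) (f y) (f v) fun i => by
    rw [hfx]
    refine (abs_norm_sub_norm_le _ _).trans (le_of_eq ?_)
    rw [hvdef, map_sub]; rfl
  rw [← map_add, ← map_sub] at key2 key
  have key3 : ‖f v‖ * (‖f (x + y)‖ + ‖f (x - y)‖) ≤
      (K * μ * ‖v‖) * (D * μ * ‖x + y‖ + D * μ * ‖x + y‖) := by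
    gcongr
    · exact hup _ hp
    · exact (hup _ hh).trans (by gcongr)
  have key4 : ‖x + y‖ * (c * ‖x - y‖) ≤ ‖x + y‖ * (2 * K * D * ‖v‖) := by
    have h5 : μ ^ 2 * (‖x + y‖ * (c * ‖x - y‖)) ≤ μ ^ 2 * (‖x + y‖ * (2 * K * D * ‖v‖)) := by
      calc _ = c * μ ^ 2 * (‖x + y‖ * ‖x - y‖) := by ring
        _ ≤ _ := key.trans (key2.trans key3)
        _ = _ := by ring
    exact le_of_mul_le_mul_left h5 (by positivity)
  have hpos : 0 < ‖x + y‖ := lt_of_lt_of_le (lt_of_le_of_lt (by positivity) hsmall) hhp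
  have key5 := le_of_mul_le_mul_left key4 hpos
  have key6 : ‖x - y‖ ≤ 2 * K * D / c * ‖v‖ := by
    rw [div_mul_eq_mul_div, le_div_iff₀ hc]; linarith
  nlinarith

end Recovery

section ComplexGaussian

/-- The standard complex Gaussian law: real and imaginary parts are independent centred real
Gaussians of variance `1/2`. -/
noncomputable def complexGaussian : Measure ℂ :=
  ((gaussianReal 0 (1/2)).prod (gaussianReal 0 (1/2))).map
    (fun z : ℝ × ℝ => (z.1 : ℂ) + z.2 * Complex.I)

instance : IsProbabilityMeasure complexGaussian :=
  Measure.isProbabilityMeasure_map (by fun_prop)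

/-- The law of a vector with independent standard complex Gaussian entries. -/
noncomputable def complexGaussianVec (ι : Type*) [Fintype ι] : Measure (ι → ℂ) :=
  Measure.pi fun _ => complexGaussian

instance {ι : Type*} [Fintype ι] : IsProbabilityMeasure (complexGaussianVec ι) :=
  inferInstanceAs (IsProbabilityMeasure (Measure.pi _))

theorem gaussMatrixComplex_eq_pi (m n : ℕ) :
    gaussMatrixComplex m n = Measure.pi fun _ : Fin m => complexGaussianVec (Fin n) := by
  have h1 : ∀ n : ℕ, Measure.map (fun (g : Fin n → ℝ × ℝ) j => ((g j).1 : ℂ) + (g j).2 * Complex.I)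
      (Measure.pi fun _ : Fin n => (gaussianReal 0 (1/2)).prod (gaussianReal 0 (1/2))) =
      complexGaussianVec (Fin n) := by
    intro n
    have : ∀ i : Fin n, SigmaFinite (Measure.map (fun z : ℝ × ℝ => (z.1 : ℂ) + z.2 * Complex.I)
        ((gaussianReal 0 (1/2)).prod (gaussianReal 0 (1/2)))) := fun _ =>
      inferInstanceAs (SigmaFinite complexGaussian)
    exact Measure.pi_map_pi
      (f := fun (_ : Fin n) (z : ℝ × ℝ) => (z.1 : ℂ) + z.2 * Complex.I) fun i => by fun_prop
  have : ∀ i : Fin m, SigmaFinite (Measure.map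
      (fun (g : Fin n → ℝ × ℝ) j => ((g j).1 : ℂ) + (g j).2 * Complex.I)
      (Measure.pi fun _ : Fin n => (gaussianReal 0 (1/2)).prod (gaussianReal 0 (1/2)))) := fun _ => by
    rw [h1]; infer_instance
  rw [gaussMatrixComplex, Measure.pi_map_pi (f := fun (_ : Fin m) (g : Fin n → ℝ × ℝ) j =>
    ((g j).1 : ℂ) + (g j).2 * Complex.I) fun i => by fun_prop]
  simp only [h1]

theorem map_swap_pi_pi {ι κ X : Type*} [Fintype ι] [Fintype κ] [MeasurableSpace X] (μ : Measure X)
    [IsProbabilityMeasure μ] :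
    (Measure.pi fun _ : ι => Measure.pi fun _ : κ => μ).map (fun A j i => A i j) =
      Measure.pi fun _ : κ => Measure.pi fun _ : ι => μ := by
  symm
  refine Measure.pi_eq_generateFrom (fun _ => generateFrom_pi) (fun _ => isPiSystem_pi)
    (fun _ => ⟨fun _ => Set.univ, fun _ => ⟨fun _ => Set.univ, fun _ _ => MeasurableSet.univ, by simp⟩,
      fun _ => measure_lt_top _ _, by simp [Set.iUnion_const]⟩) ?_
  intro s hs
  choose t ht hts using hs
  have hmeas : Measurable fun (A : ι → κ → X) (j : κ) (i : ι) => A i j := by fun_prop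
  have hms : ∀ j, MeasurableSet (s j) := fun j => by
    rw [← hts j]; exact MeasurableSet.univ_pi fun i => ht j i trivial
  rw [Measure.map_apply hmeas (MeasurableSet.univ_pi hms)]
  have e : (fun (A : ι → κ → X) (j : κ) (i : ι) => A i j) ⁻¹' Set.univ.pi s =
      Set.univ.pi fun i => Set.univ.pi fun j => t j i := by
    ext A
    simp only [Set.mem_preimage, Set.mem_univ_pi, ← hts]
    exact forall_comm
  rw [e, Measure.pi_pi]
  simp only [← hts, Measure.pi_pi]
  exact Finset.prod_comm

theorem charFun_complexGaussian (t : ℂ) :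
    charFun complexGaussian t = Complex.exp (-(‖t‖ ^ 2 / 4 : ℝ)) := by
  have h : ∀ s : ℝ, ∫ x, Complex.exp (x * s * Complex.I) ∂(gaussianReal 0 (1/2)) =
      Complex.exp (-(s ^ 2 / 4 : ℝ)) := by
    intro s
    have := charFun_gaussianReal (μ := 0) (v := 1/2) s
    rw [charFun_apply] at this
    simp only [RCLike.inner_apply, conj_trivial] at this
    convert this using 2
    · ext x; push_cast; ring_nf
    · push_cast; ring
  rw [charFun_apply, complexGaussian, integral_map (by fun_prop) (by fun_prop)]
  have e : ∀ z : ℝ × ℝ, Complex.exp ((inner ℝ ((z.1 : ℂ) + z.2 * Complex.I) t : ℝ) * Complex.I) =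
      Complex.exp (z.1 * t.re * Complex.I) * Complex.exp (z.2 * t.im * Complex.I) := by
    intro z
    rw [← Complex.exp_add, Complex.inner]
    congr 1
    simp
    ring
  simp only [e]
  rw [integral_prod_mul (fun x : ℝ => Complex.exp (x * t.re * Complex.I))
    (fun x : ℝ => Complex.exp (x * t.im * Complex.I)), h, h, ← Complex.exp_add]
  congr 1
  rw [← Complex.normSq_eq_norm_sq, Complex.normSq_apply]
  push_cast
  ring

variable {ι : Type*} [Fintype ι]

theorem integral_exp_sum_complexGaussianVec (w : ι → ℂ) :
    ∫ a, Complex.exp ((∑ j, inner ℝ (a j) (w j) : ℝ) * Complex.I) ∂(complexGaussianVec ι) =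
      Complex.exp (-((∑ j, ‖w j‖ ^ 2) / 4 : ℝ)) := by
  have e : ∀ a : ι → ℂ, Complex.exp ((∑ j, inner ℝ (a j) (w j) : ℝ) * Complex.I) =
      ∏ j, Complex.exp ((inner ℝ (a j) (w j) : ℝ) * Complex.I) := by
    intro a
    rw [← Complex.exp_sum]; push_cast; rw [Finset.sum_mul]
  simp only [e]
  rw [complexGaussianVec, integral_fintype_prod_eq_prod
    (fun j (x : ℂ) => Complex.exp ((inner ℝ x (w j) : ℝ) * Complex.I))]
  simp only [← charFun_apply, charFun_complexGaussian]
  rw [← Complex.exp_sum]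
  push_cast
  rw [Finset.sum_neg_distrib, Finset.sum_div]

theorem inner_mul_eq (a u t : ℂ) :
    (inner ℝ (a * u) t : ℝ) = inner ℝ a ((starRingEnd ℂ) u * t) := by
  simp [Complex.inner]
  ring

theorem charFun_map_sum_mul (u : EuclideanSpace ℂ ι) (t : ℂ) :
    charFun ((complexGaussianVec ι).map fun a => ∑ j, a j * u j) t =
      Complex.exp (-(‖u‖ ^ 2 * ‖t‖ ^ 2 / 4 : ℝ)) := by
  rw [charFun_apply, integral_map (Measurable.aemeasurable (by fun_prop)) (by fun_prop)]
  simp only [sum_inner, inner_mul_eq]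
  rw [integral_exp_sum_complexGaussianVec (fun j => (starRingEnd ℂ) (u j) * t)]
  simp only [norm_mul, RCLike.norm_conj, mul_pow]
  rw [← Finset.sum_mul, EuclideanSpace.norm_sq_eq]

theorem map_sum_mul_complexGaussianVec (u : EuclideanSpace ℂ ι) :
    (complexGaussianVec ι).map (fun a => ∑ j, a j * u j) =
      complexGaussian.map (fun x => ‖u‖ • x) := by
  have : IsProbabilityMeasure ((complexGaussianVec ι).map (fun a => ∑ j, a j * u j)) :=
    Measure.isProbabilityMeasure_map (Measurable.aemeasurable (by fun_prop))
  have : IsProbabilityMeasure (complexGaussian.map (fun x => ‖u‖ • x)) :=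
    Measure.isProbabilityMeasure_map (by fun_prop)
  refine Measure.ext_of_charFun ?_
  ext t
  rw [charFun_map_sum_mul, charFun_map_smul, charFun_complexGaussian, norm_smul, mul_pow,
    norm_norm]

theorem indepFun_sum_mul_of_inner_eq_zero {p w : EuclideanSpace ℂ ι} (h : inner ℂ p w = 0) :
    IndepFun (fun a : ι → ℂ => ∑ j, a j * p j) (fun a => ∑ j, a j * w j) (complexGaussianVec ι) := by
  rw [indepFun_iff_charFun_prod (Measurable.aemeasurable (by fun_prop))
    (Measurable.aemeasurable (by fun_prop))]
  intro t
  rw [charFun_map_sum_mul, charFun_map_sum_mul, ← Complex.exp_add, charFun_apply,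
    integral_map (Measurable.aemeasurable (by fun_prop)) (by fun_prop)]
  have e : ∀ a : ι → ℂ, (inner ℝ (WithLp.toLp 2 (∑ j, a j * p j, ∑ j, a j * w j)) t : ℝ) =
      ∑ j, inner ℝ (a j) ((starRingEnd ℂ) (p j) * t.ofLp.1 + (starRingEnd ℂ) (w j) * t.ofLp.2) := by
    intro a
    rw [WithLp.prod_inner_apply]
    simp only [sum_inner, inner_mul_eq, inner_add_right, Finset.sum_add_distrib]
  simp only [e]
  rw [integral_exp_sum_complexGaussianVec
    (fun j => (starRingEnd ℂ) (p j) * t.ofLp.1 + (starRingEnd ℂ) (w j) * t.ofLp.2)]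
  have key : ∑ j, ‖(starRingEnd ℂ) (p j) * t.ofLp.1 + (starRingEnd ℂ) (w j) * t.ofLp.2‖ ^ 2 =
      ‖p‖ ^ 2 * ‖t.ofLp.1‖ ^ 2 + ‖w‖ ^ 2 * ‖t.ofLp.2‖ ^ 2 := by
    have h0 : ∑ j, (starRingEnd ℂ) (p j) * w j = 0 := by
      rw [← h, PiLp.inner_apply]
      exact Finset.sum_congr rfl fun j _ => by rw [RCLike.inner_apply, mul_comm]
    have h1 : ∀ j, ‖(starRingEnd ℂ) (p j) * t.ofLp.1 + (starRingEnd ℂ) (w j) * t.ofLp.2‖ ^ 2 =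
        ‖p j‖ ^ 2 * ‖t.ofLp.1‖ ^ 2 + ‖w j‖ ^ 2 * ‖t.ofLp.2‖ ^ 2 +
        2 * (((starRingEnd ℂ) (p j) * w j) * (t.ofLp.1 * (starRingEnd ℂ) t.ofLp.2)).re := by
      intro j
      simp only [← Complex.normSq_eq_norm_sq]
      rw [Complex.normSq_add, Complex.normSq_mul, Complex.normSq_mul, Complex.normSq_conj,
        Complex.normSq_conj, map_mul, Complex.conj_conj]
      congr 3
      ring
    simp only [h1]
    rw [Finset.sum_add_distrib, Finset.sum_add_distrib, ← Finset.sum_mul, ← Finset.sum_mul,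
      ← Finset.mul_sum, ← Complex.re_sum, ← Finset.sum_mul, h0, EuclideanSpace.norm_sq_eq,
      EuclideanSpace.norm_sq_eq]
    simp
  rw [key]
  congr 1
  push_cast
  ring

end ComplexGaussian

section Tail

theorem measureReal_pi_le_prod_le {X κ : Type*} [MeasurableSpace X] [Fintype κ] (μ : Measure X)
    [IsProbabilityMeasure μ] {f : X → ℝ} (hf : ∀ x, 0 ≤ f x) (hfi : Integrable f μ) {θ : ℝ}
    (hθ : 0 < θ) :
    (Measure.pi fun _ : κ => μ).real {a | θ ≤ ∏ i, f (a i)} ≤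
      (∫ x, f x ∂μ) ^ Fintype.card κ / θ := by
  have h := mul_meas_ge_le_integral_of_nonneg (μ := Measure.pi fun _ : κ => μ)
    (f := fun a => ∏ i, f (a i)) (ae_of_all _ fun a => Finset.prod_nonneg fun i _ => hf _)
    (Integrable.fintype_prod fun _ => hfi) θ
  rw [integral_fintype_prod_eq_pow] at h
  rw [le_div_iff₀ hθ]
  linarith

open Classical in
/-- A Chernoff lower-tail bound for the number of independent trials landing in a set. -/
theorem measureReal_pi_card_le_le {X κ : Type*} [MeasurableSpace X] [Fintype κ] (μ : Measure X)
    [IsProbabilityMeasure μ] {E : Set X} (hE : MeasurableSet E) {p : ℝ} (hp : p ≤ μ.real E)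
    (r : ℝ) :
    (Measure.pi fun _ : κ => μ).real {a | ((Finset.univ.filter fun i => a i ∈ E).card : ℝ) ≤ r} ≤
      Real.exp (r - p * Fintype.card κ / 2) := by
  have he : Real.exp (-1) ≤ 1 / 2 := by
    have := Real.exp_neg_one_lt_d9; linarith
  let f : X → ℝ := fun x => 1 + E.indicator (fun _ => Real.exp (-1) - 1) x
  have hf : ∀ x, f x = Real.exp (if x ∈ E then -1 else 0) := by
    intro x
    by_cases hx : x ∈ E <;> simp [f, hx]
  have hfi : Integrable f μ :=
    (integrable_const _).add ((integrable_const _).indicator hE)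
  have hint : ∫ x, f x ∂μ ≤ Real.exp (-(p / 2)) := by
    have e : ∫ x, f x ∂μ = 1 + μ.real E * (Real.exp (-1) - 1) := by
      simp only [f]
      rw [integral_add (integrable_const _) ((integrable_const _).indicator hE),
        integral_indicator_const _ hE]
      simp
    rw [e]
    have h1 := Real.add_one_le_exp (-(p / 2))
    nlinarith [measureReal_nonneg (μ := μ) (s := E)]
  have h := measureReal_pi_le_prod_le (κ := κ) μ (fun x => by rw [hf]; positivity) hfi
    (Real.exp_pos (-r))
  have hset : {a : κ → X | Real.exp (-r) ≤ ∏ i, f (a i)} =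
      {a | ((Finset.univ.filter fun i => a i ∈ E).card : ℝ) ≤ r} := by
    ext a
    simp only [hf, ← Real.exp_sum, Set.mem_ofPred_eq, Real.exp_le_exp]
    rw [← Finset.sum_filter]
    simp
  rw [hset] at h
  refine h.trans ?_
  have hint0 : 0 ≤ ∫ x, f x ∂μ := integral_nonneg fun x => by
    simp only [Pi.zero_apply]; rw [hf]; positivity
  calc (∫ x, f x ∂μ) ^ Fintype.card κ / Real.exp (-r)
      ≤ Real.exp (-(p / 2)) ^ Fintype.card κ / Real.exp (-r) := by gcongr
    _ = Real.exp (r - p * Fintype.card κ / 2) := by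
      rw [← Real.exp_nat_mul, ← Real.exp_sub]; congr 1; ring

theorem exists_integrable_exp_normSq_complexGaussian :
    ∃ c : ℝ, 0 < c ∧ Integrable (fun x => Real.exp (c * ‖x‖ ^ 2)) complexGaussian := by
  obtain ⟨c, hc, hi⟩ := IsGaussian.exists_integrable_exp_sq (gaussianReal 0 (1/2))
  refine ⟨c, hc, ?_⟩
  rw [complexGaussian, integrable_map_measure (by fun_prop) (by fun_prop)]
  refine (hi.mul_prod hi).congr (ae_of_all _ fun z => ?_)
  simp only [Function.comp]
  rw [← Real.exp_add, ← Complex.normSq_eq_norm_sq, Complex.normSq_add_mul_I]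
  simp
  ring

theorem integral_comp_sum_mul {ι : Type*} [Fintype ι] (u : EuclideanSpace ℂ ι) {g : ℂ → ℝ}
    (hg : Continuous g) :
    ∫ a, g (∑ j, a j * u j) ∂(complexGaussianVec ι) = ∫ x, g (‖u‖ • x) ∂complexGaussian := by
  have hm : Measurable fun a : ι → ℂ => ∑ j, a j * u j := by fun_prop
  have hm' : Measurable fun x : ℂ => ‖u‖ • x := by fun_prop
  rw [← integral_map hm.aemeasurable hg.aestronglyMeasurable, map_sum_mul_complexGaussianVec,
    integral_map hm'.aemeasurable hg.aestronglyMeasurable]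

theorem integrable_comp_sum_mul {ι : Type*} [Fintype ι] (u : EuclideanSpace ℂ ι) {g : ℂ → ℝ}
    (hg : Continuous g) (hi : Integrable (fun x => g (‖u‖ • x)) complexGaussian) :
    Integrable (fun a : ι → ℂ => g (∑ j, a j * u j)) (complexGaussianVec ι) := by
  have hm : Measurable fun a : ι → ℂ => ∑ j, a j * u j := by fun_prop
  have hm' : Measurable fun x : ℂ => ‖u‖ • x := by fun_prop
  refine (integrable_map_measure hg.aestronglyMeasurable hm.aemeasurable).mp ?_
  rw [map_sum_mul_complexGaussianVec, integrable_map_measure hg.aestronglyMeasurable hm'.aemeasurable]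
  exact hi

/-- Upper tail of `‖A u‖²` for a Gaussian matrix `A` and a fixed vector `u`. -/
theorem exists_measureReal_normSq_gt_le :
    ∃ K : ℝ, 0 < K ∧ ∀ (m n : ℕ) (u : EuclideanSpace ℂ (Fin n)),
      (Measure.pi fun _ : Fin m => complexGaussianVec (Fin n)).real
        {A | K * m * ‖u‖ ^ 2 < ∑ i, ‖∑ j, A i j * u j‖ ^ 2} ≤ Real.exp (-(3 * m)) := by
  obtain ⟨c, hc, hi⟩ := exists_integrable_exp_normSq_complexGaussian
  set M := ∫ x, Real.exp (c * ‖x‖ ^ 2) ∂complexGaussian with hM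
  have hM1 : 1 ≤ M := by
    calc (1 : ℝ) = ∫ x, 1 ∂complexGaussian := by simp
      _ ≤ M := integral_mono (integrable_const _) hi fun x => Real.one_le_exp (by positivity)
  have hlog : 0 ≤ Real.log M := Real.log_nonneg hM1
  refine ⟨(Real.log M + 3) / c, by positivity, fun m n u => ?_⟩
  rcases eq_or_ne u 0 with rfl | hu
  · simp [Real.exp_nonneg]
  have hu' : 0 < ‖u‖ := norm_pos_iff.mpr hu
  let g : ℂ → ℝ := fun x => Real.exp (c * ‖x‖ ^ 2 / ‖u‖ ^ 2)
  have hgc : Continuous g := by fun_prop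
  have hg : (fun x => g (‖u‖ • x)) = fun x => Real.exp (c * ‖x‖ ^ 2) := by
    ext x; simp only [g]; congr 1; rw [norm_smul, norm_norm]; field_simp
  have hfi := integrable_comp_sum_mul u hgc (by rw [hg]; exact hi)
  have hfint := integral_comp_sum_mul u hgc
  rw [hg, ← hM] at hfint
  have h := measureReal_pi_le_prod_le (κ := Fin m) (complexGaussianVec (Fin n))
    (fun a => (Real.exp_pos _).le) hfi (Real.exp_pos ((Real.log M + 3) * m))
  rw [hfint, Fintype.card_fin] at h
  refine le_trans (measureReal_mono ?_) (h.trans (le_of_eq ?_))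
  · intro A hA
    simp only [Set.mem_ofPred_eq] at hA ⊢
    rw [← Real.exp_sum, Real.exp_le_exp, ← Finset.sum_div, ← Finset.mul_sum, le_div_iff₀ (by positivity)]
    have e : (Real.log M + 3) * m * ‖u‖ ^ 2 = c * ((Real.log M + 3) / c * m * ‖u‖ ^ 2) := by
      field_simp
    rw [e]
    exact mul_le_mul_of_nonneg_left hA.le hc.le
  · nth_rewrite 1 [← Real.exp_log (by linarith : 0 < M)]
    rw [← Real.exp_nat_mul, ← Real.exp_sub]
    congr 1; ring

theorem le_gaussianReal_Ici (t : ℝ) :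
    ENNReal.ofReal (Real.exp (-(2 * t ^ 2 + 2)) / √π) ≤ gaussianReal 0 (1/2) (Set.Ici t) := by
  have hsub : Set.Icc t (t + 1) ⊆ Set.Ici t := Set.Icc_subset_Ici_self
  refine le_trans ?_ (measure_mono hsub)
  rw [gaussianReal_apply _ (by norm_num)]
  calc ENNReal.ofReal (Real.exp (-(2 * t ^ 2 + 2)) / √π)
      = ∫⁻ x in Set.Icc t (t + 1), ENNReal.ofReal (Real.exp (-(2 * t ^ 2 + 2)) / √π) := by
        rw [setLIntegral_const, Real.volume_Icc]; simp
    _ ≤ _ := by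
        refine setLIntegral_mono (measurable_gaussianPDF _ _) fun x hx => ?_
        refine ENNReal.ofReal_le_ofReal ?_
        rw [gaussianPDFReal]
        have e1 : √(2 * π * ((1 / 2 : NNReal) : ℝ)) = √π := by congr 1; push_cast; ring
        rw [e1, div_eq_mul_inv, mul_comm]
        gcongr
        push_cast
        nlinarith [hx.1, hx.2, sq_nonneg (t - 1)]

/-- A lower bound for the upper tail of `|∑ aⱼ uⱼ|`. -/
theorem le_measureReal_norm_sum_mul_ge {n : ℕ} (u : EuclideanSpace ℂ (Fin n)) (t : ℝ) :
    Real.exp (-(2 * t ^ 2 + 2)) / √π ≤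
      (complexGaussianVec (Fin n)).real {a | t * ‖u‖ ≤ ‖∑ j, a j * u j‖} := by
  have hS : MeasurableSet {x : ℂ | t * ‖u‖ ≤ ‖x‖} :=
    measurableSet_le (by fun_prop) (by fun_prop)
  have h1 : complexGaussianVec (Fin n) {a | t * ‖u‖ ≤ ‖∑ j, a j * u j‖} =
      complexGaussian {x | t * ‖u‖ ≤ ‖‖u‖ • x‖} := by
    have := congrArg (fun ν : Measure ℂ => ν {x : ℂ | t * ‖u‖ ≤ ‖x‖})
      (map_sum_mul_complexGaussianVec u)
    simp only at this
    rwa [Measure.map_apply (by fun_prop) hS, Measure.map_apply (by fun_prop) hS] at this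
  have hS' : MeasurableSet {x : ℂ | t ≤ ‖x‖} := measurableSet_le (by fun_prop) (by fun_prop)
  have h2 : gaussianReal 0 (1/2) (Set.Ici t) ≤ complexGaussian {x | t * ‖u‖ ≤ ‖‖u‖ • x‖} := by
    calc gaussianReal 0 (1/2) (Set.Ici t)
        = ((gaussianReal 0 (1/2)).prod (gaussianReal 0 (1/2))) (Set.Ici t ×ˢ Set.univ) := by
          rw [Measure.prod_prod, measure_univ, mul_one]
      _ ≤ ((gaussianReal 0 (1/2)).prod (gaussianReal 0 (1/2)))
          ((fun z : ℝ × ℝ => (z.1 : ℂ) + z.2 * Complex.I) ⁻¹' {x | t ≤ ‖x‖}) := by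
          refine measure_mono fun z hz => ?_
          have hz1 : t ≤ z.1 := hz.1
          have := Complex.abs_re_le_norm ((z.1 : ℂ) + z.2 * Complex.I)
          simp only [Complex.add_re, Complex.ofReal_re, Complex.re_ofReal_mul, Complex.I_re,
            mul_zero, add_zero] at this
          exact hz1.trans ((le_abs_self _).trans this)
      _ = complexGaussian {x | t ≤ ‖x‖} := by
          rw [complexGaussian, Measure.map_apply (by fun_prop) hS']
      _ ≤ _ := by
          refine measure_mono fun x hx => ?_
          simp only [Set.mem_ofPred_eq, norm_smul, norm_norm] at hx ⊢
          rw [mul_comm]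
          gcongr
  rw [measureReal_def, h1]
  exact (ENNReal.ofReal_le_iff_le_toReal (measure_ne_top _ _)).mp ((le_gaussianReal_Ici t).trans h2)

end Tail

section SmallBall

theorem gaussianReal_pos_of_volume_pos {s : Set ℝ} (hs : volume s ≠ 0) :
    gaussianReal 0 (1/2) s ≠ 0 := fun h =>
  hs (gaussianReal_absolutelyContinuous' 0 (by norm_num) h)

theorem complexGaussian_reProdIm_ne_zero {s t : Set ℝ} (hs : MeasurableSet s)
    (ht : MeasurableSet t) (hs0 : volume s ≠ 0) (ht0 : volume t ≠ 0) :
    complexGaussian {z | z.re ∈ s ∧ z.im ∈ t} ≠ 0 := by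
  have hm : MeasurableSet {z : ℂ | z.re ∈ s ∧ z.im ∈ t} :=
    (Complex.measurable_re hs).inter (Complex.measurable_im ht)
  rw [complexGaussian, Measure.map_apply (by fun_prop) hm]
  have e : (fun z : ℝ × ℝ => (z.1 : ℂ) + z.2 * Complex.I) ⁻¹' {z | z.re ∈ s ∧ z.im ∈ t} =
      s ×ˢ t := by
    ext z; simp
  rw [e, Measure.prod_prod]
  exact mul_ne_zero (gaussianReal_pos_of_volume_pos hs0) (gaussianReal_pos_of_volume_pos ht0)

theorem measureReal_sum_mul_mem_ge {ι : Type*} [Fintype ι] (u : EuclideanSpace ℂ ι) {S Q : Set ℂ}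
    (hS : MeasurableSet S) (h : ∀ x ∈ Q, ‖u‖ • x ∈ S) :
    complexGaussian.real Q ≤ (complexGaussianVec ι).real ((fun a => ∑ j, a j * u j) ⁻¹' S) := by
  have h1 := congrArg (fun ν : Measure ℂ => ν.real S) (map_sum_mul_complexGaussianVec u)
  simp only at h1
  rw [map_measureReal_apply (by fun_prop) hS, map_measureReal_apply (by fun_prop) hS] at h1
  rw [h1]
  exact measureReal_mono h

/-- A deterministic lower bound for `Re (conj a * b)` when `b = α a + y` and both `a` and `± y` lie
in translated quadrants. -/
theorem half_le_abs_re_conj_mul {α a y : ℂ} {P W H : ℝ} (hP : 0 ≤ P) (hW : 0 ≤ W)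
    (ha : P ≤ a.re) (ha' : 0 ≤ a.im)
    (hy : (0 ≤ α.re ∧ W ≤ y.re ∧ 0 ≤ y.im) ∨ (α.re ≤ 0 ∧ y.re ≤ -W ∧ y.im ≤ 0))
    (hH : (H / 2) ≤ |α.re| * P + W) :
    P * H / 2 ≤ |((starRingEnd ℂ) a * (α * a + y)).re| := by
  have e : ((starRingEnd ℂ) a * (α * a + y)).re =
      α.re * (a.re ^ 2 + a.im ^ 2) + (a.re * y.re + a.im * y.im) := by
    simp; ring
  rw [e]
  have ha0 : 0 ≤ a.re := hP.trans ha
  have h1 : P ^ 2 ≤ a.re ^ 2 + a.im ^ 2 := by nlinarith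
  have h2 : P * (H / 2) ≤ P * (|α.re| * P + W) := mul_le_mul_of_nonneg_left hH hP
  rcases hy with ⟨h0, h3, h4⟩ | ⟨h0, h3, h4⟩
  · rw [abs_of_nonneg h0] at h2
    refine le_trans ?_ (le_abs_self _)
    have h5 : P * W ≤ a.re * y.re := by gcongr
    have h6 := mul_le_mul_of_nonneg_left h1 h0
    have h7 := mul_nonneg ha' h4
    nlinarith
  · rw [abs_of_nonpos h0] at h2
    refine le_trans ?_ (neg_le_abs _)
    have h5 : P * W ≤ a.re * (-y.re) := by
      have : W ≤ -y.re := by linarith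
      gcongr
    have h6 := mul_le_mul_of_nonneg_left h1 (neg_nonneg.mpr h0)
    have h7 := mul_nonneg ha' (neg_nonneg.mpr h4)
    nlinarith

/-- A small ball estimate for the real part of a product of two correlated Gaussians. -/
theorem exists_small_ball :
    ∃ p₀ : ℝ, 0 < p₀ ∧ p₀ ≤ 1 ∧ ∀ (n : ℕ) (p h : EuclideanSpace ℂ (Fin n)),
      |(inner ℂ p h).im| ≤ ‖p‖ * ‖h‖ / 2 →
      p₀ ≤ (complexGaussianVec (Fin n)).real
        {a | ‖p‖ * ‖h‖ / 2 ≤ |((starRingEnd ℂ) (∑ j, a j * p j) * ∑ j, a j * h j).re|} := by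
  set Q₁ : Set ℂ := {z | z.re ∈ Set.Ici 1 ∧ z.im ∈ Set.Ici 0} with hQ₁
  set Q₂ : Set ℂ := {z | z.re ∈ Set.Iic (-1) ∧ z.im ∈ Set.Iic 0} with hQ₂
  have q₁ : 0 < complexGaussian.real Q₁ := ENNReal.toReal_pos
    (complexGaussian_reProdIm_ne_zero measurableSet_Ici measurableSet_Ici (by simp) (by simp))
    (measure_ne_top _ _)
  have q₂ : 0 < complexGaussian.real Q₂ := ENNReal.toReal_pos
    (complexGaussian_reProdIm_ne_zero measurableSet_Iic measurableSet_Iic (by simp) (by simp))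
    (measure_ne_top _ _)
  have q₁' : complexGaussian.real Q₁ ≤ 1 := measureReal_le_one
  have q₂' : complexGaussian.real Q₂ ≤ 1 := measureReal_le_one
  set q := min (complexGaussian.real Q₁) (complexGaussian.real Q₂) with hq
  have hq0 : 0 < q := lt_min q₁ q₂
  have hq1 : q ≤ 1 := (min_le_left _ _).trans q₁'
  refine ⟨q * q, by positivity, by nlinarith, fun n p h hph => ?_⟩
  set α : ℂ := inner ℂ p h / (‖p‖ ^ 2 : ℝ) with hα
  set w : EuclideanSpace ℂ (Fin n) := h - α • p with hw
  have hαp : α * (‖p‖ ^ 2 : ℝ) = inner ℂ p h := by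
    rcases eq_or_ne p 0 with hp | hp
    · simp [hp]
    · have : ((‖p‖ ^ 2 : ℝ) : ℂ) ≠ 0 := by
        rw [Complex.ofReal_ne_zero]; have := norm_pos_iff.mpr hp; positivity
      rw [hα, div_mul_cancel₀ _ this]
  have hpp : inner ℂ p p = ((‖p‖ ^ 2 : ℝ) : ℂ) := by
    rw [inner_self_eq_norm_sq_to_K]; push_cast; rfl
  have hpw : inner ℂ p w = 0 := by
    rw [hw, inner_sub_right, inner_smul_right, hpp, hαp, sub_self]
  have hhw : h = α • p + w := by rw [hw]; abel
  have hnorm : ‖h‖ ^ 2 = ‖α‖ ^ 2 * ‖p‖ ^ 2 + ‖w‖ ^ 2 := by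
    have h0 : inner ℂ (α • p) w = 0 := by rw [inner_smul_left, hpw, mul_zero]
    have := @norm_add_sq ℂ _ _ _ _ (α • p) w
    rw [← hhw, h0, norm_smul] at this
    rw [this]; simp; ring
  have hαn : ‖α‖ ^ 2 = α.re ^ 2 + α.im ^ 2 := by
    rw [← Complex.normSq_eq_norm_sq, Complex.normSq_apply]; ring
  have him : |α.im| * ‖p‖ ≤ ‖h‖ / 2 := by
    rcases eq_or_ne p 0 with hp | hp
    · rw [hp, norm_zero, mul_zero]; positivity
    · have hp' := norm_pos_iff.mpr hp
      have e : (inner ℂ p h).im = α.im * ‖p‖ ^ 2 := by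
        rw [← hαp, Complex.im_mul_ofReal]
      rw [e, abs_mul, abs_of_nonneg (by positivity : 0 ≤ ‖p‖ ^ 2)] at hph
      refine le_of_mul_le_mul_left ?_ hp'
      linarith
  have hH : ‖h‖ / 2 ≤ |α.re| * ‖p‖ + ‖w‖ := by
    have h1 : (|α.im| * ‖p‖) ^ 2 ≤ (‖h‖ / 2) ^ 2 := by gcongr
    have h2 : (‖h‖ / 2) ^ 2 ≤ (|α.re| * ‖p‖ + ‖w‖) ^ 2 := by
      have h3 : 0 ≤ |α.re| * ‖p‖ * ‖w‖ := by positivity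
      rw [mul_pow, sq_abs] at h1
      rw [add_sq, mul_pow, sq_abs]
      rw [hαn] at hnorm
      nlinarith [sq_nonneg ‖h‖]
    exact le_of_sq_le_sq h2 (by positivity)
  have hind := indepFun_sum_mul_of_inner_eq_zero hpw
  have hξ : ∀ a : Fin n → ℂ, ∑ j, a j * h j = α * ∑ j, a j * p j + ∑ j, a j * w j := by
    intro a
    rw [Finset.mul_sum, ← Finset.sum_add_distrib]
    refine Finset.sum_congr rfl fun j _ => ?_
    rw [hw]; simp; ring
  let S₁ : ℝ → Set ℂ := fun r => {z | r ≤ z.re ∧ 0 ≤ z.im}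
  let S₂ : ℝ → Set ℂ := fun r => {z | z.re ≤ -r ∧ z.im ≤ 0}
  have hS₁ : ∀ r, MeasurableSet (S₁ r) := fun r =>
    (measurableSet_le measurable_const Complex.measurable_re).inter
      (measurableSet_le measurable_const Complex.measurable_im)
  have hS₂ : ∀ r, MeasurableSet (S₂ r) := fun r =>
    (measurableSet_le Complex.measurable_re measurable_const).inter
      (measurableSet_le Complex.measurable_im measurable_const)
  have b₁ : ∀ u : EuclideanSpace ℂ (Fin n), q ≤
      (complexGaussianVec (Fin n)).real ((fun a => ∑ j, a j * u j) ⁻¹' (S₁ ‖u‖)) := fun u =>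
    (min_le_left _ _).trans (measureReal_sum_mul_mem_ge u (hS₁ _) fun x hx => by
      have h1 : 1 ≤ x.re := hx.1
      have h2 : 0 ≤ x.im := hx.2
      constructor
      · simp only [Complex.smul_re, smul_eq_mul]; nlinarith [norm_nonneg u]
      · simp only [Complex.smul_im, smul_eq_mul]; positivity)
  have b₂ : ∀ u : EuclideanSpace ℂ (Fin n), q ≤
      (complexGaussianVec (Fin n)).real ((fun a => ∑ j, a j * u j) ⁻¹' (S₂ ‖u‖)) := fun u =>
    (min_le_right _ _).trans (measureReal_sum_mul_mem_ge u (hS₂ _) fun x hx => by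
      have h1 : x.re ≤ -1 := hx.1
      have h2 : x.im ≤ 0 := hx.2
      constructor
      · simp only [Complex.smul_re, smul_eq_mul]; nlinarith [norm_nonneg u]
      · simp only [Complex.smul_im, smul_eq_mul]; nlinarith [norm_nonneg u])
  have main : ∀ S : Set ℂ, MeasurableSet S →
      q ≤ (complexGaussianVec (Fin n)).real ((fun a => ∑ j, a j * w j) ⁻¹' S) →
      (∀ y ∈ S, (0 ≤ α.re ∧ ‖w‖ ≤ y.re ∧ 0 ≤ y.im) ∨ (α.re ≤ 0 ∧ y.re ≤ -‖w‖ ∧ y.im ≤ 0)) →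
      q * q ≤ (complexGaussianVec (Fin n)).real
        {a | ‖p‖ * ‖h‖ / 2 ≤ |((starRingEnd ℂ) (∑ j, a j * p j) * ∑ j, a j * h j).re|} := by
    intro S hS hqS hα'
    have h1 := hind.measure_inter_preimage_eq_mul (S₁ ‖p‖) S (hS₁ _) hS
    have h2 := congrArg ENNReal.toReal h1
    rw [ENNReal.toReal_mul] at h2
    simp only [← measureReal_def] at h2
    calc q * q ≤ _ * _ := mul_le_mul (b₁ p) hqS hq0.le measureReal_nonneg
      _ = _ := h2.symm
      _ ≤ _ := by
        refine measureReal_mono fun a ha => ?_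
        rw [Set.mem_ofPred_eq, hξ]
        exact half_le_abs_re_conj_mul (norm_nonneg _) (norm_nonneg _) ha.1.1 ha.1.2
          (hα' _ ha.2) hH
  rcases le_total 0 α.re with h0 | h0
  · exact main (S₁ ‖w‖) (hS₁ _) (b₁ w) fun y hy => Or.inl ⟨h0, hy.1, hy.2⟩
  · exact main (S₂ ‖w‖) (hS₂ _) (b₂ w) fun y hy => Or.inr ⟨h0, hy.1, hy.2⟩

end SmallBall

section SparseNet

variable {ι : Type*} [Fintype ι]

/-- The subspace of vectors supported on `S`. -/
def supportedSubmodule (S : Finset ι) : Submodule ℂ (EuclideanSpace ℂ ι) where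
  carrier := {x | SupportedOn S x}
  add_mem' {x y} hx hy j hj := by rw [PiLp.add_apply, hx j hj, hy j hj, add_zero]
  zero_mem' j _ := rfl
  smul_mem' c x hx j hj := by rw [PiLp.smul_apply, hx j hj, smul_zero]

theorem finrank_supportedSubmodule_le (S : Finset ι) :
    Module.finrank ℝ (supportedSubmodule S) ≤ 2 * S.card := by
  rw [finrank_real_of_complex]
  let g : supportedSubmodule S →ₗ[ℂ] (S → ℂ) :=
    { toFun := fun x j => x.1 j
      map_add' := fun _ _ => rfl
      map_smul' := fun _ _ => rfl }
  have hg : Function.Injective g := by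
    intro x y hxy
    ext j
    by_cases hj : j ∈ S
    · exact congrFun hxy ⟨j, hj⟩
    · rw [x.2 j hj, y.2 j hj]
  have := LinearMap.finrank_le_finrank_of_injective hg
  rw [Module.finrank_fintype_fun_eq_card, Fintype.card_coe] at this
  omega

/-- An `ε`-net of the `s`-sparse unit vectors, compatible with supports. -/
theorem exists_sparse_net (s : ℕ) {ε : ℝ} (hε : 0 < ε) :
    ∃ N : Finset (EuclideanSpace ℂ ι),
      (∀ S : Finset ι, S.card = s → ∀ x : EuclideanSpace ℂ ι, SupportedOn S x → ‖x‖ ≤ 1 →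
        ∃ u ∈ N, SupportedOn S u ∧ ‖u‖ ≤ 1 ∧ ‖x - u‖ ≤ ε) ∧
      (N.card : ℝ) ≤ (Fintype.card ι).choose s * (1 + 2 / ε) ^ (2 * s) := by
  classical
  choose M hM1 hM2 hM3 using fun S : Finset ι => exists_net_unitBall (supportedSubmodule S) hε
  refine ⟨(Finset.powersetCard s Finset.univ).biUnion fun S => (M S).image Subtype.val, ?_, ?_⟩
  · intro S hS x hx hx1
    obtain ⟨u, hu, hxu⟩ := hM2 S ⟨x, hx⟩ hx1
    refine ⟨u.1, ?_, u.2, hM1 S u hu, hxu⟩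
    rw [Finset.mem_biUnion]
    exact ⟨S, by simp [hS], Finset.mem_image_of_mem _ hu⟩
  · have h1 : ∀ S ∈ Finset.powersetCard s (Finset.univ : Finset ι),
        (((M S).image Subtype.val).card : ℝ) ≤ (1 + 2 / ε) ^ (2 * s) := by
      intro S hS
      rw [Finset.mem_powersetCard] at hS
      calc (((M S).image Subtype.val).card : ℝ) ≤ (M S).card := by
            exact_mod_cast Finset.card_image_le
        _ ≤ _ := hM3 S
        _ ≤ _ := by
          refine pow_le_pow_right₀ (by have : 0 ≤ 2 / ε := by positivity
                                       linarith) ?_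
          exact (finrank_supportedSubmodule_le S).trans (by rw [hS.2])
    calc _ ≤ ∑ S ∈ Finset.powersetCard s (Finset.univ : Finset ι),
          (((M S).image Subtype.val).card : ℝ) := by exact_mod_cast Finset.card_biUnion_le
      _ ≤ _ := Finset.sum_le_card_nsmul _ _ _ h1
      _ = _ := by rw [nsmul_eq_mul, Finset.card_powersetCard, Finset.card_univ]

theorem sparseBound_of_net {κ : Type*} [Fintype κ] {f : EuclideanSpace ℂ ι →ₗ[ℂ] EuclideanSpace ℂ κ}
    {s : ℕ} {ε B : ℝ} (hε : ε ≤ 1 / 2) (hB : 0 ≤ B) {N : Set (EuclideanSpace ℂ ι)}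
    (hN : ∀ S : Finset ι, S.card = s → ∀ x : EuclideanSpace ℂ ι, SupportedOn S x → ‖x‖ ≤ 1 →
        ∃ u ∈ N, SupportedOn S u ∧ ‖u‖ ≤ 1 ∧ ‖x - u‖ ≤ ε)
    (hf : ∀ u ∈ N, ‖u‖ ≤ 1 → ‖f u‖ ≤ B) : SparseBound f s (2 * B) := by
  intro S hS x hx
  refine norm_le_of_net (f.comp (supportedSubmodule S).subtype) hε hB
    {u : supportedSubmodule S | (u : EuclideanSpace ℂ ι) ∈ N ∧ ‖u‖ ≤ 1} ?_ ?_ ⟨x, hx⟩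
  · intro y hy
    obtain ⟨u, hu, hSu, hu1, hyu⟩ := hN S hS y.1 y.2 hy
    exact ⟨⟨u, hSu⟩, ⟨hu, hu1⟩, hyu⟩
  · exact fun u hu => hf u.1 hu.1 hu.2

end SparseNet

section Events

/-- The linear map between Euclidean spaces given by a matrix. -/
noncomputable def matMap {m n : ℕ} (A : Fin m → Fin n → ℂ) :
    EuclideanSpace ℂ (Fin n) →ₗ[ℂ] EuclideanSpace ℂ (Fin m) where
  toFun x := WithLp.toLp 2 fun i => ∑ j, A i j * x j
  map_add' x y := by
    ext i; simp [mul_add, Finset.sum_add_distrib]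
  map_smul' c x := by
    ext i
    simp only [PiLp.smul_apply, smul_eq_mul, RingHom.id_apply, Finset.mul_sum]
    exact Finset.sum_congr rfl fun j _ => by ring

theorem matMap_apply {m n : ℕ} (A : Fin m → Fin n → ℂ) (x : EuclideanSpace ℂ (Fin n)) (i : Fin m) :
    matMap A x i = ∑ j, A i j * x j := rfl

theorem inner_matMap_single {m n : ℕ} (A : Fin m → Fin n → ℂ) (e : EuclideanSpace ℂ (Fin m))
    (j : Fin n) :
    inner ℂ e (matMap A (EuclideanSpace.single j 1)) = ∑ i, A i j * (starRingEnd ℂ) (e i) := by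
  rw [PiLp.inner_apply]
  refine Finset.sum_congr rfl fun i _ => ?_
  rw [RCLike.inner_apply, matMap_apply]
  congr 1
  simp

instance (m n : ℕ) : IsProbabilityMeasure (gaussMatrixComplex m n) := by
  rw [gaussMatrixComplex_eq_pi]; infer_instance

theorem exists_measureReal_norm_matMap_gt_le :
    ∃ K : ℝ, 0 < K ∧ ∀ (m n : ℕ) (u : EuclideanSpace ℂ (Fin n)),
      (gaussMatrixComplex m n).real {A | √K * √m * ‖u‖ < ‖matMap A u‖} ≤ Real.exp (-(3 * m)) := by
  obtain ⟨K, hK, h⟩ := exists_measureReal_normSq_gt_le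
  refine ⟨K, hK, fun m n u => ?_⟩
  rw [gaussMatrixComplex_eq_pi]
  refine le_trans (measureReal_mono fun A hA => ?_) (h m n u)
  rw [Set.mem_ofPred_eq] at hA ⊢
  have h1 : ∑ i, ‖∑ j, A i j * u j‖ ^ 2 = ‖matMap A u‖ ^ 2 := by
    rw [EuclideanSpace.norm_sq_eq]; rfl
  have h2 : K * m * ‖u‖ ^ 2 = (√K * √m * ‖u‖) ^ 2 := by
    rw [mul_pow, mul_pow, Real.sq_sqrt hK.le, Real.sq_sqrt (Nat.cast_nonneg m)]
  rw [h1, h2]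
  exact pow_lt_pow_left₀ hA (by positivity) two_ne_zero

theorem exists_measureReal_absReSum_lt_le :
    ∃ b : ℝ, 0 < b ∧ b ≤ 1 ∧ ∀ (m n : ℕ) (p h : EuclideanSpace ℂ (Fin n)),
      |(inner ℂ p h).im| ≤ ‖p‖ * ‖h‖ / 2 →
      (gaussMatrixComplex m n).real
        {A | absReSum (matMap A p) (matMap A h) < b * m * (‖p‖ * ‖h‖)} ≤
          Real.exp (-(2 * b * m)) := by
  classical
  obtain ⟨p₀, hp₀, hp₁, hsb⟩ := exists_small_ball
  refine ⟨p₀ / 8, by positivity, by linarith, fun m n p h hph => ?_⟩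
  rw [gaussMatrixComplex_eq_pi]
  set E : Set (Fin n → ℂ) :=
    {a | ‖p‖ * ‖h‖ / 2 ≤ |((starRingEnd ℂ) (∑ j, a j * p j) * ∑ j, a j * h j).re|} with hE
  have hEm : MeasurableSet E := by
    refine measurableSet_le measurable_const (Continuous.measurable ?_)
    fun_prop
  have hc := measureReal_pi_card_le_le (κ := Fin m) _ hEm (hsb n p h hph) (p₀ * m / 4)
  refine le_trans (measureReal_mono fun A hA => ?_) (hc.trans (le_of_eq ?_))
  · rw [Set.mem_ofPred_eq] at hA ⊢
    by_contra hcon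
    push Not at hcon
    refine absurd hA (not_lt.mpr ?_)
    have h1 : ((Finset.univ.filter fun i => A i ∈ E).card : ℝ) * (‖p‖ * ‖h‖ / 2) ≤
        absReSum (matMap A p) (matMap A h) := by
      unfold absReSum
      rw [← nsmul_eq_mul]
      refine (Finset.card_nsmul_le_sum (Finset.univ.filter fun i => A i ∈ E)
        (fun i => |((starRingEnd ℂ) (matMap A p i) * matMap A h i).re|) _ fun i hi => ?_).trans ?_
      · exact (Finset.mem_filter.mp hi).2
      · exact Finset.sum_le_sum_of_subset_of_nonneg (Finset.filter_subset _ _)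
          fun _ _ _ => abs_nonneg _
    refine le_trans ?_ h1
    calc p₀ / 8 * m * (‖p‖ * ‖h‖) = p₀ * m / 4 * (‖p‖ * ‖h‖ / 2) := by ring
      _ ≤ _ := by gcongr
  · rw [Fintype.card_fin]; congr 1; ring

open Classical in
theorem measureReal_card_correlated_le_le (m n : ℕ) (e : EuclideanSpace ℂ (Fin m)) (t r : ℝ) :
    (gaussMatrixComplex m n).real
      {A | ((Finset.univ.filter fun j =>
        t * ‖e‖ ≤ ‖(inner ℂ e (matMap A (EuclideanSpace.single j 1)) : ℂ)‖).card : ℝ) ≤ r} ≤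
      Real.exp (r - Real.exp (-(2 * t ^ 2 + 2)) / √π * n / 2) := by
  set e' : EuclideanSpace ℂ (Fin m) := WithLp.toLp 2 fun i => (starRingEnd ℂ) (e i) with he'
  have hnorm : ‖e'‖ = ‖e‖ := by
    simp [EuclideanSpace.norm_eq, he']
  set E : Set (Fin m → ℂ) := {a | t * ‖e'‖ ≤ ‖∑ i, a i * e' i‖} with hE
  have hEm : MeasurableSet E := by
    refine measurableSet_le measurable_const (Continuous.measurable ?_)
    fun_prop
  have hc := measureReal_pi_card_le_le (κ := Fin n) _ hEm (le_measureReal_norm_sum_mul_ge e' t) r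
  rw [Fintype.card_fin] at hc
  refine le_trans (le_of_eq ?_) hc
  have hmeas : MeasurableSet {a : Fin n → Fin m → ℂ |
      ((Finset.univ.filter fun j => a j ∈ E).card : ℝ) ≤ r} := by
    have : ∀ a : Fin n → Fin m → ℂ, ((Finset.univ.filter fun j => a j ∈ E).card : ℝ) =
        ∑ j, E.indicator (fun _ => (1 : ℝ)) (a j) := by
      intro a
      simp [Set.indicator_apply]
    simp only [this]
    refine measurableSet_le (Finset.measurable_sum _ fun j _ => ?_) measurable_const
    exact (measurable_const.indicator hEm).comp (measurable_pi_apply j)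
  have hswap := map_swap_pi_pi (ι := Fin m) (κ := Fin n) complexGaussian
  rw [gaussMatrixComplex_eq_pi]
  unfold complexGaussianVec
  rw [← hswap, map_measureReal_apply (by fun_prop) hmeas]
  simp only [hE, hnorm, inner_matMap_single, Set.preimage_ofPred_eq, Set.mem_ofPred_eq]
  rfl

end Events

section Constants

theorem mul_max_log_le {k n m : ℕ} {C : ℝ} (hk : 0 < k) (hkn : k ≤ n) (hC : 1 ≤ C)
    (h : C * k * Real.log (Real.exp 1 * n / k) ≤ m) :
    0 < m ∧ C * k * max 1 (Real.log (Real.exp 1 * n / m)) ≤ m := by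
  have hk' : (0 : ℝ) < k := by exact_mod_cast hk
  have hkn' : (k : ℝ) ≤ n := by exact_mod_cast hkn
  have hn' : (0 : ℝ) < n := hk'.trans_le hkn'
  have hlog : 1 ≤ Real.log (Real.exp 1 * n / k) := by
    rw [Real.le_log_iff_exp_le (by positivity), mul_div_assoc]
    exact le_mul_of_one_le_right (Real.exp_pos _).le ((one_le_div hk').mpr hkn')
  have hkm : (k : ℝ) ≤ m := by
    refine le_trans ?_ h
    rw [mul_comm C, mul_assoc]
    exact le_mul_of_one_le_right hk'.le (by nlinarith)
  have hm' : (0 : ℝ) < m := hk'.trans_le hkm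
  refine ⟨by exact_mod_cast hm', le_trans ?_ h⟩
  refine mul_le_mul_of_nonneg_left (max_le hlog ?_) (by positivity)
  exact Real.log_le_log (by positivity) (by gcongr)

theorem choose_mul_pow_le_exp {n m s : ℕ} {δ L ε : ℝ} (hδ : 0 < δ) (hδ2 : δ ≤ 2) (hL : 1 ≤ L)
    (hnL : Real.exp 1 * n ≤ m * Real.exp L) (hs : 0 < s) (hsu : s ≤ δ * m / L)
    (hsl : δ * m / (2 * L) ≤ s) (hε : 0 < ε) :
    (n.choose s : ℝ) * (1 + 2 / ε) ^ (2 * s) ≤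
      Real.exp (m * (δ * (Real.log (2 / δ) + (2 + 2 * Real.log (1 + 2 / ε))))) := by
  have hs' : (0 : ℝ) < s := by exact_mod_cast hs
  have h1ε : 1 ≤ 1 + 2 / ε := by
    have : 0 ≤ 2 / ε := by positivity
    linarith
  have hlogε : 0 ≤ Real.log (1 + 2 / ε) := Real.log_nonneg h1ε
  have hlogδ : 0 ≤ Real.log (2 / δ) := Real.log_nonneg ((one_le_div hδ).mpr hδ2)
  have hL0 : 0 < L := by linarith
  have hns : Real.exp 1 * n ≤ s * Real.exp (Real.log (2 / δ) + 2 * L) := by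
    have hLe : L ≤ Real.exp L := by linarith [Real.add_one_le_exp L]
    have e : Real.exp (Real.log (2 / δ) + 2 * L) = 2 / δ * (Real.exp L * Real.exp L) := by
      rw [Real.exp_add, Real.exp_log (by positivity), two_mul, Real.exp_add]
    rw [e]
    calc Real.exp 1 * n ≤ m * Real.exp L := hnL
      _ = δ * m / (2 * L) * (2 / δ * (L * Real.exp L)) := by field_simp
      _ ≤ s * (2 / δ * (Real.exp L * Real.exp L)) := by gcongr
  have hch : (n.choose s : ℝ) ≤ Real.exp (s * (Real.log (2 / δ) + 2 * L)) := by
    calc (n.choose s : ℝ) ≤ (n : ℝ) ^ s / (s.factorial : ℝ) := Nat.choose_le_pow_div s n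
      _ = (n : ℝ) ^ s / (s : ℝ) ^ s * ((s : ℝ) ^ s / (s.factorial : ℝ)) := by
        field_simp
      _ ≤ (n : ℝ) ^ s / (s : ℝ) ^ s * Real.exp s := by
        gcongr
        exact Real.pow_div_factorial_le_exp _ hs'.le s
      _ = (Real.exp 1 * n / s) ^ s := by
        rw [div_pow, mul_pow, ← Real.exp_nat_mul]; ring_nf
      _ ≤ Real.exp (Real.log (2 / δ) + 2 * L) ^ s := by
        gcongr
        rw [div_le_iff₀ hs', mul_comm]
        linarith
      _ = _ := by rw [← Real.exp_nat_mul]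
  have hpow : (1 + 2 / ε) ^ (2 * s) = Real.exp (s * (2 * Real.log (1 + 2 / ε))) := by
    nth_rewrite 1 [← Real.exp_log (by linarith : 0 < 1 + 2 / ε)]
    rw [← Real.exp_nat_mul]; push_cast; ring_nf
  rw [hpow]
  calc _ ≤ Real.exp (s * (Real.log (2 / δ) + 2 * L)) * Real.exp (s * (2 * Real.log (1 + 2 / ε))) := by
        gcongr
    _ = Real.exp (s * (Real.log (2 / δ) + 2 * Real.log (1 + 2 / ε)) + 2 * (s * L)) := by
        rw [← Real.exp_add]; ring_nf
    _ ≤ _ := by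
        rw [Real.exp_le_exp]
        have h1 : s * L ≤ δ * m := (le_div_iff₀ hL0).mp hsu
        have h2 : (s : ℝ) ≤ δ * m := le_trans (le_mul_of_one_le_right hs'.le hL) h1
        have h3 := mul_le_mul_of_nonneg_right h2
          (by positivity : 0 ≤ Real.log (2 / δ) + 2 * Real.log (1 + 2 / ε))
        linarith

theorem exists_mul_log_add_le {η c : ℝ} (hη : 0 < η) (hc : 0 ≤ c) :
    ∃ δ : ℝ, 0 < δ ∧ δ ≤ 1 / 3 ∧ δ * (Real.log (2 / δ) + c) ≤ η := by
  set r := min (1 / 2) (η / (3 + c)) with hr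
  have hr0 : 0 < r := lt_min (by norm_num) (by positivity)
  have hr1 : r ≤ 1 / 2 := min_le_left _ _
  have hr2 : r * (3 + c) ≤ η := by
    rw [← le_div_iff₀ (by positivity)]; exact min_le_right _ _
  refine ⟨r ^ 2, by positivity, by nlinarith, ?_⟩
  have hlog : Real.log (2 / r ^ 2) ≤ 2 * (3 / 2 / r) := by
    have h1 : Real.log (2 / r ^ 2) ≤ 2 * Real.log (3 / 2 / r) := by
      rw [← Real.log_rpow (by positivity)]
      refine Real.log_le_log (by positivity) ?_
      norm_num
      rw [div_pow]
      gcongr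
      norm_num
    have h2 := Real.log_le_sub_one_of_pos (by positivity : 0 < 3 / 2 / r)
    linarith
  calc r ^ 2 * (Real.log (2 / r ^ 2) + c) ≤ r ^ 2 * (2 * (3 / 2 / r) + c) := by gcongr
    _ = r * 3 + r * r * c := by field_simp
    _ ≤ r * 3 + r * 1 * c := by gcongr; linarith
    _ = r * (3 + c) := by ring
    _ ≤ η := hr2

/-- The failure exponent for the correlation of the columns with a net. -/
theorem exp_correlation_exponent_le {n m s : ℕ} {L a : ℝ} (ha : 0 ≤ a) (hsm : s ≤ m)
    (hL : 8 * a + 24 ≤ L) (hn : Real.exp 1 * n = m * Real.exp L) :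
    a * (2 * m) + (s - Real.exp (-(2 * (√L / 2) ^ 2 + 2)) / √π * n / 2) ≤ -(m : ℝ) := by
  have hm : (0 : ℝ) ≤ m := Nat.cast_nonneg m
  have hsm' : (s : ℝ) ≤ m := by exact_mod_cast hsm
  have hL0 : 0 ≤ L := by linarith
  have hn' : (n : ℝ) = m * Real.exp (L - 1) := by
    rw [Real.exp_sub, ← mul_div_assoc, eq_div_iff (Real.exp_pos 1).ne', ← hn]; ring
  have hπ : √π ≤ Real.exp 1 := by
    have h1 : √π ≤ 2 := by
      rw [Real.sqrt_le_left (by norm_num)]; linarith [Real.pi_le_four]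
    linarith [Real.add_one_le_exp (1 : ℝ)]
  have hπ0 : 0 < √π := Real.sqrt_pos.mpr Real.pi_pos
  have hsq : 2 * (√L / 2) ^ 2 = L / 2 := by
    rw [div_pow, Real.sq_sqrt hL0]; ring
  have h1 : Real.exp (-(L / 2 + 2) - 1) ≤ Real.exp (-(L / 2 + 2)) / √π := by
    rw [Real.exp_sub]; gcongr
  have h2 : (4 * a + 4) * m ≤ Real.exp (-(2 * (√L / 2) ^ 2 + 2)) / √π * n := by
    rw [hsq]
    calc (4 * a + 4) * (m : ℝ) ≤ Real.exp (L / 2 - 4) * m := by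
          gcongr
          linarith [Real.add_one_le_exp (L / 2 - 4)]
      _ = Real.exp (-(L / 2 + 2) - 1) * (m * Real.exp (L - 1)) := by
          have : Real.exp (L / 2 - 4) = Real.exp (-(L / 2 + 2) - 1) * Real.exp (L - 1) := by
            rw [← Real.exp_add]; ring_nf
          rw [this]; ring
      _ ≤ _ := by rw [hn']; gcongr
  linarith

end Constants

section Assembly

variable {m n : ℕ}

/-- The `ℓ₁` quotient property: `f v` has a preimage of small `ℓ₁` norm. -/
theorem exists_preimage_sumNorm_le {A : Fin m → Fin n → ℂ} {s : ℕ} {K δ L L₀ εq ℓ : ℝ}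
    (hm : 0 < m) (hs : 0 < s) (hK : 0 < K) (hδ : 0 < δ) (hL : 1 ≤ L) (hL₀ : 1 ≤ L₀) (hℓ0 : 0 ≤ ℓ)
    (hsl : δ * m / (2 * L) ≤ s) (hnL : Real.exp 1 * n ≤ m * Real.exp L)
    (hℓ : 288 * K / δ + 2 * L₀ * Real.exp L₀ / δ ≤ ℓ ^ 2)
    (hεq : εq ≤ 1 / 4) (hεq' : εq ≤ δ / (256 * K))
    (hf : SparseBound (matMap A) s (2 * (√K * √m)))
    {N : Set (EuclideanSpace ℂ (Fin m))} (hN1 : ∀ u ∈ N, ‖u‖ ≤ 1)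
    (hN : ∀ x : EuclideanSpace ℂ (Fin m), ‖x‖ ≤ 1 → ∃ u ∈ N, ‖x - u‖ ≤ εq)
    (hcor : L₀ ≤ L → ∀ e ∈ N, ∃ S : Finset (Fin n), S.card = s ∧ ∀ j ∈ S,
      √L / 2 * ‖e‖ ≤ ‖(inner ℂ e (matMap A (EuclideanSpace.single j 1)) : ℂ)‖)
    {v : EuclideanSpace ℂ (Fin n)} (hv : ‖matMap A v‖ ≤ √K * √m * ‖v‖) :
    ∃ u, matMap A u = matMap A v ∧ sumNorm u ≤ ℓ * √s * ‖v‖ := by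
  have hm' : (0 : ℝ) < m := by exact_mod_cast hm
  have hs' : (0 : ℝ) < s := by exact_mod_cast hs
  have hL' : 0 < L := by linarith
  have hKd : 0 ≤ 288 * K / δ := by positivity
  have hLd : 0 ≤ 2 * L₀ * Real.exp L₀ / δ := by positivity
  rcases le_total L₀ L with hLL | hLL
  · have hsqL : √L ^ 2 = L := Real.sq_sqrt hL'.le
    have hB : (2 * (√K * √m)) ^ 2 = 4 * K * m := by
      rw [mul_pow, mul_pow, Real.sq_sqrt hK.le, Real.sq_sqrt hm'.le]; ring
    have hε8 : εq ≤ s * (√L / 2) ^ 2 / (2 * (√K * √m)) ^ 2 / 8 := by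
      rw [hB, div_pow, hsqL]
      calc εq ≤ δ / (256 * K) := hεq'
        _ = δ * m / (2 * L) * (L / 2 ^ 2) / (4 * K * m) / 8 := by field_simp; norm_num
        _ ≤ _ := by gcongr
    obtain ⟨u, hu, hu'⟩ := exists_preimage_of_correlated_columns (t := √L / 2) hf (by positivity)
      (by positivity) hs hεq hε8 N hN1 hN (hcor hLL) (matMap A v)
    refine ⟨u, hu, hu'.trans ?_⟩
    have h1 : 12 / √L * (√K * √m) ≤ ℓ * √s := by
      refine le_of_sq_le_sq ?_ (by positivity)
      have e : (12 / √L * (√K * √m)) ^ 2 = 288 * K / δ * (δ * m / (2 * L)) := by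
        rw [mul_pow, mul_pow, div_pow, Real.sq_sqrt hK.le, Real.sq_sqrt hm'.le, hsqL]
        field_simp; norm_num
      rw [e, mul_pow, Real.sq_sqrt hs'.le]
      exact mul_le_mul (by linarith) hsl (by positivity) (by positivity)
    calc 6 / (√L / 2) * ‖matMap A v‖ ≤ 6 / (√L / 2) * (√K * √m * ‖v‖) := by gcongr
      _ = 12 / √L * (√K * √m) * ‖v‖ := by ring
      _ ≤ _ := by gcongr
  · refine ⟨v, rfl, (sumNorm_le v).trans ?_⟩
    rw [Fintype.card_fin]
    refine mul_le_mul_of_nonneg_right ?_ (norm_nonneg v)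
    refine le_of_sq_le_sq ?_ (by positivity)
    rw [mul_pow, Real.sq_sqrt (Nat.cast_nonneg n), Real.sq_sqrt hs'.le]
    have h1 : (n : ℝ) ≤ m * Real.exp L := by
      refine le_trans (le_mul_of_one_le_left (Nat.cast_nonneg n) ?_) hnL
      linarith [Real.add_one_le_exp (1 : ℝ)]
    calc (n : ℝ) ≤ m * Real.exp L := h1
      _ = 2 * L * Real.exp L / δ * (δ * m / (2 * L)) := by field_simp
      _ ≤ 2 * L₀ * Real.exp L₀ / δ * s := by gcongr
      _ ≤ ℓ ^ 2 * s := by gcongr; linarith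

theorem norm_eq_lpNorm_two {ι : Type*} [Fintype ι] (x : EuclideanSpace ℂ ι) :
    lpNorm 2 (fun i => x i) = ‖x‖ := by
  rw [_root_.lpNorm, EuclideanSpace.norm_eq, Real.sqrt_eq_rpow]
  norm_cast

theorem sumNorm_eq_lpNorm_one {ι : Type*} [Fintype ι] (x : EuclideanSpace ℂ ι) :
    lpNorm 1 (fun i => x i) = sumNorm x := by
  simp [_root_.lpNorm, sumNorm]

/-- The best sparse approximation error is attained by restricting to some support. -/
theorem exists_restrictTo_norm_le_sigmaK {ι : Type*} [Fintype ι] [DecidableEq ι] (k : ℕ)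
    (x : EuclideanSpace ℂ ι) :
    ∃ T : Finset ι, T.card ≤ k ∧ ‖x - restrictTo T x‖ ≤ sigmaK k 2 (fun i => x i) := by
  obtain ⟨T, hT, hmin⟩ := Finset.exists_min_image
    (Finset.univ.filter fun T : Finset ι => T.card ≤ k) (fun T => ‖x - restrictTo T x‖)
    ⟨∅, by simp⟩
  rw [Finset.mem_filter] at hT
  refine ⟨T, hT.2, le_csInf ⟨_, 0, by simp [l0Norm], rfl⟩ ?_⟩
  rintro d ⟨z, hz, rfl⟩
  classical
  set S : Finset ι := Finset.univ.filter fun i => z i ≠ 0 with hS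
  have hSk : S.card ≤ k := by
    refine le_trans (le_of_eq ?_) hz
    rw [l0Norm]
  refine (hmin S (by simp [hSk])).trans ?_
  have e : lpNorm 2 (fun i => x i - z i) = ‖x - WithLp.toLp 2 z‖ :=
    norm_eq_lpNorm_two (x - WithLp.toLp 2 z)
  rw [e, EuclideanSpace.norm_eq, EuclideanSpace.norm_eq]
  refine Real.sqrt_le_sqrt (Finset.sum_le_sum fun i _ => ?_)
  by_cases hi : i ∈ S
  · simp [restrictTo_apply, hi]
  · have : z i = 0 := by simpa [hS] using hi
    simp [restrictTo_apply, hi, this]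

theorem phaseDist_two_le {ι : Type*} [Fintype ι] (x y : EuclideanSpace ℂ ι) {a : ℂ}
    (ha : ‖a‖ = 1) : phaseDist 2 (fun i => x i) (fun i => y i) ≤ ‖x - a • y‖ := by
  refine csInf_le ⟨0, ?_⟩ ⟨a, ha, ?_⟩
  · rintro d ⟨c, -, rfl⟩
    exact Real.rpow_nonneg (Finset.sum_nonneg fun i _ => by positivity) _
  · exact (norm_eq_lpNorm_two (x - a • y)).symm

end Assembly

section Main

theorem measureReal_biUnion_finset_le_card_mul {Ω α : Type*} [MeasurableSpace Ω] (P : Measure Ω)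
    [IsFiniteMeasure P] (N : Finset α) (E : α → Set Ω) {q : ℝ} (h : ∀ u ∈ N, P.real (E u) ≤ q) :
    P.real (⋃ u ∈ N, E u) ≤ N.card * q :=
  (measureReal_biUnion_finset_le N E).trans ((Finset.sum_le_card_nsmul _ _ _ h).trans_eq
    (nsmul_eq_mul _ _))

set_option maxHeartbeats 1000000 in
theorem exists_recovery_constants :
    ∃ C C' b : ℝ, 0 < C ∧ 0 < C' ∧ 0 < b ∧ ∀ k n m : ℕ, 0 < k → k ≤ n →
      C * k * Real.log (Real.exp 1 * n / k) ≤ m → 0 < Real.log (Real.exp 1 * n / m) →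
      ∀ x₀ : EuclideanSpace ℂ (Fin n),
        (gaussMatrixComplex m n).real {A | ∀ xs : EuclideanSpace ℂ (Fin n),
          (∀ i, ‖matMap A xs i‖ = ‖matMap A x₀ i‖) →
          (∀ z, (∀ i, ‖matMap A z i‖ = ‖matMap A x₀ i‖) → sumNorm xs ≤ sumNorm z) →
          phaseDist 2 (fun i => xs i) (fun i => x₀ i) ≤ C' * sigmaK k 2 (fun i => x₀ i)}ᶜ ≤
        4 * Real.exp (-b * m) := by
  classical
  obtain ⟨K, hK, htail⟩ := exists_measureReal_norm_matMap_gt_le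
  obtain ⟨b, hb, hb1, hpair⟩ := exists_measureReal_absReSum_lt_le
  set τ : ℝ := min (1 / 10) (b / (48 * K)) with hτ
  have hτ0 : 0 < τ := lt_min (by norm_num) (by positivity)
  have hτ1 : τ ≤ 1 / 10 := min_le_left _ _
  have hτ2 : 48 * K * τ ≤ b := by
    have : τ ≤ b / (48 * K) := min_le_right _ _
    rw [le_div_iff₀ (by positivity)] at this
    linarith
  clear_value τ
  set ω : ℝ := τ / 4 with hω
  set ε : ℝ := τ / 2 with hε
  have hω0 : 0 < ω := by positivity
  have hε0 : 0 < ε := by positivity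
  have h1ε : 0 ≤ Real.log (1 + 2 / ε) := Real.log_nonneg (by
    have : 0 ≤ 2 / ε := by positivity
    linarith)
  obtain ⟨δ, hδ0, hδ1, hδ⟩ := exists_mul_log_add_le (η := b / 2)
    (c := 2 + 2 * Real.log (1 + 2 / ε)) (by positivity) (by positivity)
  set εq : ℝ := min (1 / 4) (δ / (256 * K)) with hεq
  have hεq0 : 0 < εq := lt_min (by norm_num) (by positivity)
  have hεq1 : εq ≤ 1 / 4 := min_le_left _ _
  have hεq2 : εq ≤ δ / (256 * K) := min_le_right _ _
  clear_value εq
  have h1q : 0 < 1 + 2 / εq := by positivity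
  set a : ℝ := Real.log (1 + 2 / εq) with ha
  have ha0 : 0 ≤ a := Real.log_nonneg (by
    have : 0 ≤ 2 / εq := by positivity
    linarith)
  set L₀ : ℝ := 8 * a + 24 with hL₀
  have hL₀1 : 1 < L₀ := by linarith
  set ℓ : ℝ := √(288 * K / δ + 2 * L₀ * Real.exp L₀ / δ) with hℓ
  have hℓarg : 0 < 288 * K / δ + 2 * L₀ * Real.exp L₀ / δ := by positivity
  have hℓ0 : 0 < ℓ := Real.sqrt_pos.mpr hℓarg
  have hℓsq : 288 * K / δ + 2 * L₀ * Real.exp L₀ / δ ≤ ℓ ^ 2 := by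
    rw [hℓ, Real.sq_sqrt hℓarg.le]
  clear_value ℓ
  set D : ℝ := 2 * √K * (1 + 2 * ω) with hD
  have hsK : 0 < √K := Real.sqrt_pos.mpr hK
  have hD0 : 0 < D := by positivity
  set C : ℝ := 128 / (δ * ω ^ 2) with hC
  have hCδ : 128 ≤ C * (δ * ω ^ 2) := by
    rw [hC, div_mul_cancel₀]; positivity
  have hC0 : 0 < C := by positivity
  have hω1 : ω ≤ 1 := by linarith
  have hω2 : ω ^ 2 ≤ 1 := pow_le_one₀ hω0.le hω1
  have hCδ' : 1 ≤ C * δ := by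
    have : C * δ * ω ^ 2 ≤ C * δ * 1 := by gcongr
    linarith
  have hC1 : 1 ≤ C := hCδ'.trans (mul_le_of_le_one_right hC0.le (by linarith))
  clear_value C
  refine ⟨C, 2 * ℓ / ω + 2 * √K * D / (b / 2) + 1, b, hC0, by positivity, hb, ?_⟩
  intro k n m hk hkn hkm hlog x₀
  obtain ⟨hm, hkL⟩ := mul_max_log_le hk hkn hC1 hkm
  have hk' : (1 : ℝ) ≤ k := by exact_mod_cast hk
  have hm' : (0 : ℝ) < m := by exact_mod_cast hm
  have hn' : (0 : ℝ) < n := by exact_mod_cast hk.trans_le hkn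
  set L : ℝ := max 1 (Real.log (Real.exp 1 * n / m)) with hL
  have hL1 : 1 ≤ L := le_max_left _ _
  have hL0 : 0 < L := by linarith
  have hexp : Real.exp (Real.log (Real.exp 1 * n / m)) = Real.exp 1 * n / m :=
    Real.exp_log (by positivity)
  have hnL : Real.exp 1 * n ≤ m * Real.exp L := by
    have : Real.exp 1 * n / m ≤ Real.exp L := by
      rw [← hexp]; exact Real.exp_le_exp.mpr (le_max_right _ _)
    rw [div_le_iff₀ hm'] at this
    linarith
  have hnL' : L₀ ≤ L → Real.exp 1 * n = m * Real.exp L := by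
    intro h
    have h1 : L = Real.log (Real.exp 1 * n / m) := by
      rcases max_choice 1 (Real.log (Real.exp 1 * n / m)) with h2 | h2
      · rw [← hL] at h2; linarith
      · exact h2
    rw [h1, hexp, mul_div_cancel₀ _ hm'.ne']
  have hmn : (m : ℝ) ≤ 3 * n := by
    have h1 : 1 < Real.exp 1 * n / m := (Real.log_pos_iff (by positivity)).mp hlog
    rw [lt_div_iff₀ hm'] at h1
    have h2 : Real.exp 1 ≤ 3 := by linarith [Real.exp_one_lt_d9]
    have : Real.exp 1 * n ≤ 3 * n := by gcongr
    linarith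
  clear_value L
  set s : ℕ := ⌊δ * m / L⌋₊ with hs
  have hkδ : C * δ * k ≤ δ * m / L := by
    rw [le_div_iff₀ hL0]
    have := mul_le_mul_of_nonneg_left hkL hδ0.le
    linarith
  have hx1 : 1 ≤ δ * m / L := by nlinarith
  have hs0 : 0 < s := Nat.floor_pos.mpr hx1
  have hs0' : (1 : ℝ) ≤ s := by exact_mod_cast hs0
  have hsu : (s : ℝ) ≤ δ * m / L := Nat.floor_le (by positivity)
  have hsl' : δ * m / L ≤ 2 * s := by
    have := Nat.lt_floor_add_one (δ * m / L)
    rw [← hs] at this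
    linarith
  have hsl : δ * m / (2 * L) ≤ s := by
    have : δ * m / (2 * L) = δ * m / L / 2 := by field_simp
    rw [this]; linarith
  clear_value s
  have hsm3 : (s : ℝ) ≤ m / 3 := by
    calc (s : ℝ) ≤ δ * m / L := hsu
      _ ≤ δ * m := div_le_self (by positivity) hL1
      _ ≤ 1 / 3 * m := by gcongr
      _ = m / 3 := by ring
  have hsm : s ≤ m := by
    have : (s : ℝ) ≤ m := by linarith
    exact_mod_cast this
  have hsn : s ≤ n := by
    have : (s : ℝ) ≤ n := by linarith
    exact_mod_cast this
  have hks : 8 * √k ≤ ω * √s := by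
    refine le_of_sq_le_sq ?_ (by positivity)
    rw [mul_pow, mul_pow, Real.sq_sqrt (by positivity), Real.sq_sqrt (by positivity)]
    have h1 := mul_le_mul_of_nonneg_right (hkδ.trans hsl') (sq_nonneg ω)
    have h2 : 128 * (k : ℝ) ≤ C * (δ * ω ^ 2) * k := by gcongr
    linarith
  obtain ⟨T, hT, hTσ⟩ := exists_restrictTo_norm_le_sigmaK k x₀
  set v := x₀ - restrictTo T x₀ with hv
  obtain ⟨N, hN, hNcard⟩ := exists_sparse_net (ι := Fin n) s hε0
  rw [Fintype.card_fin] at hNcard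
  replace hNcard : (N.card : ℝ) ≤ Real.exp (m * (b / 2)) :=
    hNcard.trans ((choose_mul_pow_le_exp hδ0 (by linarith) hL1 hnL hs0 hsu hsl hε0).trans
      (Real.exp_le_exp.mpr (by gcongr)))
  obtain ⟨M, hM1, hM, hMcard⟩ := exists_net_unitBall (EuclideanSpace ℂ (Fin m)) hεq0
  replace hMcard : (M.card : ℝ) ≤ Real.exp (a * (2 * m)) := by
    refine hMcard.trans (le_of_eq ?_)
    rw [finrank_real_of_complex, finrank_euclideanSpace_fin, ← Real.exp_log h1q,
      ← Real.exp_nat_mul, ← ha]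
    push_cast; ring_nf
  set P := gaussMatrixComplex m n with hP
  let E₁ : Set (Fin m → Fin n → ℂ) := ⋃ u ∈ N, {A | √K * √m * ‖u‖ < ‖matMap A u‖}
  let pairs := (N ×ˢ N).filter fun q => |(inner ℂ q.1 q.2).im| ≤ ‖q.1‖ * ‖q.2‖ / 2
  let E₂ : Set (Fin m → Fin n → ℂ) := ⋃ q ∈ pairs,
    {A | absReSum (matMap A q.1) (matMap A q.2) < b * m * (‖q.1‖ * ‖q.2‖)}
  let E₃ : Set (Fin m → Fin n → ℂ) := {A | √K * √m * ‖v‖ < ‖matMap A v‖}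
  let E₄ : Set (Fin m → Fin n → ℂ) := if L₀ ≤ L then ⋃ e ∈ M,
    {A | ((Finset.univ.filter fun j => √L / 2 * ‖e‖ ≤
      ‖(inner ℂ e (matMap A (EuclideanSpace.single j 1)) : ℂ)‖).card : ℝ) ≤ s} else ∅
  have hbm : 0 ≤ b * m := by positivity
  have hbm1 : b * m ≤ m := mul_le_of_le_one_left hm'.le hb1
  have hE₁ : P.real E₁ ≤ Real.exp (-b * m) := by
    refine (measureReal_biUnion_finset_le_card_mul P N _ fun u _ => htail m n u).trans ?_
    calc N.card * Real.exp (-(3 * m)) ≤ Real.exp (m * (b / 2)) * Real.exp (-(3 * m)) := by gcongr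
      _ ≤ _ := by
        rw [← Real.exp_add, Real.exp_le_exp]; linarith
  have hE₂ : P.real E₂ ≤ Real.exp (-b * m) := by
    refine (measureReal_biUnion_finset_le_card_mul P pairs _ fun q hq =>
      hpair m n q.1 q.2 (Finset.mem_filter.mp hq).2).trans ?_
    have hcard : (pairs.card : ℝ) ≤ N.card * N.card := by
      have : pairs.card ≤ N.card * N.card :=
        (Finset.card_filter_le _ _).trans (Finset.card_product _ _).le
      exact_mod_cast this
    calc pairs.card * Real.exp (-(2 * b * m))
        ≤ (Real.exp (m * (b / 2)) * Real.exp (m * (b / 2))) * Real.exp (-(2 * b * m)) := by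
          gcongr
          exact hcard.trans (by gcongr)
      _ ≤ _ := by
        rw [← Real.exp_add, ← Real.exp_add, Real.exp_le_exp]; linarith
  have hE₃ : P.real E₃ ≤ Real.exp (-b * m) :=
    (htail m n v).trans (Real.exp_le_exp.mpr (by linarith))
  have hE₄ : P.real E₄ ≤ Real.exp (-b * m) := by
    by_cases hLL : L₀ ≤ L
    · simp only [E₄, if_pos hLL]
      refine (measureReal_biUnion_finset_le_card_mul P M _ fun e _ =>
        measureReal_card_correlated_le_le m n e (√L / 2) s).trans ?_
      calc _ ≤ Real.exp (a * (2 * m)) * _ := by gcongr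
        _ ≤ _ := by
          rw [← Real.exp_add, Real.exp_le_exp]
          have := exp_correlation_exponent_le ha0 hsm hLL (hnL' hLL)
          linarith
    · simp only [E₄, if_neg hLL, measureReal_empty]
      positivity
  have hunion : P.real (E₁ ∪ E₂ ∪ (E₃ ∪ E₄)) ≤ 4 * Real.exp (-b * m) := by
    have h1 := measureReal_union_le (μ := P) (E₁ ∪ E₂) (E₃ ∪ E₄)
    have h2 := measureReal_union_le (μ := P) E₁ E₂
    have h3 := measureReal_union_le (μ := P) E₃ E₄
    linarith
  refine (measureReal_mono ?_).trans hunion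
  rw [Set.compl_subset_comm]
  intro A hA xs hxs hmin
  simp only [Set.mem_compl_iff, Set.mem_union, not_or] at hA
  obtain ⟨⟨hA1, hA2⟩, hA3, hA4⟩ := hA
  have g1 : ∀ u ∈ N, ‖matMap A u‖ ≤ √K * √m * ‖u‖ := by
    intro u hu
    by_contra hcon
    exact hA1 (Set.mem_biUnion hu (not_le.mp hcon))
  have g2 : ∀ p ∈ N, ∀ h ∈ N, |(inner ℂ p h).im| ≤ ‖p‖ * ‖h‖ / 2 →
      b * m * (‖p‖ * ‖h‖) ≤ absReSum (matMap A p) (matMap A h) := by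
    intro p hp h hh hph
    by_contra hcon
    exact hA2 (Set.mem_biUnion (x := (p, h))
      (Finset.mem_filter.mpr ⟨Finset.mem_product.mpr ⟨hp, hh⟩, hph⟩) (not_le.mp hcon))
  have g3 : ‖matMap A v‖ ≤ √K * √m * ‖v‖ := not_lt.mp hA3
  have g4 : L₀ ≤ L → ∀ e ∈ M, ∃ S : Finset (Fin n), S.card = s ∧ ∀ j ∈ S,
      √L / 2 * ‖e‖ ≤ ‖(inner ℂ e (matMap A (EuclideanSpace.single j 1)) : ℂ)‖ := by
    intro hLL e he
    simp only [E₄, if_pos hLL] at hA4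
    have hcard : s ≤ (Finset.univ.filter fun j => √L / 2 * ‖e‖ ≤
        ‖(inner ℂ e (matMap A (EuclideanSpace.single j 1)) : ℂ)‖).card := by
      by_contra hcon
      refine hA4 (Set.mem_biUnion he ?_)
      rw [Set.mem_ofPred_eq]
      exact_mod_cast (not_le.mp hcon).le
    obtain ⟨S, hS, hSs⟩ := Finset.exists_subset_card_eq hcard
    exact ⟨S, hSs, fun j hj => (Finset.mem_filter.mp (hS hj)).2⟩
  have hsm0 : 0 < √(m : ℝ) := Real.sqrt_pos.mpr hm'
  have hsqm : √(m : ℝ) ^ 2 = m := Real.sq_sqrt hm'.le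
  have hbound : SparseBound (matMap A) s (2 * (√K * √m)) :=
    sparseBound_of_net (by linarith) (by positivity) hN fun u hu hu1 =>
      (g1 u hu).trans (mul_le_of_le_one_right (by positivity) hu1)
  obtain ⟨u, hu, hu'⟩ := exists_preimage_sumNorm_le hm hs0 hK hδ0 hL1 hL₀1.le hℓ0.le hsl hnL hℓsq
    hεq1 hεq2 hbound hM1 hM g4 g3
  have hsn' : s ≤ Fintype.card (Fin n) := by rwa [Fintype.card_fin]
  obtain ⟨c, hc, hfin⟩ := exists_phase_norm_sub_le (f := matMap A) (s := s) (k := k) (ω := ω)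
    (c := b / 2) (D := D) (K := √K) (ℓ := ℓ) (μ := √m) hω0 (by positivity) hD0.le hsK.le hℓ0 hsm0
    (fun p h hp hh hph => by
      have := absReSum_ge_of_net (ε := ε) (b := b * m) hbound (by positivity) hs0 hsn' hN
        (by linarith) ?_ g2 hp hh hph
      · rw [hsqm]; linarith
      · rw [mul_pow, mul_pow, Real.sq_sqrt hK.le, hsqm]
        have h1 := mul_le_mul_of_nonneg_right hτ2 hm'.le
        have h2 : 2 * ω + ε = τ := by rw [hω, hε]; ring
        rw [h2]; linarith)
    (fun p hp => by
      have := hbound.norm_le_of_sumNorm_le (by positivity) hs0 hsn' p hp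
      rw [hD]; linarith)
    hT hks g3 hu hu' hxs hmin
  calc _ ≤ ‖xs - c • x₀‖ := phaseDist_two_le xs x₀ hc
    _ ≤ _ := hfin
    _ ≤ _ := by gcongr

end Main

theorem setOf_recovery_euclidean_subset {m n : ℕ} (k : ℕ) (C' : ℝ) (x₀ : Fin n → ℂ) :
    {A : Fin m → Fin n → ℂ | ∀ xs : EuclideanSpace ℂ (Fin n),
        (∀ i, ‖matMap A xs i‖ = ‖matMap A (WithLp.toLp 2 x₀) i‖) →
        (∀ z, (∀ i, ‖matMap A z i‖ = ‖matMap A (WithLp.toLp 2 x₀) i‖) →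
          sumNorm xs ≤ sumNorm z) →
        phaseDist 2 (fun i => xs i) x₀ ≤ C' * sigmaK k 2 x₀} ⊆
      {A : Fin m → Fin n → ℂ | ∀ xs : Fin n → ℂ,
        (∀ i, absMv A xs i = absMv A x₀ i) →
        (∀ z : Fin n → ℂ, (∀ i, absMv A z i = absMv A x₀ i) →
          _root_.lpNorm 1 xs ≤ _root_.lpNorm 1 z) →
        phaseDist 2 xs x₀ ≤ C' * sigmaK k 2 x₀} := by
  intro A hA xs h1 h2
  refine hA (WithLp.toLp 2 xs) h1 fun z hz => ?_
  rw [← sumNorm_eq_lpNorm_one, ← sumNorm_eq_lpNorm_one]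
  exact h2 (fun i => z i) hz

/-- Theorem `th:22`, complex case: non-uniform `(2,2)`-instance optimality.
For a fixed `x₀ ∈ ℂ^n` and a standard complex Gaussian random matrix `A ∈ ℂ^{m×n}` with
`C·k·log(en/k) ≤ m`, with probability at least
`1 - c̃₃·exp(-c̃₂ m) - exp(-√(mn)) - 2m·exp(-c̃₁ m/log(en/m))`, every `ℓ₁` minimizer `x♯`
subject to `|Ax♯| = |Ax₀|` satisfies `dist(x♯, x₀) ≤ C'·σ_k(x₀)₂`. -/
theorem stmt14 :
    ∃ C C' c₁ c₂ c₃ : ℝ, 0 < C ∧ 0 < C' ∧ 0 < c₁ ∧ 0 < c₂ ∧ 0 < c₃ ∧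
      ∀ k n m : ℕ, 0 < k → k ≤ n →
        C * k * Real.log (Real.exp 1 * n / k) ≤ m →
        ∀ x₀ : Fin n → ℂ,
          ENNReal.ofReal (1 - c₃ * Real.exp (-c₂ * m) - Real.exp (-Real.sqrt (m * n))
              - 2 * m * Real.exp (-c₁ * m / Real.log (Real.exp 1 * n / m))) ≤
            gaussMatrixComplex m n
              {A : Fin m → Fin n → ℂ | ∀ xs : Fin n → ℂ,
                (∀ i, absMv A xs i = absMv A x₀ i) →
                (∀ z : Fin n → ℂ, (∀ i, absMv A z i = absMv A x₀ i) →
                  lpNorm 1 xs ≤ lpNorm 1 z) →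
                phaseDist 2 xs x₀ ≤ C' * sigmaK k 2 x₀} := by
  obtain ⟨C, C', b, hC, hC', hb, h⟩ := exists_recovery_constants
  refine ⟨C, C', 1, b, 4, hC, hC', one_pos, hb, by norm_num, ?_⟩
  intro k n m hk hkn hm x₀
  have hk' : (0 : ℝ) < k := by exact_mod_cast hk
  have hkn' : (k : ℝ) ≤ n := by exact_mod_cast hkn
  rcases le_or_gt (Real.log (Real.exp 1 * n / m)) 0 with hlog | hlog
  · have hlog1 : 0 < Real.log (Real.exp 1 * n / k) := by
      refine Real.log_pos ?_
      rw [lt_div_iff₀ hk']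
      nlinarith [Real.add_one_lt_exp (one_ne_zero : (1 : ℝ) ≠ 0)]
    have hm0 : (0 : ℝ) < m := lt_of_lt_of_le (by positivity) hm
    have hm1 : (1 : ℝ) ≤ m := by exact_mod_cast hm0
    have hexp : 1 ≤ Real.exp (-1 * m / Real.log (Real.exp 1 * n / m)) :=
      Real.one_le_exp (div_nonneg_of_nonpos (by linarith) hlog)
    rw [ENNReal.ofReal_of_nonpos]
    · exact zero_le
    · have h1 := Real.exp_pos (-b * m)
      have h2 := Real.exp_pos (-Real.sqrt (m * n))
      nlinarith
  · refine ENNReal.ofReal_le_of_le_toReal ?_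
    have hbad := h k n m hk hkn hm hlog (WithLp.toLp 2 x₀)
    refine le_trans ?_ (measureReal_mono (setOf_recovery_euclidean_subset k C' x₀)
      (measure_ne_top _ _))
    have hun := measureReal_union_le (μ := gaussMatrixComplex m n)
      {A : Fin m → Fin n → ℂ | ∀ xs : EuclideanSpace ℂ (Fin n),
        (∀ i, ‖matMap A xs i‖ = ‖matMap A (WithLp.toLp 2 x₀) i‖) →
        (∀ z, (∀ i, ‖matMap A z i‖ = ‖matMap A (WithLp.toLp 2 x₀) i‖) →
          sumNorm xs ≤ sumNorm z) →
        phaseDist 2 (fun i => xs i) x₀ ≤ C' * sigmaK k 2 x₀} _ |>.trans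
      (add_le_add_right hbad _)
    rw [Set.union_compl_self, probReal_univ] at hun
    have h2 := Real.exp_pos (-Real.sqrt (m * n))
    have h3 : 0 ≤ 2 * (m : ℝ) * Real.exp (-1 * m / Real.log (Real.exp 1 * n / m)) := by
      positivity
    linarith
end

section
/- There exist universal constants c > 0 and C > 0 such that for every δ ∈ (0, 0.05) and all positive integers m, n with m ≥ C·log(1/δ)·δ^{−2}·n: if A ∈ ℝ^{m×n} is a standard Gaussian random matrix, then with probability at least 1 − 2·exp(−c·δ²·m) there exist constants L, U > 0 with √(π/(π−2)) ≤ U/L ≤ √(π/(π−2)) + δ such that A satisfies the phaseless bi-Lipschitz condition with constants L, U on all of ℝ^n, i.e., L·dist(x,y) ≤ ‖|Ax| − |Ay|‖₂ ≤ U·dist(x,y) for all x, y ∈ ℝ^n. -/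
open MeasureTheory ProbabilityTheory Real Finset

/-- The law of a standard Gaussian random matrix `A ∈ ℝ^{m×n}`: the product over the `m·n`
entries of the real Gaussian measure with mean `0` and variance `1`. -/
noncomputable def gaussMatrixReal (m n : ℕ) : Measure (Fin m → Fin n → ℝ) :=
  Measure.pi fun _ : Fin m => Measure.pi fun _ : Fin n => gaussianReal 0 1

open scoped NNReal ENNReal

section GaussianMoments

lemma integral_gaussianReal_zero_one (f : ℝ → ℝ) :
    ∫ x, f x ∂(gaussianReal 0 1) = (√(2 * π))⁻¹ * ∫ x, Real.exp (-(1 / 2) * x ^ 2) * f x := by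
  rw [integral_gaussianReal_eq_integral_smul one_ne_zero, ← integral_const_mul]
  refine integral_congr_ae (Filter.Eventually.of_forall fun x => ?_)
  simp only [gaussianPDFReal, smul_eq_mul, NNReal.coe_one, mul_one, sub_zero, mul_assoc]
  congr 3
  ring

lemma integral_abs_gaussianReal : ∫ x, |x| ∂(gaussianReal 0 1) = √(2 / π) := by
  rw [integral_gaussianReal_zero_one]
  have h1 := integral_comp_abs (f := fun x => Real.exp (-(1 / 2) * x ^ 2) * x)
  simp only [sq_abs] at h1
  have h2 := integral_rpow_mul_exp_neg_mul_rpow (p := 2) (q := 1) (b := 1 / 2)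
    (by norm_num) (by norm_num) (by norm_num)
  have h3 : ∫ x in Set.Ioi (0 : ℝ), Real.exp (-(1 / 2) * x ^ 2) * x = 1 := by
    have h4 : (1 / 2 : ℝ) ^ (-((1 : ℝ) + 1) / 2) * (1 / 2) * Real.Gamma ((1 + 1) / 2) = 1 := by
      norm_num [Real.rpow_neg_one]
    refine Eq.trans ?_ (h2.trans h4)
    refine integral_congr_ae (Filter.Eventually.of_forall fun x => ?_)
    simp only [Real.rpow_one, Real.rpow_two]
    ring
  rw [h1, h3, mul_one, Real.sqrt_div (by norm_num), Real.sqrt_mul (by norm_num)]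
  have : √2 * √2 = 2 := Real.mul_self_sqrt (by norm_num)
  have h4 : 0 < √π := Real.sqrt_pos.2 Real.pi_pos
  field_simp
  nlinarith

lemma integral_exp_mul_sq_gaussianReal {t : ℝ} (ht : t < 1 / 2) :
    ∫ x, Real.exp (t * x ^ 2) ∂(gaussianReal 0 1) = (√(1 - 2 * t))⁻¹ := by
  rw [integral_gaussianReal_zero_one]
  simp_rw [← Real.exp_add, ← add_mul]
  have := integral_gaussian (1 / 2 - t)
  rw [show -(1 / 2 - t) = -(1 / 2) + t by ring] at this
  rw [this, ← Real.sqrt_inv, ← Real.sqrt_inv, ← Real.sqrt_mul (by positivity)]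
  have : 0 < 1 - 2 * t := by linarith
  have : 0 < 1 / 2 - t := by linarith
  congr 1
  have := Real.pi_pos
  field_simp

lemma integrable_exp_mul_sq_gaussianReal {t : ℝ} (ht : t < 1 / 2) :
    Integrable (fun x => Real.exp (t * x ^ 2)) (gaussianReal 0 1) := by
  by_contra h
  have h1 := integral_exp_mul_sq_gaussianReal ht
  rw [integral_undef h] at h1
  have : 0 < (√(1 - 2 * t))⁻¹ := inv_pos.2 (Real.sqrt_pos.2 (by linarith))
  linarith

lemma integrable_pow_gaussianReal (k : ℕ) : Integrable (fun x => x ^ k) (gaussianReal 0 1) :=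
  ((memLp_id_gaussianReal (μ := 0) (v := 1) k).integrable_norm_pow').mono'
    (by fun_prop) (by simp)

lemma integral_sq_gaussianReal : ∫ x, x ^ 2 ∂(gaussianReal 0 1) = 1 := by
  have h := variance_id_gaussianReal (μ := 0) (v := 1)
  rw [variance_of_integral_eq_zero (by fun_prop) (by simp)] at h
  simpa using h

lemma integral_pow_four_gaussianReal_le : ∫ x, x ^ 4 ∂(gaussianReal 0 1) ≤ 48 := by
  have h1 : ∫ x, x ^ 4 ∂(gaussianReal 0 1) ≤
      ∫ x, 32 * Real.exp (1 / 4 * x ^ 2) ∂(gaussianReal 0 1) := by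
    refine integral_mono (integrable_pow_gaussianReal 4)
      ((integrable_exp_mul_sq_gaussianReal (by norm_num)).const_mul _) fun x => ?_
    have := Real.quadratic_le_exp_of_nonneg (x := 1 / 4 * x ^ 2) (by positivity)
    simp only
    nlinarith [sq_nonneg x]
  rw [integral_const_mul, integral_exp_mul_sq_gaussianReal (by norm_num)] at h1
  have h2 : (√(1 - 2 * (1 / 4 : ℝ)))⁻¹ ≤ 3 / 2 := by
    rw [inv_le_comm₀ (Real.sqrt_pos.2 (by norm_num)) (by norm_num)]
    exact Real.le_sqrt_of_sq_le (by norm_num)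
  linarith

end GaussianMoments

section StdGaussian

variable {E : Type*} [NormedAddCommGroup E] [InnerProductSpace ℝ E] [FiniteDimensional ℝ E]
  [MeasurableSpace E] [BorelSpace E]

lemma covariance_inner_stdGaussian (p q : E) :
    cov[fun x => inner ℝ p x, fun x => inner ℝ q x; stdGaussian E] = inner ℝ p q := by
  rw [← covarianceBilin_apply_eq_cov (IsGaussian.memLp_two_id), covarianceBilin_stdGaussian]
  rfl

lemma map_inner_stdGaussian {u : E} (hu : ‖u‖ = 1) :
    (stdGaussian E).map (fun x => inner ℝ u x) = gaussianReal 0 1 := by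
  have hg : HasGaussianLaw (fun x : E => inner ℝ u x) (stdGaussian E) :=
    (IsGaussian.hasGaussianLaw_id (μ := stdGaussian E)).map (innerSL ℝ u)
  have h0 : ∫ x, inner ℝ u x ∂(stdGaussian E) = 0 :=
    integral_strongDual_stdGaussian (innerSL ℝ u)
  have h1 : Var[fun x => inner ℝ u x; stdGaussian E] = 1 := by
    rw [← covariance_self (by fun_prop), covariance_inner_stdGaussian, real_inner_self_eq_norm_sq,
      hu, one_pow]
  rw [hg.map_eq_gaussianReal, h0, h1, Real.toNNReal_one]

lemma integral_comp_inner_stdGaussian {u : E} (hu : ‖u‖ = 1) {f : ℝ → ℝ} (hf : Measurable f) :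
    ∫ x, f (inner ℝ u x) ∂(stdGaussian E) = ∫ x, f x ∂(gaussianReal 0 1) := by
  rw [← map_inner_stdGaussian hu, integral_map (by fun_prop) hf.aestronglyMeasurable]

lemma integrable_comp_inner_stdGaussian {u : E} (hu : ‖u‖ = 1) {f : ℝ → ℝ} (hf : Measurable f)
    (h : Integrable f (gaussianReal 0 1)) :
    Integrable (fun x => f (inner ℝ u x)) (stdGaussian E) := by
  rw [← map_inner_stdGaussian hu] at h
  exact (integrable_map_measure hf.aestronglyMeasurable (by fun_prop)).1 h

lemma integral_abs_inner_stdGaussian (p : E) :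
    ∫ x, |inner ℝ p x| ∂(stdGaussian E) = ‖p‖ * √(2 / π) := by
  rcases eq_or_ne p 0 with rfl | hp
  · simp
  have hp' : ‖p‖ ≠ 0 := norm_ne_zero_iff.2 hp
  have h : ∀ x, |inner ℝ p x| = ‖p‖ * |inner ℝ (‖p‖⁻¹ • p) x| := fun x => by
    rw [real_inner_smul_left, abs_mul, abs_inv, abs_norm, mul_inv_cancel_left₀ hp']
  simp_rw [h]
  rw [integral_const_mul, integral_comp_inner_stdGaussian (f := fun x => |x|)
    (by rw [norm_smul, norm_inv, norm_norm, inv_mul_cancel₀ hp']) (by fun_prop),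
    integral_abs_gaussianReal]

lemma indepFun_inner_stdGaussian {p q : E} (h : inner ℝ p q = (0 : ℝ)) :
    IndepFun (fun x => inner ℝ p x) (fun x => inner ℝ q x) (stdGaussian E) := by
  refine HasGaussianLaw.indepFun_of_covariance_eq_zero
    ((IsGaussian.hasGaussianLaw_id (μ := stdGaussian E)).map
      ((innerSL ℝ p).prod (innerSL ℝ q))) ?_
  rw [covariance_inner_stdGaussian, h]

lemma integral_abs_inner_mul_abs_inner_stdGaussian {p q : E} (h : inner ℝ p q = (0 : ℝ)) :
    ∫ x, |inner ℝ p x| * |inner ℝ q x| ∂(stdGaussian E) = ‖p‖ * ‖q‖ * (2 / π) := by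
  have hi : IndepFun (fun x => |inner ℝ p x|) (fun x => |inner ℝ q x|) (stdGaussian E) :=
    (indepFun_inner_stdGaussian h).comp (φ := fun x => |x|) (ψ := fun x => |x|)
      (by fun_prop) (by fun_prop)
  rw [hi.integral_fun_mul_eq_mul_integral (by fun_prop) (by fun_prop),
    integral_abs_inner_stdGaussian, integral_abs_inner_stdGaussian]
  have : √(2 / π) * √(2 / π) = 2 / π := Real.mul_self_sqrt (by positivity)
  linear_combination ‖p‖ * ‖q‖ * this

lemma integrable_min_sq_inner_stdGaussian {u : E} (v : E) (hu : ‖u‖ = 1) :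
    Integrable (fun x => min (inner ℝ u x ^ 2) (inner ℝ v x ^ 2)) (stdGaussian E) := by
  refine (integrable_comp_inner_stdGaussian hu (by fun_prop) (integrable_pow_gaussianReal 2)).mono'
    (by fun_prop) (Filter.Eventually.of_forall fun x => ?_)
  rw [Real.norm_of_nonneg (le_min (sq_nonneg _) (sq_nonneg _))]
  exact min_le_left _ _

lemma le_integral_min_sq_inner_stdGaussian {u v : E} (hu : ‖u‖ = 1) (hv : ‖v‖ = 1) :
    1 - 2 / π ≤ ∫ x, min (inner ℝ u x ^ 2) (inner ℝ v x ^ 2) ∂(stdGaussian E) := by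
  have hiu := integrable_comp_inner_stdGaussian hu (by fun_prop) (integrable_pow_gaussianReal 2)
  have hiv := integrable_comp_inner_stdGaussian hv (by fun_prop) (integrable_pow_gaussianReal 2)
  have heq : ∀ x, min (inner ℝ u x ^ 2) (inner ℝ v x ^ 2) =
      (inner ℝ u x ^ 2 + inner ℝ v x ^ 2) / 2 -
        |inner ℝ (u - v) x| * |inner ℝ (u + v) x| / 2 := fun x => by
    rw [inner_sub_left, inner_add_left, ← abs_mul, mul_comm (_ - _), ← sq_sub_sq]
    rcases le_total (inner ℝ u x ^ 2) (inner ℝ v x ^ 2) with h | h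
    · rw [min_eq_left h, abs_of_nonpos (by linarith)]
      ring
    · rw [min_eq_right h, abs_of_nonneg (by linarith)]
      ring
  have hip : Integrable (fun x => |inner ℝ (u - v) x| * |inner ℝ (u + v) x|) (stdGaussian E) := by
    refine (hiu.sub hiv).abs.congr (Filter.Eventually.of_forall fun x => ?_)
    simp only [Pi.sub_apply]
    rw [inner_sub_left, inner_add_left, ← abs_mul]
    ring_nf
  have horth : inner ℝ (u - v) (u + v) = (0 : ℝ) := by
    rw [inner_sub_left, inner_add_right, inner_add_right, real_inner_self_eq_norm_sq,
      real_inner_self_eq_norm_sq, hu, hv, real_inner_comm]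
    ring
  simp_rw [heq]
  have hadd : Integrable (fun x => inner ℝ u x ^ 2 + inner ℝ v x ^ 2) (stdGaussian E) :=
    hiu.add hiv
  rw [integral_sub (hadd.div_const 2) (hip.div_const 2), integral_div, integral_div,
    integral_add hiu hiv, integral_comp_inner_stdGaussian hu (f := fun x => x ^ 2) (by fun_prop),
    integral_comp_inner_stdGaussian hv (f := fun x => x ^ 2) (by fun_prop),
    integral_sq_gaussianReal, integral_abs_inner_mul_abs_inner_stdGaussian horth]
  have h1 := parallelogram_law_with_norm ℝ u v
  rw [hu, hv] at h1
  have h2 : ‖u - v‖ * ‖u + v‖ ≤ 2 := by nlinarith [sq_nonneg (‖u - v‖ - ‖u + v‖)]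
  have h3 : ‖u - v‖ * ‖u + v‖ * (2 / π) ≤ 2 * (2 / π) := by gcongr
  linarith

lemma integral_exp_sq_inner_stdGaussian_le {u : E} (hu : ‖u‖ = 1) {t : ℝ} (ht : 0 ≤ t)
    (ht' : t ≤ 1 / 4) :
    ∫ x, Real.exp (t * inner ℝ u x ^ 2) ∂(stdGaussian E) ≤ Real.exp (t + 2 * t ^ 2) := by
  rw [integral_comp_inner_stdGaussian hu (f := fun x => Real.exp (t * x ^ 2)) (by fun_prop),
    integral_exp_mul_sq_gaussianReal (by linarith)]
  have h1 : 0 < 1 - 2 * t := by linarith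
  rw [inv_le_comm₀ (Real.sqrt_pos.2 h1) (Real.exp_pos _), ← Real.exp_neg]
  refine Real.le_sqrt_of_sq_le ?_
  have h2 := Real.quadratic_le_exp_of_nonneg (x := 2 * (t + 2 * t ^ 2)) (by positivity)
  have h3 : Real.exp (-(t + 2 * t ^ 2)) ^ 2 = (Real.exp (2 * (t + 2 * t ^ 2)))⁻¹ := by
    rw [← Real.exp_nat_mul, ← Real.exp_neg]
    push_cast
    ring_nf
  rw [h3, inv_le_comm₀ (Real.exp_pos _) h1]
  refine le_trans ?_ h2
  rw [inv_le_iff_one_le_mul₀ h1]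
  have h4 : 0 ≤ 2 - 4 * t - 8 * t ^ 2 - 16 * t ^ 3 := by
    have : t ^ 2 ≤ 1 / 16 := by nlinarith
    have : t ^ 3 ≤ 1 / 64 := by nlinarith
    linarith
  nlinarith [mul_nonneg (sq_nonneg t) h4]

lemma exp_neg_le_quadratic {x : ℝ} (hx : 0 ≤ x) : Real.exp (-x) ≤ 1 - x + x ^ 2 / 2 := by
  have h := Real.quadratic_le_exp_of_nonneg hx
  rw [Real.exp_neg]
  refine inv_le_of_inv_le₀ (by nlinarith [sq_nonneg (x - 1)]) (le_trans ?_ h)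
  rw [inv_le_iff_one_le_mul₀ (by nlinarith [sq_nonneg (x - 1)])]
  nlinarith [sq_nonneg (x ^ 2)]

lemma integral_exp_neg_min_sq_inner_stdGaussian_le {u v : E} (hu : ‖u‖ = 1) (hv : ‖v‖ = 1)
    {t : ℝ} (ht : 0 ≤ t) :
    ∫ x, Real.exp (-t * min (inner ℝ u x ^ 2) (inner ℝ v x ^ 2)) ∂(stdGaussian E) ≤
      Real.exp (-t * (1 - 2 / π) + 24 * t ^ 2) := by
  set W : E → ℝ := fun x => min (inner ℝ u x ^ 2) (inner ℝ v x ^ 2) with hW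
  have hi4 := integrable_comp_inner_stdGaussian hu (by fun_prop) (integrable_pow_gaussianReal 4)
  have hiW : Integrable W (stdGaussian E) := integrable_min_sq_inner_stdGaussian v hu
  have hW0 : ∀ x, 0 ≤ W x := fun x => le_min (sq_nonneg _) (sq_nonneg _)
  have hW4 : ∀ x, W x ^ 2 ≤ inner ℝ u x ^ 4 := fun x => by
    rw [show (inner ℝ u x : ℝ) ^ 4 = (inner ℝ u x ^ 2) ^ 2 by ring]
    exact pow_le_pow_left₀ (hW0 x) (min_le_left _ _) 2
  have hiq : Integrable (fun x => 1 - t * W x) (stdGaussian E) :=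
    (integrable_const 1).sub (hiW.const_mul t)
  calc ∫ x, Real.exp (-t * W x) ∂(stdGaussian E)
      ≤ ∫ x, ((1 - t * W x) + t ^ 2 / 2 * inner ℝ u x ^ 4) ∂(stdGaussian E) := by
        refine integral_mono_of_nonneg (Filter.Eventually.of_forall fun x => (Real.exp_pos _).le)
          (hiq.add (hi4.const_mul _)) (Filter.Eventually.of_forall fun x => ?_)
        have h1 := exp_neg_le_quadratic (mul_nonneg ht (hW0 x))
        have h2 := mul_le_mul_of_nonneg_left (hW4 x) (sq_nonneg t)
        simp only [neg_mul]
        nlinarith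
    _ = 1 - t * (∫ x, W x ∂(stdGaussian E)) +
          t ^ 2 / 2 * ∫ x, x ^ 4 ∂(gaussianReal 0 1) := by
        rw [integral_add hiq (hi4.const_mul _), integral_sub (integrable_const 1)
          (hiW.const_mul t), integral_const_mul, integral_const_mul,
          integral_comp_inner_stdGaussian hu (f := fun x => x ^ 4) (by fun_prop)]
        simp
    _ ≤ 1 - t * (1 - 2 / π) + t ^ 2 / 2 * 48 := by
        gcongr
        · exact le_integral_min_sq_inner_stdGaussian hu hv
        · exact integral_pow_four_gaussianReal_le
    _ ≤ Real.exp (-t * (1 - 2 / π) + 24 * t ^ 2) := by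
        have := Real.add_one_le_exp (-t * (1 - 2 / π) + 24 * t ^ 2)
        linarith

end StdGaussian

section SphereNet

variable {E : Type*} [NormedAddCommGroup E] [NormedSpace ℝ E] [FiniteDimensional ℝ E]

open Module Metric in
open scoped Function in
lemma card_le_of_separated_of_norm_le_one {ε : ℝ} (hε : 0 < ε) (s : Finset E)
    (hs : ∀ c ∈ s, ‖c‖ ≤ 1) (h : ∀ c ∈ s, ∀ d ∈ s, c ≠ d → ε ≤ ‖c - d‖) :
    (s.card : ℝ) ≤ (1 + 2 / ε) ^ finrank ℝ E := by
  borelize E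
  let μ : Measure E := Measure.addHaar
  have hδ : 0 < ε / 2 := by positivity
  have hρ : 0 < 1 + ε / 2 := by positivity
  set A := ⋃ c ∈ s, ball (c : E) (ε / 2) with hA
  have hdisj : Set.Pairwise (s : Set E) (Disjoint on fun c => ball (c : E) (ε / 2)) := by
    rintro c hc d hd hcd
    apply ball_disjoint_ball
    rw [dist_eq_norm, add_halves]
    exact h c hc d hd hcd
  have hsub : A ⊆ ball (0 : E) (1 + ε / 2) := by
    refine Set.iUnion₂_subset fun x hx => ball_subset_ball' ?_
    rw [dist_zero_right]
    linarith [hs x hx]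
  have hvol : (s.card : ℝ≥0∞) * ENNReal.ofReal ((ε / 2) ^ finrank ℝ E) * μ (ball 0 1) ≤
      ENNReal.ofReal ((1 + ε / 2) ^ finrank ℝ E) * μ (ball 0 1) :=
    calc (s.card : ℝ≥0∞) * ENNReal.ofReal ((ε / 2) ^ finrank ℝ E) * μ (ball 0 1) = μ A := by
          rw [hA, measure_biUnion_finset hdisj fun c _ => measurableSet_ball]
          simp only [μ.addHaar_ball_of_pos _ hδ]
          simp only [Finset.sum_const, nsmul_eq_mul, mul_assoc]
      _ ≤ μ (ball (0 : E) (1 + ε / 2)) := measure_mono hsub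
      _ = ENNReal.ofReal ((1 + ε / 2) ^ finrank ℝ E) * μ (ball 0 1) := by
          simp only [μ.addHaar_ball_of_pos _ hρ]
  have hcard := (ENNReal.mul_le_mul_iff_left (measure_ball_pos _ _ zero_lt_one).ne'
    measure_ball_lt_top.ne).1 hvol
  have hreal : (s.card : ℝ) * (ε / 2) ^ finrank ℝ E ≤ (1 + ε / 2) ^ finrank ℝ E := by
    have := ENNReal.toReal_le_of_le_ofReal (by positivity) hcard
    rwa [ENNReal.toReal_mul, ENNReal.toReal_natCast, ENNReal.toReal_ofReal (by positivity)] at this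
  rw [show 1 + 2 / ε = (1 + ε / 2) / (ε / 2) by field_simp; ring, div_pow,
    le_div_iff₀ (by positivity)]
  exact hreal

variable (E) in
lemma exists_finset_sphere_net {ε : ℝ} (hε : 0 < ε) :
    ∃ N : Finset E, (∀ u ∈ N, ‖u‖ = 1) ∧ (∀ x : E, ‖x‖ = 1 → ∃ u ∈ N, ‖x - u‖ ≤ ε) ∧
      (N.card : ℝ) ≤ (1 + 2 / ε) ^ Module.finrank ℝ E := by
  classical
  let P : Finset E → Prop := fun s =>
    (∀ c ∈ s, ‖c‖ = 1) ∧ ∀ c ∈ s, ∀ d ∈ s, c ≠ d → ε ≤ ‖c - d‖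
  have hcard : ∀ s, P s → (s.card : ℝ) ≤ (1 + 2 / ε) ^ Module.finrank ℝ E := fun s hs =>
    card_le_of_separated_of_norm_le_one hε s (fun c hc => (hs.1 c hc).le) hs.2
  let S : Set ℕ := {k | ∃ s, P s ∧ s.card = k}
  have hne : S.Nonempty := ⟨0, ∅, by simp [P], rfl⟩
  have hbdd : BddAbove S := by
    refine ⟨⌈(1 + 2 / ε) ^ Module.finrank ℝ E⌉₊, ?_⟩
    rintro _ ⟨s, hs, rfl⟩
    exact_mod_cast (hcard s hs).trans (Nat.le_ceil _)
  obtain ⟨N, hN, hNcard⟩ := Nat.sSup_mem hne hbdd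
  refine ⟨N, hN.1, fun x hx => ?_, hcard N hN⟩
  by_contra! hfar
  have hxN : x ∉ N := fun hmem => by
    have := hfar x hmem
    rw [sub_self, norm_zero] at this
    linarith
  have hmem : (insert x N).card ∈ S := by
    refine ⟨insert x N, ⟨fun c hc => ?_, fun c hc d hd hcd => ?_⟩, rfl⟩
    · rcases Finset.mem_insert.1 hc with rfl | hc
      exacts [hx, hN.1 c hc]
    · rcases Finset.mem_insert.1 hc with rfl | hcN <;>
        rcases Finset.mem_insert.1 hd with rfl | hdN
      · exact absurd rfl hcd
      · exact (hfar d hdN).le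
      · rw [norm_sub_rev]
        exact (hfar c hcN).le
      · exact hN.2 c hcN d hdN hcd
  have hle := le_csSup hbdd hmem
  rw [Finset.card_insert_of_notMem hxN, hNcard] at hle
  omega

end SphereNet

section Concentration

lemma measure_pi_sum_nonneg_le {X : Type*} [MeasurableSpace X] {ν : Measure X}
    [IsProbabilityMeasure ν] {f : X → ℝ} {b : ℝ} (hf : Integrable (fun x => Real.exp (f x)) ν)
    (hb : ∫ x, Real.exp (f x) ∂ν ≤ Real.exp (-b)) (m : ℕ) :
    (Measure.pi fun _ : Fin m => ν).real {A | 0 ≤ ∑ i, f (A i)} ≤ Real.exp (-b * m) := by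
  have hexp : ∀ A : Fin m → X, Real.exp (1 * ∑ i, f (A i)) = ∏ i, Real.exp (f (A i)) :=
    fun A => by rw [one_mul, Real.exp_sum]
  have h_int : Integrable (fun A : Fin m → X => Real.exp (1 * ∑ i, f (A i)))
      (Measure.pi fun _ : Fin m => ν) := by
    simp_rw [hexp]
    exact Integrable.fintype_prod (f := fun _ x => Real.exp (f x)) fun _ => hf
  have h := measure_ge_le_exp_mul_mgf (X := fun A : Fin m → X => ∑ i, f (A i)) 0 zero_le_one h_int
  refine h.trans ?_
  rw [mgf]
  simp_rw [hexp]
  rw [integral_fintype_prod_eq_pow (ι := Fin m) (fun x => Real.exp (f x)), mul_zero, Real.exp_zero,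
    one_mul, Fintype.card_fin, mul_comm, Real.exp_nat_mul]
  exact pow_le_pow_left₀ (integral_nonneg fun x => (Real.exp_pos _).le) hb m

lemma integral_pi_gaussianReal_toLp {n : ℕ} {g : EuclideanSpace ℝ (Fin n) → ℝ}
    (hg : Measurable g) :
    ∫ a, g (WithLp.toLp 2 a) ∂(Measure.pi fun _ : Fin n => gaussianReal 0 1) =
      ∫ x, g x ∂(stdGaussian (EuclideanSpace ℝ (Fin n))) := by
  rw [← map_pi_eq_stdGaussian, integral_map (by fun_prop) hg.aestronglyMeasurable]

lemma integrable_pi_gaussianReal_toLp {n : ℕ} {g : EuclideanSpace ℝ (Fin n) → ℝ}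
    (hg : Measurable g) (h : Integrable g (stdGaussian (EuclideanSpace ℝ (Fin n)))) :
    Integrable (fun a => g (WithLp.toLp 2 a))
      (Measure.pi fun _ : Fin n => gaussianReal 0 1) := by
  rw [← map_pi_eq_stdGaussian] at h
  exact (integrable_map_measure hg.aestronglyMeasurable (by fun_prop)).1 h

instance isProbabilityMeasure_gaussMatrixReal (m n : ℕ) :
    IsProbabilityMeasure (gaussMatrixReal m n) := by
  unfold gaussMatrixReal
  infer_instance

lemma gaussMatrixReal_sum_sq_ge_le (m : ℕ) {n : ℕ} {u : EuclideanSpace ℝ (Fin n)} (hu : ‖u‖ = 1)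
    {s : ℝ} (hs : 0 ≤ s) (hs' : s ≤ 1) :
    (gaussMatrixReal m n).real
      {A | (1 + s) * m ≤ ∑ i, inner ℝ u (WithLp.toLp 2 (A i)) ^ 2} ≤
      Real.exp (-(s ^ 2 / 96) * m) := by
  let g : EuclideanSpace ℝ (Fin n) → ℝ := fun x => s / 4 * inner ℝ u x ^ 2 + -(s / 4 * (1 + s))
  have hgm : Measurable (fun x => Real.exp (g x)) := by fun_prop
  have hgi : Integrable (fun x => Real.exp (g x)) (stdGaussian (EuclideanSpace ℝ (Fin n))) := by
    simp only [g, Real.exp_add]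
    exact (integrable_comp_inner_stdGaussian hu (f := fun x => Real.exp (s / 4 * x ^ 2))
      (by fun_prop) (integrable_exp_mul_sq_gaussianReal (by linarith))).mul_const _
  have hb : ∫ x, Real.exp (g x) ∂(stdGaussian (EuclideanSpace ℝ (Fin n))) ≤
      Real.exp (-(s ^ 2 / 96)) := by
    simp only [g, Real.exp_add]
    rw [integral_mul_const]
    refine (mul_le_mul_of_nonneg_right (integral_exp_sq_inner_stdGaussian_le hu (t := s / 4)
      (by linarith) (by linarith)) (Real.exp_pos _).le).trans ?_
    rw [← Real.exp_add, Real.exp_le_exp]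
    nlinarith [sq_nonneg s]
  have h := measure_pi_sum_nonneg_le (integrable_pi_gaussianReal_toLp hgm hgi)
    ((integral_pi_gaussianReal_toLp hgm).trans_le hb) m
  refine le_trans (measureReal_mono (μ := gaussMatrixReal m n) fun A hA => ?_) h
  simp only [Set.mem_ofPred_eq, g, Finset.sum_add_distrib, ← Finset.mul_sum, Finset.sum_const,
    Finset.card_univ, Fintype.card_fin, nsmul_eq_mul] at hA ⊢
  nlinarith [mul_le_mul_of_nonneg_left hA (by positivity : (0 : ℝ) ≤ s / 4)]

lemma gaussMatrixReal_sum_min_sq_le_le (m : ℕ) {n : ℕ} {u v : EuclideanSpace ℝ (Fin n)}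
    (hu : ‖u‖ = 1) (hv : ‖v‖ = 1) {s : ℝ} (hs : 0 ≤ s) :
    (gaussMatrixReal m n).real
      {A | ∑ i, min (inner ℝ u (WithLp.toLp 2 (A i)) ^ 2) (inner ℝ v (WithLp.toLp 2 (A i)) ^ 2) ≤
        (1 - 2 / π - s) * m} ≤
      Real.exp (-(s ^ 2 / 96) * m) := by
  let g : EuclideanSpace ℝ (Fin n) → ℝ := fun x =>
    -(s / 48) * min (inner ℝ u x ^ 2) (inner ℝ v x ^ 2) + s / 48 * (1 - 2 / π - s)
  have hgm : Measurable (fun x => Real.exp (g x)) := by fun_prop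
  have hle : ∀ x, Real.exp (-(s / 48) * min (inner ℝ u x ^ 2) (inner ℝ v x ^ 2)) ≤ 1 := fun x => by
    rw [Real.exp_le_one_iff, neg_mul, neg_nonpos]
    exact mul_nonneg (by positivity) (le_min (sq_nonneg _) (sq_nonneg _))
  have hgi : Integrable (fun x => Real.exp (g x)) (stdGaussian (EuclideanSpace ℝ (Fin n))) := by
    simp only [g, Real.exp_add]
    refine Integrable.mul_const (Integrable.of_bound (by fun_prop) 1
      (Filter.Eventually.of_forall fun x => ?_)) _
    rw [Real.norm_of_nonneg (Real.exp_pos _).le]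
    exact hle x
  have hb : ∫ x, Real.exp (g x) ∂(stdGaussian (EuclideanSpace ℝ (Fin n))) ≤
      Real.exp (-(s ^ 2 / 96)) := by
    simp only [g, Real.exp_add]
    rw [integral_mul_const]
    refine (mul_le_mul_of_nonneg_right (integral_exp_neg_min_sq_inner_stdGaussian_le hu hv
      (t := s / 48) (by positivity)) (Real.exp_pos _).le).trans ?_
    rw [← Real.exp_add, Real.exp_le_exp]
    nlinarith [sq_nonneg s]
  have h := measure_pi_sum_nonneg_le (integrable_pi_gaussianReal_toLp hgm hgi)
    ((integral_pi_gaussianReal_toLp hgm).trans_le hb) m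
  refine le_trans (measureReal_mono (μ := gaussMatrixReal m n) fun A hA => ?_) h
  simp only [Set.mem_ofPred_eq, g, Finset.sum_add_distrib, ← Finset.mul_sum, Finset.sum_const,
    Finset.card_univ, Fintype.card_fin, nsmul_eq_mul] at hA ⊢
  nlinarith [mul_le_mul_of_nonneg_left hA (by positivity : (0 : ℝ) ≤ s / 48)]

end Concentration

section BiLipschitz

variable {ι : Type*} [Fintype ι]

/-- The entrywise minimum `min (|x i|) (|y i|)` of the moduli of two vectors. -/
noncomputable def minAbs (x y : EuclideanSpace ℝ ι) : EuclideanSpace ℝ ι :=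
  WithLp.toLp 2 fun i => min |x i| |y i|

lemma EuclideanSpace.norm_le_norm_of_abs_le {x y : EuclideanSpace ℝ ι} (h : ∀ i, |x i| ≤ |y i|) :
    ‖x‖ ≤ ‖y‖ := by
  rw [EuclideanSpace.norm_eq, EuclideanSpace.norm_eq]
  gcongr with i
  exact h i

lemma norm_minAbs_le_left (x y : EuclideanSpace ℝ ι) : ‖minAbs x y‖ ≤ ‖x‖ :=
  EuclideanSpace.norm_le_norm_of_abs_le fun i => by
    rw [minAbs, abs_of_nonneg (le_min (abs_nonneg _) (abs_nonneg _))]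
    exact min_le_left _ _

lemma norm_minAbs_le_right (x y : EuclideanSpace ℝ ι) : ‖minAbs x y‖ ≤ ‖y‖ :=
  EuclideanSpace.norm_le_norm_of_abs_le fun i => by
    rw [minAbs, abs_of_nonneg (le_min (abs_nonneg _) (abs_nonneg _))]
    exact min_le_right _ _

lemma norm_minAbs_sq (x y : EuclideanSpace ℝ ι) :
    ‖minAbs x y‖ ^ 2 = ∑ i, min (x i ^ 2) (y i ^ 2) := by
  rw [EuclideanSpace.norm_sq_eq]
  refine Finset.sum_congr rfl fun i _ => ?_
  rw [Real.norm_eq_abs, sq_abs, minAbs]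
  rcases le_total |x i| |y i| with h | h
  · simp only [min_eq_left h, sq_abs, min_eq_left (sq_le_sq.2 h)]
  · simp only [min_eq_right h, sq_abs, min_eq_right (sq_le_sq.2 h)]

lemma norm_minAbs_le_add (x y x' y' : EuclideanSpace ℝ ι) :
    ‖minAbs x y‖ ≤ ‖minAbs x' y'‖ + (‖x - x'‖ + ‖y - y'‖) := by
  let absVec : EuclideanSpace ℝ ι → EuclideanSpace ℝ ι := fun z => WithLp.toLp 2 fun i => |z i|
  have habs : ∀ z, ‖absVec z‖ = ‖z‖ := fun z => by
    simp [absVec, EuclideanSpace.norm_eq]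
  have h : ‖minAbs x y‖ ≤ ‖minAbs x' y' + (absVec (x - x') + absVec (y - y'))‖ := by
    refine EuclideanSpace.norm_le_norm_of_abs_le fun i => ?_
    have h1 := abs_min_sub_min_le_max |x i| |y i| |x' i| |y' i|
    have h2 := max_le_add_of_nonneg (abs_nonneg (|x i| - |x' i|)) (abs_nonneg (|y i| - |y' i|))
    have h3 := abs_abs_sub_abs_le (x i) (x' i)
    have h4 := abs_abs_sub_abs_le (y i) (y' i)
    have h5 := le_abs_self (min |x i| |y i| - min |x' i| |y' i|)
    have h6 : 0 ≤ min |x i| |y i| := le_min (abs_nonneg _) (abs_nonneg _)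
    simp only [minAbs, absVec, PiLp.add_apply, PiLp.sub_apply]
    rw [abs_of_nonneg h6]
    refine le_trans ?_ (le_abs_self _)
    linarith
  refine h.trans ((norm_add_le _ _).trans ?_)
  gcongr
  refine (norm_add_le _ _).trans_eq ?_
  rw [habs, habs]

lemma smul_norm_minAbs_le {a b r : ℝ} (hr : 0 ≤ r) (ha : r ≤ a) (hb : r ≤ b)
    (x y : EuclideanSpace ℝ ι) : r * ‖minAbs x y‖ ≤ ‖minAbs (a • x) (b • y)‖ := by
  rw [← Real.norm_of_nonneg hr, ← norm_smul]
  refine EuclideanSpace.norm_le_norm_of_abs_le fun i => ?_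
  simp only [minAbs, PiLp.smul_apply, smul_eq_mul, abs_mul]
  rw [abs_of_nonneg (le_min (abs_nonneg (x i)) (abs_nonneg (y i))), abs_of_nonneg hr,
    abs_of_nonneg (hr.trans ha), abs_of_nonneg (hr.trans hb)]
  refine le_trans (le_min ?_ ?_) (le_abs_self _)
  · exact mul_le_mul ha (min_le_left _ _) (le_min (abs_nonneg _) (abs_nonneg _)) (hr.trans ha)
  · exact mul_le_mul hb (min_le_right _ _) (le_min (abs_nonneg _) (abs_nonneg _)) (hr.trans hb)

variable {E : Type*} [NormedAddCommGroup E] [NormedSpace ℝ E]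

lemma opNorm_le_of_sphere_net {F : Type*} [NormedAddCommGroup F] [NormedSpace ℝ F] (T : E →L[ℝ] F)
    {N : Finset E} {ε M : ℝ} (hM : 0 ≤ M)
    (hnet : ∀ x : E, ‖x‖ = 1 → ∃ u ∈ N, ‖x - u‖ ≤ ε) (h : ∀ u ∈ N, ‖T u‖ ≤ M) :
    ‖T‖ * (1 - ε) ≤ M := by
  rcases lt_or_ge ε 0 with hε | hε
  · by_cases hE : ∃ x : E, ‖x‖ = 1
    · obtain ⟨x, hx⟩ := hE
      obtain ⟨u, -, hu⟩ := hnet x hx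
      exact absurd (norm_nonneg (x - u)) (by linarith)
    · have : T = 0 := by
        ext x
        by_contra hne
        have hx : ‖x‖ ≠ 0 := fun h0 => hne (by rw [norm_eq_zero.1 h0]; simp)
        exact hE ⟨‖x‖⁻¹ • x, by rw [norm_smul, norm_inv, norm_norm, inv_mul_cancel₀ hx]⟩
      simpa [this] using hM
  · have : ‖T‖ ≤ M + ‖T‖ * ε := by
      refine T.opNorm_le_of_unit_norm (by positivity) fun x hx => ?_
      obtain ⟨u, huN, hu⟩ := hnet x hx
      calc ‖T x‖ = ‖T u + T (x - u)‖ := by rw [← map_add, add_sub_cancel]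
        _ ≤ ‖T u‖ + ‖T (x - u)‖ := norm_add_le _ _
        _ ≤ M + ‖T‖ * ε := by
          gcongr
          · exact h u huN
          · exact T.le_opNorm_of_le hu
    linarith

lemma mul_min_norm_le_norm_minAbs (T : E →L[ℝ] EuclideanSpace ℝ ι) {N : Finset E} {ε ℓ : ℝ}
    (hnet : ∀ x : E, ‖x‖ = 1 → ∃ u ∈ N, ‖x - u‖ ≤ ε)
    (h : ∀ u ∈ N, ∀ v ∈ N, ℓ ≤ ‖minAbs (T u) (T v)‖) (x y : E) :
    (ℓ - 2 * (‖T‖ * ε)) * min ‖x‖ ‖y‖ ≤ ‖minAbs (T x) (T y)‖ := by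
  rcases eq_or_ne x 0 with rfl | hx
  · simp
  rcases eq_or_ne y 0 with rfl | hy
  · simp
  have hx' : ‖x‖ ≠ 0 := norm_ne_zero_iff.2 hx
  have hy' : ‖y‖ ≠ 0 := norm_ne_zero_iff.2 hy
  obtain ⟨u, huN, hu⟩ := hnet (‖x‖⁻¹ • x)
    (by rw [norm_smul, norm_inv, norm_norm, inv_mul_cancel₀ hx'])
  obtain ⟨v, hvN, hv⟩ := hnet (‖y‖⁻¹ • y)
    (by rw [norm_smul, norm_inv, norm_norm, inv_mul_cancel₀ hy'])
  have hunit : ℓ - 2 * (‖T‖ * ε) ≤ ‖minAbs (T (‖x‖⁻¹ • x)) (T (‖y‖⁻¹ • y))‖ := by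
    have h1 := norm_minAbs_le_add (T u) (T v) (T (‖x‖⁻¹ • x)) (T (‖y‖⁻¹ • y))
    rw [← map_sub, ← map_sub] at h1
    rw [norm_sub_rev] at hu hv
    have h2 := T.le_opNorm_of_le hu
    have h3 := T.le_opNorm_of_le hv
    linarith [h u huN v hvN]
  have hscale := smul_norm_minAbs_le (le_min (norm_nonneg x) (norm_nonneg y))
    (min_le_left ‖x‖ ‖y‖) (min_le_right ‖x‖ ‖y‖) (T (‖x‖⁻¹ • x)) (T (‖y‖⁻¹ • y))
  rw [← map_smul, ← map_smul, smul_inv_smul₀ hx', smul_inv_smul₀ hy'] at hscale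
  refine le_trans ?_ hscale
  rw [mul_comm]
  exact mul_le_mul_of_nonneg_left hunit (le_min (norm_nonneg x) (norm_nonneg y))

lemma lpNorm_two_eq_norm (x : ι → ℝ) : lpNorm 2 x = ‖WithLp.toLp 2 x‖ := by
  rw [_root_.lpNorm, EuclideanSpace.norm_eq, Real.sqrt_eq_rpow]
  simp only [Real.rpow_two]

lemma phaseDist_two_eq_min_norm (x y : ι → ℝ) :
    phaseDist 2 x y = min ‖WithLp.toLp 2 (x - y)‖ ‖WithLp.toLp 2 (x + y)‖ := by
  have hset : {d | ∃ c : ℝ, ‖c‖ = 1 ∧ d = lpNorm 2 (fun i => x i - c * y i)} =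
      {‖WithLp.toLp 2 (x - y)‖, ‖WithLp.toLp 2 (x + y)‖} := by
    have h1 : (fun i => x i - 1 * y i) = x - y := by ext i; simp
    have h2 : (fun i => x i - -1 * y i) = x + y := by ext i; simp
    ext d
    simp only [lpNorm_two_eq_norm, Set.mem_ofPred_eq, Set.mem_insert_iff, Set.mem_singleton_iff]
    constructor
    · rintro ⟨c, hc, rfl⟩
      rcases eq_or_eq_neg_of_abs_eq hc with rfl | rfl
      · exact Or.inl (by rw [h1])
      · exact Or.inr (by rw [h2])
    · rintro (rfl | rfl)
      · exact ⟨1, by simp, by rw [h1]⟩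
      · exact ⟨-1, by simp, by rw [h2]⟩
  rw [phaseDist, hset, csInf_pair]

/-- The linear map `x ↦ A x` between Euclidean spaces. -/
noncomputable def euclideanMulVec {m n : ℕ} (A : Fin m → Fin n → ℝ) :
    EuclideanSpace ℝ (Fin n) →L[ℝ] EuclideanSpace ℝ (Fin m) :=
  (Matrix.toEuclideanLin (Matrix.of A)).toContinuousLinearMap

lemma euclideanMulVec_apply {m n : ℕ} (A : Fin m → Fin n → ℝ) (x : EuclideanSpace ℝ (Fin n))
    (i : Fin m) : euclideanMulVec A x i = ∑ j, A i j * x j := rfl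

lemma euclideanMulVec_apply_eq_inner {m n : ℕ} (A : Fin m → Fin n → ℝ)
    (x : EuclideanSpace ℝ (Fin n)) (i : Fin m) :
    euclideanMulVec A x i = inner ℝ x (WithLp.toLp 2 (A i)) := by
  simp [euclideanMulVec_apply, PiLp.inner_apply]

lemma abs_abs_sub_abs_eq_min (a b : ℝ) : |(|a| - |b|)| = min |a - b| |a + b| := by
  rcases abs_cases a with ⟨ha, ha'⟩ | ⟨ha, ha'⟩ <;> rcases abs_cases b with ⟨hb, hb'⟩ | ⟨hb, hb'⟩ <;>
    rcases abs_cases (a - b) with ⟨hs, hs'⟩ | ⟨hs, hs'⟩ <;>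
    rcases abs_cases (a + b) with ⟨ht, ht'⟩ | ⟨ht, ht'⟩ <;>
    rcases abs_cases (|a| - |b|) with ⟨hd, hd'⟩ | ⟨hd, hd'⟩ <;>
    rcases min_cases |a - b| |a + b| with ⟨hm, hm'⟩ | ⟨hm, hm'⟩ <;> linarith

lemma lpNorm_absMv_sub_eq {m n : ℕ} (A : Fin m → Fin n → ℝ) (x y : Fin n → ℝ) :
    lpNorm 2 (fun i => absMv A x i - absMv A y i) =
      ‖minAbs (euclideanMulVec A (WithLp.toLp 2 (x - y)))
        (euclideanMulVec A (WithLp.toLp 2 (x + y)))‖ := by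
  rw [lpNorm_two_eq_norm, EuclideanSpace.norm_eq, EuclideanSpace.norm_eq]
  congr 2 with i
  change ‖|∑ j, A i j * x j| - |∑ j, A i j * y j|‖ ^ 2 = _
  rw [Real.norm_eq_abs, abs_abs_sub_abs_eq_min]
  simp only [minAbs, euclideanMulVec_apply, Pi.sub_apply, Pi.add_apply, mul_sub, mul_add,
    Finset.sum_sub_distrib, Finset.sum_add_distrib, Real.norm_eq_abs]
  rw [abs_of_nonneg (a := min _ _) (le_min (abs_nonneg _) (abs_nonneg _))]

lemma phaselessBiLip_of_norm_minAbs {m n : ℕ} {A : Fin m → Fin n → ℝ} {L U : ℝ}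
    (hU : ‖euclideanMulVec A‖ ≤ U)
    (hL : ∀ x y, L * min ‖x‖ ‖y‖ ≤ ‖minAbs (euclideanMulVec A x) (euclideanMulVec A y)‖) :
    PhaselessBiLip A Set.univ L U := by
  intro x _ y _
  rw [lpNorm_absMv_sub_eq, phaseDist_two_eq_min_norm]
  refine ⟨hL _ _, ?_⟩
  have hT := fun z => (euclideanMulVec A).le_of_opNorm_le hU z
  rcases min_choice ‖WithLp.toLp 2 (x - y)‖ ‖WithLp.toLp 2 (x + y)‖ with h | h <;> rw [h]
  · exact (norm_minAbs_le_left _ _).trans (hT _)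
  · exact (norm_minAbs_le_right _ _).trans (hT _)

end BiLipschitz

lemma sqrt_pi_div_pi_sub_two : √(π / (π - 2)) = (√(1 - 2 / π))⁻¹ := by
  rw [← Real.sqrt_inv]
  congr 1
  have h1 := Real.pi_gt_three
  have h2 : π - 2 ≠ 0 := by linarith
  field_simp

lemma exists_phaselessBiLip_of_sphere_net {m n : ℕ} (hm : 0 < m) {δ : ℝ} (hδ : 0 < δ)
    (hδ' : δ < 0.05) {A : Fin m → Fin n → ℝ} {N : Finset (EuclideanSpace ℝ (Fin n))}
    (hnet : ∀ x : EuclideanSpace ℝ (Fin n), ‖x‖ = 1 → ∃ u ∈ N, ‖x - u‖ ≤ δ / 100)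
    (hup : ∀ u ∈ N, ‖euclideanMulVec A u‖ ^ 2 ≤ (1 + δ / 10) * m)
    (hlow : ∀ u ∈ N, ∀ v ∈ N, (1 - 2 / π - δ / 10) * m ≤
      ‖minAbs (euclideanMulVec A u) (euclideanMulVec A v)‖ ^ 2) :
    ∃ L U : ℝ, 0 < L ∧ 0 < U ∧ √(π / (π - 2)) ≤ U / L ∧ U / L ≤ √(π / (π - 2)) + δ ∧
      PhaselessBiLip A Set.univ L U := by
  have hκ : (0.36 : ℝ) ≤ 1 - 2 / π := by
    have h1 : 2 / π ≤ 0.64 := by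
      rw [div_le_iff₀ Real.pi_pos]
      linarith [Real.pi_gt_d2]
    linarith
  set q := √(1 - 2 / π) with hq
  have hq6 : 0.6 ≤ q := Real.le_sqrt_of_sq_le (by linarith)
  have hq2 : q ^ 2 = 1 - 2 / π := Real.sq_sqrt (by linarith)
  set r := √(m : ℝ) with hr
  have hr0 : 0 < r := Real.sqrt_pos.2 (by exact_mod_cast hm)
  have hr2 : r ^ 2 = m := Real.sq_sqrt (by positivity)
  have hT : ‖euclideanMulVec A‖ ≤ r * (1 + δ / 10) := by
    have h1 : ∀ u ∈ N, ‖euclideanMulVec A u‖ ≤ r * (1 + δ / 20) := fun u hu => by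
      refine abs_le_of_sq_le_sq' ?_ (by positivity) |>.2
      rw [mul_pow, hr2]
      refine (hup u hu).trans ?_
      rw [mul_comm]
      gcongr
      nlinarith
    have h2 := opNorm_le_of_sphere_net (euclideanMulVec A) (by positivity) hnet h1
    have h3 : r * (1 + δ / 20) ≤ r * (1 + δ / 10) * (1 - δ / 100) := by
      rw [mul_assoc]
      gcongr
      nlinarith
    exact le_of_mul_le_mul_right (h2.trans h3) (by linarith)
  have hlow' : ∀ u ∈ N, ∀ v ∈ N, r * (q - δ / 10) ≤
      ‖minAbs (euclideanMulVec A u) (euclideanMulVec A v)‖ := fun u hu v hv => by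
    refine abs_le_of_sq_le_sq' ?_ (norm_nonneg _) |>.2
    refine le_trans ?_ (hlow u hu v hv)
    rw [mul_pow, hr2, mul_comm, ← hq2]
    gcongr
    nlinarith
  have hL0 : 0 < q - 0.13 * δ := by linarith
  refine ⟨r * (q - 0.13 * δ), r * (1 + δ / 10), by positivity, by positivity, ?_, ?_,
    phaselessBiLip_of_norm_minAbs hT fun x y => ?_⟩
  · rw [sqrt_pi_div_pi_sub_two, mul_div_mul_left _ _ hr0.ne', ← one_div]
    exact div_le_div₀ (by positivity) (by linarith) hL0 (by linarith)
  · rw [sqrt_pi_div_pi_sub_two, mul_div_mul_left _ _ hr0.ne', div_le_iff₀ hL0]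
    have hinv : q⁻¹ * q = 1 := inv_mul_cancel₀ (by linarith)
    have hinv' : q⁻¹ ≤ 5 / 3 := by
      rw [inv_le_comm₀ (by linarith) (by norm_num)]
      linarith
    nlinarith [mul_le_mul_of_nonneg_right hinv' hδ.le, mul_le_mul_of_nonneg_left hq6 hδ.le]
  · refine le_trans ?_ (mul_min_norm_le_norm_minAbs (euclideanMulVec A) hnet hlow' x y)
    gcongr
    have h1 : ‖euclideanMulVec A‖ * (δ / 100) ≤ r * (1 + δ / 10) * (δ / 100) := by gcongr
    nlinarith [mul_pos hr0 hδ]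

lemma sphere_net_card_sq_mul_exp_le {δ : ℝ} (hδ : 0 < δ) (hδ' : δ < 0.05) {m n k : ℕ}
    (hm : 120000 * Real.log (1 / δ) * δ⁻¹ ^ 2 * n ≤ m)
    (hk : (k : ℝ) ≤ (1 + 2 / (δ / 100)) ^ n) :
    (k : ℝ) ^ 2 * Real.exp (-((δ / 10) ^ 2 / 96) * m) ≤ Real.exp (-(1 / 20000) * δ ^ 2 * m) := by
  have hbase : 1 + 2 / (δ / 100) ≤ (1 / δ) ^ 3 := by
    rw [div_pow, one_pow, le_div_iff₀ (by positivity)]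
    have : (1 + 2 / (δ / 100)) * δ ^ 3 = δ ^ 3 + 200 * δ ^ 2 := by
      field_simp
      ring
    nlinarith [sq_nonneg δ]
  have hexp : (1 / δ) ^ 3 = Real.exp (3 * Real.log (1 / δ)) := by
    rw [show (3 : ℝ) * Real.log (1 / δ) = (3 : ℕ) * Real.log (1 / δ) by norm_num, Real.exp_nat_mul,
      Real.exp_log (by positivity)]
  have hk2 : (k : ℝ) ^ 2 ≤ Real.exp (6 * n * Real.log (1 / δ)) := by
    calc (k : ℝ) ^ 2 ≤ ((Real.exp (3 * Real.log (1 / δ))) ^ n) ^ 2 := by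
          rw [← hexp]
          exact pow_le_pow_left₀ (by positivity)
            (hk.trans (pow_le_pow_left₀ (by positivity) hbase n)) 2
      _ = Real.exp (6 * n * Real.log (1 / δ)) := by
          rw [← Real.exp_nat_mul, ← Real.exp_nat_mul]
          push_cast
          ring_nf
  refine (mul_le_mul_of_nonneg_right hk2 (Real.exp_pos _).le).trans ?_
  rw [← Real.exp_add, Real.exp_le_exp]
  have h1 := mul_le_mul_of_nonneg_right hm (sq_nonneg δ)
  have h2 : 120000 * Real.log (1 / δ) * δ⁻¹ ^ 2 * n * δ ^ 2 = 120000 * Real.log (1 / δ) * n := by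
    field_simp
  have h3 : 0 ≤ (m : ℝ) * δ ^ 2 := by positivity
  nlinarith

lemma gaussMatrixReal_not_good_on_finset_le {m n : ℕ} {s : ℝ} (hs : 0 ≤ s) (hs' : s ≤ 1)
    {N : Finset (EuclideanSpace ℝ (Fin n))} (hN : ∀ u ∈ N, ‖u‖ = 1) :
    (gaussMatrixReal m n).real {A | ¬ ((∀ u ∈ N, ‖euclideanMulVec A u‖ ^ 2 ≤ (1 + s) * m) ∧
      ∀ u ∈ N, ∀ v ∈ N, (1 - 2 / π - s) * m ≤
        ‖minAbs (euclideanMulVec A u) (euclideanMulVec A v)‖ ^ 2)} ≤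
      2 * ((N.card : ℝ) ^ 2 * Real.exp (-(s ^ 2 / 96) * m)) := by
  let B₁ : EuclideanSpace ℝ (Fin n) → Set (Fin m → Fin n → ℝ) := fun u =>
    {A | (1 + s) * m ≤ ∑ i, inner ℝ u (WithLp.toLp 2 (A i)) ^ 2}
  let B₂ : EuclideanSpace ℝ (Fin n) × EuclideanSpace ℝ (Fin n) → Set (Fin m → Fin n → ℝ) :=
    fun p => {A | ∑ i, min (inner ℝ p.1 (WithLp.toLp 2 (A i)) ^ 2)
      (inner ℝ p.2 (WithLp.toLp 2 (A i)) ^ 2) ≤ (1 - 2 / π - s) * m}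
  have hsub : {A | ¬ ((∀ u ∈ N, ‖euclideanMulVec A u‖ ^ 2 ≤ (1 + s) * m) ∧
      ∀ u ∈ N, ∀ v ∈ N, (1 - 2 / π - s) * m ≤
        ‖minAbs (euclideanMulVec A u) (euclideanMulVec A v)‖ ^ 2)} ⊆
      (⋃ u ∈ N, B₁ u) ∪ ⋃ p ∈ N ×ˢ N, B₂ p := by
    intro A hA
    by_contra hnot
    simp only [Set.mem_union, Set.mem_iUnion, not_or, not_exists, B₁, B₂, Set.mem_ofPred_eq,
      not_le] at hnot
    refine hA ⟨fun u hu => ?_, fun u hu v hv => ?_⟩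
    · have h := hnot.1 u hu
      rw [EuclideanSpace.norm_sq_eq]
      simp only [Real.norm_eq_abs, sq_abs, euclideanMulVec_apply_eq_inner]
      exact h.le
    · have h := hnot.2 (u, v) (Finset.mem_product.2 ⟨hu, hv⟩)
      rw [norm_minAbs_sq]
      simp only [euclideanMulVec_apply_eq_inner]
      exact h.le
  set e := Real.exp (-(s ^ 2 / 96) * m) with he
  have h₁ : (gaussMatrixReal m n).real (⋃ u ∈ N, B₁ u) ≤ N.card * e := by
    refine (measureReal_biUnion_finset_le N B₁).trans ?_
    rw [← nsmul_eq_mul]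
    exact Finset.sum_le_card_nsmul _ _ _ fun u hu =>
      gaussMatrixReal_sum_sq_ge_le m (hN u hu) hs hs'
  have h₂ : (gaussMatrixReal m n).real (⋃ p ∈ N ×ˢ N, B₂ p) ≤ (N ×ˢ N).card * e := by
    refine (measureReal_biUnion_finset_le (N ×ˢ N) B₂).trans ?_
    rw [← nsmul_eq_mul]
    refine Finset.sum_le_card_nsmul _ _ _ fun p hp => ?_
    rw [Finset.mem_product] at hp
    exact gaussMatrixReal_sum_min_sq_le_le m (hN _ hp.1) (hN _ hp.2) hs
  have hcard : (N.card : ℝ) ≤ (N.card : ℝ) ^ 2 := by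
    exact_mod_cast Nat.le_self_pow two_ne_zero N.card
  have hcard' : (N.card : ℝ) * e ≤ (N.card : ℝ) ^ 2 * e := by gcongr
  rw [Finset.card_product, Nat.cast_mul, ← sq] at h₂
  have h₃ := (measureReal_mono (μ := gaussMatrixReal m n) hsub).trans (measureReal_union_le _ _)
  linarith

/-- Theorem `thm: complex_beta`, real case: a standard Gaussian random matrix
`A ∈ ℝ^{m×n}` with `m ≥ C·log(1/δ)·δ⁻²·n` satisfies, with probability at least
`1 - 2exp(-c·δ²·m)`, the phaseless bi-Lipschitz condition on all of `ℝ^n` with constants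
`L, U` such that `√(π/(π-2)) ≤ U/L ≤ √(π/(π-2)) + δ`. -/
theorem stmt15 :
    ∃ c C : ℝ, 0 < c ∧ 0 < C ∧
      ∀ δ : ℝ, 0 < δ → δ < 0.05 →
        ∀ m n : ℕ, 0 < m → 0 < n →
          C * Real.log (1 / δ) * δ⁻¹ ^ 2 * n ≤ m →
          ENNReal.ofReal (1 - 2 * Real.exp (-c * δ ^ 2 * m)) ≤
            gaussMatrixReal m n
              {A : Fin m → Fin n → ℝ | ∃ L U : ℝ, 0 < L ∧ 0 < U ∧
                Real.sqrt (π / (π - 2)) ≤ U / L ∧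
                U / L ≤ Real.sqrt (π / (π - 2)) + δ ∧
                PhaselessBiLip A Set.univ L U} := by
  refine ⟨1 / 20000, 120000, by norm_num, by norm_num, fun δ hδ hδ' m n hm _ hmn => ?_⟩
  obtain ⟨N, hN, hnet, hcard⟩ :=
    exists_finset_sphere_net (EuclideanSpace ℝ (Fin n)) (ε := δ / 100) (by positivity)
  rw [finrank_euclideanSpace, Fintype.card_fin] at hcard
  have hbad := (gaussMatrixReal_not_good_on_finset_le (m := m) (s := δ / 10) (by positivity)
    (by linarith) hN).trans
    (mul_le_mul_of_nonneg_left (sphere_net_card_sq_mul_exp_le hδ hδ' hmn hcard) zero_le_two)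
  refine ENNReal.ofReal_le_of_le_toReal ?_
  rw [← measureReal_def, sub_le_iff_le_add]
  refine le_trans ?_ (add_le_add_right hbad _)
  refine (probReal_univ (μ := gaussMatrixReal m n)).symm.trans_le
    (le_trans (measureReal_mono fun A _ => ?_) (measureReal_union_le _ _))
  by_cases hA : (∀ u ∈ N, ‖euclideanMulVec A u‖ ^ 2 ≤ (1 + δ / 10) * m) ∧
      ∀ u ∈ N, ∀ v ∈ N, (1 - 2 / π - δ / 10) * m ≤
        ‖minAbs (euclideanMulVec A u) (euclideanMulVec A v)‖ ^ 2
  · exact Or.inl (exists_phaselessBiLip_of_sphere_net hm hδ hδ' hnet hA.1 hA.2)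
  · exact Or.inr hA
end
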